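/- arXiv:funct-an/9712004 — 6 statements merged into one kernel-verified Lean document; each statement's English description precedes it below -/
import Mathlib

section
/- Let M : ℂ₊ → M_n(ℂ) be an n×n matrix-valued Herglotz function, and suppose there exists a Borel set E ⊆ ℝ of positive Lebesgue measure such that for every j ∈ {1,…,n} and every λ ∈ E the normal limit lim_{ε↓0} M(λ + iε)_{j,j} exists and equals 0. Then M is constant on ℂ₊: M(z) = C₀ for all z ∈ ℂ₊, where C₀ is a self-adjoint n×n matrix (C₀ = C₀*) whose diagonal entries all vanish. -/
open Matrix MeasureTheory Filter Topology
open scoped ComplexOrder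

/-- The "imaginary part" `(M - M*)/(2i)` of a complex square matrix. -/
noncomputable def matIm {n : ℕ} (M : Matrix (Fin n) (Fin n) ℂ) : Matrix (Fin n) (Fin n) ℂ :=
  (2 * Complex.I)⁻¹ • (M - Mᴴ)

/-- A holomorphic function on the upper half-plane with nonnegative real part grows at most like
`C / y` near a compact interval of the real line. -/
lemma exists_norm_le_div_im_of_re_nonneg {g : ℂ → ℂ}
    (hg : DifferentiableOn ℂ g {z : ℂ | 0 < z.im}) (hre : ∀ z : ℂ, 0 < z.im → 0 ≤ (g z).re)
    (R : ℝ) :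
    ∃ C : ℝ, 0 ≤ C ∧ ∀ x ∈ Set.Icc (-R) R, ∀ y ∈ Set.Ioc (0 : ℝ) 1,
      ‖g ((x : ℂ) + y * Complex.I)‖ ≤ C / y := by
  have hcont : ContinuousOn (fun x : ℝ => g ((x : ℂ) + Complex.I)) (Set.Icc (-R) R) := by
    refine hg.continuousOn.comp (by fun_prop) ?_
    intro x _
    simp
  obtain ⟨B, hB⟩ := isCompact_Icc.exists_bound_of_continuousOn hcont
  refine ⟨2 + 2 * |B|, by positivity, fun x hx y hy => ?_⟩
  have hball : ∀ w ∈ Metric.ball (0 : ℂ) 1, 0 < ((x : ℂ) + Complex.I + w).im := by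
    intro w hw
    have h1 := (abs_lt.mp ((Complex.abs_im_le_norm w).trans_lt (mem_ball_zero_iff.mp hw))).1
    simp
    linarith
  have hnorm : ‖(((y - 1 : ℝ) : ℂ) * Complex.I)‖ = 1 - y := by
    rw [norm_mul, Complex.norm_I, mul_one, Complex.norm_real, Real.norm_eq_abs,
      abs_of_nonpos (by linarith [hy.2])]
    ring
  have key := Complex.borelCaratheodory (f := fun w => -g ((x : ℂ) + Complex.I + w)) (M := 1)
    (R := 1) (z := ((y - 1 : ℝ) : ℂ) * Complex.I) one_pos
    ((hg.comp (by fun_prop) hball).neg)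
    (fun w hw => by
      have := hre _ (hball w hw)
      simp only [Set.mem_ofPred_eq, Complex.neg_re]
      linarith) one_pos
    (by rw [mem_ball_zero_iff, hnorm]; linarith [hy.1])
  have hpt : (x : ℂ) + Complex.I + ((y - 1 : ℝ) : ℂ) * Complex.I = (x : ℂ) + y * Complex.I := by
    push_cast; ring
  rw [hnorm, hpt, norm_neg, norm_neg, add_zero, ← add_div] at key
  have hy0 := hy.1
  have hBx : ‖g ((x : ℂ) + Complex.I)‖ ≤ |B| := (hB x hx).trans (le_abs_self B)
  refine key.trans ?_
  rw [show (1 : ℝ) - (1 - y) = y by ring]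
  refine div_le_div_of_nonneg_right ?_ hy0.le
  nlinarith [norm_nonneg (g ((x : ℂ) + Complex.I))]

/-- For a holomorphic function on the upper half-plane with nonnegative real part, the integrals
of the real part over horizontal segments, with a weight vanishing at the end points, are bounded
uniformly in the height. -/
lemma exists_integral_re_mul_le_of_re_nonneg {g : ℂ → ℂ}
    (hg : DifferentiableOn ℂ g {z : ℂ | 0 < z.im}) (hre : ∀ z : ℂ, 0 < z.im → 0 ≤ (g z).re)
    {R : ℝ} (hR : 0 < R) :
    ∃ C : ℝ, ∀ ε ∈ Set.Ioc (0 : ℝ) 1,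
      ∫ t in (-R)..R, (g ((t : ℂ) + ε * Complex.I)).re * (R ^ 2 - t ^ 2) ≤ C := by
  obtain ⟨C, hC0, hC⟩ := exists_norm_le_div_im_of_re_nonneg hg hre R
  refine ⟨C * (R ^ 2 + (R + 1) ^ 2) * (2 * R) + C * (2 * R + 1) + C * (2 * R + 1),
    fun ε hε => ?_⟩
  have hε0 := hε.1
  have hε1 := hε.2
  set f : ℂ → ℂ := fun z => g z * ((R : ℂ) ^ 2 - (z - ε * Complex.I) ^ 2) with hf
  have hfd : DifferentiableOn ℂ f {z : ℂ | 0 < z.im} := hg.mul (by fun_prop)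
  have hrect := Complex.integral_boundary_rect_eq_zero_of_differentiableOn f
    (⟨-R, ε⟩ : ℂ) (⟨R, 1⟩ : ℂ) (hfd.mono (by
      intro z hz
      have hz2 := hz.2
      simp only [Set.mem_preimage, Set.uIcc_of_le hε1] at hz2
      exact hε0.trans_le hz2.1))
  simp only at hrect
  have htop : ‖∫ x : ℝ in (-R)..R, f (x + (1 : ℝ) * Complex.I)‖
      ≤ C * (R ^ 2 + (R + 1) ^ 2) * (2 * R) := by
    have h := intervalIntegral.norm_integral_le_of_norm_le_const (a := -R) (b := R)
      (f := fun x : ℝ => f (x + (1 : ℝ) * Complex.I)) (C := C * (R ^ 2 + (R + 1) ^ 2)) ?_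
    · rwa [show |R - -R| = 2 * R by rw [abs_of_nonneg] <;> linarith] at h
    · intro x hx
      rw [Set.uIoc_of_le (by linarith)] at hx
      have h1 := hC x ⟨hx.1.le, hx.2⟩ 1 ⟨one_pos, le_rfl⟩
      rw [div_one] at h1
      rw [hf, norm_mul]
      refine mul_le_mul h1 ?_ (norm_nonneg _) hC0
      refine (norm_sub_le _ _).trans ?_
      rw [norm_pow, norm_pow, Complex.norm_real, Real.norm_eq_abs, abs_of_pos hR]
      gcongr
      rw [show (x : ℂ) + (1 : ℝ) * Complex.I - ε * Complex.I
        = (x : ℂ) + ((1 - ε : ℝ) : ℂ) * Complex.I by push_cast; ring]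
      refine (norm_add_le _ _).trans ?_
      rw [norm_mul, Complex.norm_I, mul_one, Complex.norm_real, Complex.norm_real,
        Real.norm_eq_abs, Real.norm_eq_abs, abs_of_nonneg (sub_nonneg.mpr hε1)]
      have : |x| ≤ R := abs_le.mpr ⟨hx.1.le, hx.2⟩
      linarith
  have hside : ∀ r : ℝ, |r| = R → ‖∫ y : ℝ in ε..1, f (r + y * Complex.I)‖
      ≤ C * (2 * R + 1) := by
    intro r hr
    have h := intervalIntegral.norm_integral_le_of_norm_le_const (a := ε) (b := 1)
      (f := fun y : ℝ => f (r + y * Complex.I)) (C := C * (2 * R + 1)) ?_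
    · refine h.trans (mul_le_of_le_one_right (by positivity) ?_)
      rw [abs_of_nonneg] <;> linarith
    · intro y hy
      rw [Set.uIoc_of_le hε1] at hy
      have hy0 : 0 < y := hε0.trans hy.1
      have h1 := hC r (abs_le.mp hr.le) y ⟨hy0, hy.2⟩
      have hr2 : (R : ℂ) ^ 2 = (r : ℂ) ^ 2 := by
        rw [← Complex.ofReal_pow, ← Complex.ofReal_pow, ← hr, sq_abs]
      have hk : (R : ℂ) ^ 2 - (r + y * Complex.I - ε * Complex.I) ^ 2
          = ((y - ε : ℝ) : ℂ) * (((y - ε : ℝ) : ℂ) - 2 * r * Complex.I) := by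
        rw [hr2]
        push_cast
        linear_combination (-((y : ℂ) - ε) ^ 2) * Complex.I_sq
      have h2 : ‖(R : ℂ) ^ 2 - (r + y * Complex.I - ε * Complex.I) ^ 2‖ ≤ y * (2 * R + 1) := by
        rw [hk, norm_mul, Complex.norm_real, Real.norm_eq_abs,
          abs_of_pos (sub_pos.mpr hy.1)]
        refine mul_le_mul (by linarith) ((norm_sub_le _ _).trans ?_) (norm_nonneg _) hy0.le
        rw [norm_mul, norm_mul, Complex.norm_I, Complex.norm_real, Complex.norm_real,
          Real.norm_eq_abs, Real.norm_eq_abs, hr, abs_of_pos (sub_pos.mpr hy.1)]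
        norm_num
        linarith [hy.2]
      rw [hf, norm_mul]
      calc _ ≤ C / y * (y * (2 * R + 1)) := mul_le_mul h1 h2 (norm_nonneg _) (by positivity)
        _ = C * (2 * R + 1) := by field_simp
  have hbot : ∫ t in (-R)..R, (g ((t : ℂ) + ε * Complex.I)).re * (R ^ 2 - t ^ 2)
      = (∫ x : ℝ in (-R)..R, f (x + ε * Complex.I)).re := by
    have hint : IntervalIntegrable (fun x : ℝ => f (x + ε * Complex.I)) volume (-R) R := by
      refine ContinuousOn.intervalIntegrable (hfd.continuousOn.comp (by fun_prop) ?_)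
      intro x _
      simpa using hε0
    have h := Complex.reCLM.intervalIntegral_comp_comm hint
    simp only [Complex.reCLM_apply] at h
    rw [← h]
    refine intervalIntegral.integral_congr fun t _ => ?_
    simp only [hf, add_sub_cancel_right]
    rw [← Complex.ofReal_pow, ← Complex.ofReal_pow, ← Complex.ofReal_sub, Complex.re_mul_ofReal]
  rw [hbot]
  refine (Complex.re_le_norm _).trans ?_
  have hs1 := hside R (abs_of_pos hR)
  have hs2 := hside (-R) (by rw [abs_neg, abs_of_pos hR])
  have heq : (∫ x : ℝ in (-R)..R, f (x + ε * Complex.I))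
      = (∫ x : ℝ in (-R)..R, f (x + (1 : ℝ) * Complex.I))
        - Complex.I • (∫ y : ℝ in ε..1, f ((R : ℝ) + y * Complex.I))
        + Complex.I • (∫ y : ℝ in ε..1, f ((-R : ℝ) + y * Complex.I)) := by
    linear_combination hrect
  rw [heq]
  refine (norm_add_le _ _).trans (add_le_add ((norm_sub_le _ _).trans (add_le_add htop ?_)) ?_)
  · rwa [norm_smul, Complex.norm_I, one_mul]
  · rwa [norm_smul, Complex.norm_I, one_mul]

/-- The real part of a holomorphic function on the upper half-plane with nonnegative real part
can have infinite normal limits only on a Lebesgue null set. -/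
lemma volume_eq_zero_of_tendsto_re_atTop {g : ℂ → ℂ}
    (hg : DifferentiableOn ℂ g {z : ℂ | 0 < z.im}) (hre : ∀ z : ℂ, 0 < z.im → 0 ≤ (g z).re)
    {E : Set ℝ} (hE : MeasurableSet E)
    (hlim : ∀ l ∈ E, Tendsto (fun ε : ℝ => (g ((l : ℂ) + ε * Complex.I)).re) (𝓝[>] 0) atTop) :
    volume E = 0 := by
  have hcover : E ⊆ ⋃ n : ℕ, E ∩ Set.Ioo (-(n + 1 : ℝ)) (n + 1) := by
    intro x hx
    obtain ⟨n, hn⟩ := exists_nat_gt |x|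
    exact Set.mem_iUnion.mpr ⟨n, hx, abs_lt.mp (hn.trans (by linarith))⟩
  refine measure_mono_null hcover (measure_iUnion_null fun n => ?_)
  set R : ℝ := n + 1 with hRdef
  have hR : 0 < R := by positivity
  obtain ⟨C, hC⟩ := exists_integral_re_mul_le_of_re_nonneg hg hre hR
  set ε : ℕ → ℝ := fun k => 1 / ((k : ℝ) + 1) with hεdef
  have hε : ∀ k, ε k ∈ Set.Ioc (0 : ℝ) 1 := fun k =>
    ⟨Nat.one_div_pos_of_nat, by
      rw [hεdef]
      exact (div_le_one (by positivity)).mpr (by linarith [k.cast_nonneg (α := ℝ)])⟩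
  have hεlim : Tendsto ε atTop (𝓝[>] 0) :=
    tendsto_nhdsWithin_iff.mpr ⟨tendsto_one_div_add_atTop_nhds_zero_nat,
      Eventually.of_forall fun k => (hε k).1⟩
  set u : ℕ → ℝ → ℝ := fun k t => (g ((t : ℂ) + ε k * Complex.I)).re * (R ^ 2 - t ^ 2) with hu
  have hucont : ∀ k, Continuous (u k) := by
    intro k
    have h : Continuous fun t : ℝ => g ((t : ℂ) + ε k * Complex.I) :=
      hg.continuousOn.comp_continuous (by fun_prop) fun t => by simpa using (hε k).1
    exact (Complex.continuous_re.comp h).mul (by fun_prop)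
  have hunonneg : ∀ k, ∀ t ∈ Set.Ioo (-R) R, 0 ≤ u k t := by
    intro k t ht
    refine mul_nonneg (hre _ (by simpa using (hε k).1)) ?_
    nlinarith [ht.1, ht.2]
  set S := E ∩ Set.Ioo (-R) R with hS
  have hSm : MeasurableSet S := hE.inter measurableSet_Ioo
  have hbound : ∀ k, ∫⁻ t in S, ENNReal.ofReal (u k t) ≤ ENNReal.ofReal C := by
    intro k
    calc ∫⁻ t in S, ENNReal.ofReal (u k t)
        ≤ ∫⁻ t in Set.Ioo (-R) R, ENNReal.ofReal (u k t) :=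
          lintegral_mono_set Set.inter_subset_right
      _ = ENNReal.ofReal (∫ t in Set.Ioo (-R) R, u k t) := by
          rw [ofReal_integral_eq_lintegral_ofReal]
          · exact ((hucont k).integrableOn_Icc).mono_set Set.Ioo_subset_Icc_self
          · exact (ae_restrict_iff' measurableSet_Ioo).mpr (Eventually.of_forall (hunonneg k))
      _ ≤ ENNReal.ofReal C := by
          refine ENNReal.ofReal_le_ofReal ?_
          rw [← integral_Ioc_eq_integral_Ioo,
            ← intervalIntegral.integral_of_le (by linarith)]
          exact hC _ (hε k)
  have hfatou := lintegral_liminf_le (μ := volume.restrict S) (u := atTop)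
    (f := fun k t => ENNReal.ofReal (u k t)) fun k => (hucont k).measurable.ennreal_ofReal
  have hle : liminf (fun k => ∫⁻ t in S, ENNReal.ofReal (u k t)) atTop ≤ ENNReal.ofReal C :=
    (liminf_le_liminf (Eventually.of_forall hbound)).trans_eq (liminf_const _)
  have htop : ∫⁻ t in S, liminf (fun k => ENNReal.ofReal (u k t)) atTop = ⊤ * volume S := by
    rw [← setLIntegral_const]
    refine setLIntegral_congr_fun hSm fun t ht => ?_
    have hw : 0 < R ^ 2 - t ^ 2 := by nlinarith [ht.2.1, ht.2.2]
    exact (ENNReal.tendsto_ofReal_atTop.comp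
      (((hlim t ht.1).comp hεlim).atTop_mul_const hw)).liminf_eq
  by_contra hne
  rw [htop, ENNReal.top_mul hne] at hfatou
  exact absurd (hfatou.trans hle) (by simp)

lemma isConnected_setOf_im_pos : IsConnected {z : ℂ | 0 < z.im} :=
  ⟨⟨Complex.I, by simp⟩, (convex_halfSpace_im_gt 0).isPreconnected⟩

/-- A scalar Herglotz function whose normal limits vanish on a set of positive Lebesgue measure
is identically zero. -/
lemma herglotz_eq_zero_of_zero_limits {m : ℂ → ℂ}
    (hm : DifferentiableOn ℂ m {z : ℂ | 0 < z.im}) (him : ∀ z : ℂ, 0 < z.im → 0 ≤ (m z).im)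
    {E : Set ℝ} (hE : MeasurableSet E) (hEpos : 0 < volume E)
    (hlim : ∀ l ∈ E, Tendsto (fun ε : ℝ => m ((l : ℂ) + ε * Complex.I)) (𝓝[>] 0) (𝓝 0)) :
    ∀ z : ℂ, 0 < z.im → m z = 0 := by
  have hopen : IsOpen {z : ℂ | 0 < z.im} := UpperHalfPlane.isOpen_upperHalfPlaneSet
  rcases (hm.analyticOnNhd hopen).is_constant_or_isOpen isConnected_setOf_im_pos.isPreconnected
    with ⟨w, hw⟩ | hmap
  · obtain ⟨l, hl⟩ := nonempty_of_measure_ne_zero hEpos.ne'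
    have hconst : Tendsto (fun _ : ℝ => w) (𝓝[>] 0) (𝓝 0) := by
      refine (hlim l hl).congr' ?_
      filter_upwards [self_mem_nhdsWithin] with ε hε
      exact hw _ (by simpa using hε)
    intro z hz
    rw [hw z hz]
    exact tendsto_nhds_unique tendsto_const_nhds hconst
  · exfalso
    have himpos : ∀ z : ℂ, 0 < z.im → 0 < (m z).im := by
      intro z hz
      have hsub : m '' {z : ℂ | 0 < z.im} ⊆ interior {w : ℂ | 0 ≤ w.im} :=
        interior_maximal (by rintro _ ⟨z, hz, rfl⟩; exact him z hz) (hmap _ subset_rfl hopen)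
      rw [Complex.interior_setOfPred_le_im] at hsub
      exact hsub ⟨z, hz, rfl⟩
    have hne : ∀ z : ℂ, 0 < z.im → m z ≠ 0 := fun z hz h => by
      simpa [h] using himpos z hz
    have hrepos : ∀ z : ℂ, 0 < z.im → 0 < (Complex.I / m z).re := by
      intro z hz
      rw [Complex.div_re]
      simpa using div_pos (himpos z hz) (Complex.normSq_pos.mpr (hne z hz))
    have hsqrt : ∀ z : ℂ, ((Complex.I / m z) ^ (2⁻¹ : ℂ)).re
        = √((‖Complex.I / m z‖ + (Complex.I / m z).re) / 2) := fun z => Complex.cpow_inv_two_re _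
    refine hEpos.ne' (volume_eq_zero_of_tendsto_re_atTop
      (g := fun z => (Complex.I / m z) ^ (2⁻¹ : ℂ)) ?_ ?_ hE ?_)
    · exact ((differentiableOn_const _).div hm hne).cpow_const fun z hz => Or.inl (hrepos z hz)
    · intro z _
      simp only [hsqrt]
      exact Real.sqrt_nonneg _
    · intro l hl
      have hpos : ∀ᶠ ε : ℝ in 𝓝[>] 0, 0 < ((l : ℂ) + ε * Complex.I).im := by
        filter_upwards [self_mem_nhdsWithin] with ε hε
        simpa using hε
      have hnorm : Tendsto (fun ε : ℝ => ‖m ((l : ℂ) + ε * Complex.I)‖) (𝓝[>] 0) (𝓝[>] 0) := by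
        refine tendsto_nhdsWithin_iff.mpr ⟨by simpa using (hlim l hl).norm, ?_⟩
        filter_upwards [hpos] with ε hε
        exact norm_pos_iff.mpr (hne _ hε)
      have hinv := Real.tendsto_sqrt_atTop.comp
        (hnorm.inv_tendsto_nhdsGT_zero.atTop_div_const (two_pos (α := ℝ)))
      refine tendsto_atTop_mono' _ ?_ hinv
      filter_upwards [hpos] with ε hε
      simp only [hsqrt, Function.comp_apply, Pi.inv_apply]
      refine Real.sqrt_le_sqrt ?_
      have h := (hrepos _ hε).le
      rw [norm_div, Complex.norm_I, one_div] at *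
      linarith

/-- If each diagonal entry of a matrix-valued Herglotz function has zero normal limits on a
fixed Borel set of positive Lebesgue measure, then `M` is identically equal to a constant
self-adjoint matrix `C₀` with vanishing diagonal. -/
theorem herglotz_matrix_const_of_diag_zero_limits {n : ℕ}
    (M : ℂ → Matrix (Fin n) (Fin n) ℂ)
    (hanal : ∀ i j : Fin n, DifferentiableOn ℂ (fun z => M z i j) {z : ℂ | 0 < z.im})
    (hpos : ∀ z : ℂ, 0 < z.im → (matIm (M z)).PosSemidef)
    (E : Set ℝ) (hE : MeasurableSet E) (hEpos : 0 < volume E)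
    (hlim : ∀ j : Fin n, ∀ l ∈ E,
      Tendsto (fun ε : ℝ => M ((l : ℂ) + ε * Complex.I) j j)
        (𝓝[>] 0) (𝓝 0)) :
    ∃ C₀ : Matrix (Fin n) (Fin n) ℂ, C₀ᴴ = C₀ ∧ (∀ j : Fin n, C₀ j j = 0) ∧
      ∀ z : ℂ, 0 < z.im → M z = C₀ := by
  have hopen : IsOpen {z : ℂ | 0 < z.im} := UpperHalfPlane.isOpen_upperHalfPlaneSet
  have hentry : ∀ z i j, matIm (M z) i j
      = (2 * Complex.I)⁻¹ * (M z i j - (starRingEnd ℂ) (M z j i)) := fun z i j => by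
    simp [matIm]
  have hdiagIm : ∀ z j, matIm (M z) j j = ((M z j j).im : ℂ) := fun z j => by
    rw [hentry, Complex.sub_conj]
    field_simp
    push_cast
    ring
  have hdiag : ∀ j, ∀ z : ℂ, 0 < z.im → M z j j = 0 := fun j =>
    herglotz_eq_zero_of_zero_limits (hanal j j)
      (fun z hz => by
        have h := (hpos z hz).diag_nonneg (i := j)
        rw [hdiagIm] at h
        exact_mod_cast h) hE hEpos (hlim j)
  have hherm : ∀ z : ℂ, 0 < z.im → ∀ i j, M z i j = (starRingEnd ℂ) (M z j i) := by
    intro z hz i j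
    have h0 : matIm (M z) = 0 := by
      refine (hpos z hz).trace_eq_zero_iff.mp (Finset.sum_eq_zero fun k _ => ?_)
      rw [Matrix.diag_apply, hdiagIm, hdiag k z hz]
      simp
    have h := hentry z i j
    rw [h0, Matrix.zero_apply, zero_eq_mul] at h
    exact sub_eq_zero.mp (h.resolve_left (by simp))
  have hconst : ∀ i j, ∃ c : ℂ, ∀ z ∈ {z : ℂ | 0 < z.im}, M z i j = c := by
    intro i j
    obtain ⟨a, ha⟩ := (((hanal i j).add (hanal j i)).analyticOnNhd hopen).eq_const_of_im_eq_const
      (c₀ := 0) (fun z hz => by simp [hherm z hz i j]) hopen isConnected_setOf_im_pos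
    obtain ⟨b, hb⟩ := (((hanal i j).sub (hanal j i)).analyticOnNhd hopen).eq_const_of_re_eq_const
      (c₀ := 0) (fun z hz => by simp [hherm z hz i j]) hopen isConnected_setOf_im_pos
    refine ⟨(a + b) / 2, fun z hz => ?_⟩
    rw [← ha z hz, ← hb z hz]
    simp
  have hI : (0 : ℝ) < Complex.I.im := by simp
  refine ⟨M Complex.I, ?_, fun j => hdiag j _ hI, fun z hz => ?_⟩
  · ext i j
    exact (hherm _ hI i j).symm
  · ext i j
    obtain ⟨c, hc⟩ := hconst i j
    rw [hc z hz, hc _ hI]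
end

section
/- Let m be a Herglotz function. Then there exist c ∈ ℝ, d ≥ 0, and a Borel measure ω on ℝ satisfying ∫_ℝ (1 + λ²)⁻¹ dω(λ) < ∞ such that for all z ∈ ℂ₊, m(z) = c + dz + ∫_ℝ ((λ − z)⁻¹ − λ(1 + λ²)⁻¹) dω(λ); moreover, c = Re(m(i)) and d = lim_{η→∞} m(iη)/(iη). -/
open MeasureTheory Filter Topology

open Metric in
/-- **Schwarz integral formula** on the unit disk. -/
theorem circleAverage_herglotzRieszKernel_mul_re {f : ℂ → ℂ} {w : ℂ}
    (hf : DiffContOnCl ℂ f (ball 0 1)) (hw : w ∈ ball (0 : ℂ) 1) :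
    Real.circleAverage (fun ζ ↦ herglotzRieszKernel 0 w ζ * ((f ζ).re : ℂ)) 0 1 =
      f w - (f 0).im * Complex.I := by
  have hw1 : ‖w‖ < 1 := by simpa using hw
  have hf1 : DiffContOnCl ℂ f (ball 0 |1|) := by simpa using hf
  have hcl : closure (ball (0 : ℂ) 1) = closedBall 0 1 := closure_ball 0 one_ne_zero
  have hfc : ContinuousOn f (sphere 0 1) := hf.2.mono (by rw [hcl]; exact sphere_subset_closedBall)
  have hK : ContinuousOn (herglotzRieszKernel 0 w) (sphere 0 1) := by
    simpa using continuousOn_herglotzRieszKernel_sphere hw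
  have hne : ∀ ζ ∈ sphere (0 : ℂ) 1, ζ - w ≠ 0 := by
    intro ζ hζ h
    rw [mem_sphere_zero_iff_norm, sub_eq_zero.1 h] at hζ
    exact hw1.ne hζ
  have hden : ∀ ζ ∈ closedBall (0 : ℂ) 1, 1 - starRingEnd ℂ w * ζ ≠ 0 := by
    intro ζ hζ h
    have h1 : ‖starRingEnd ℂ w * ζ‖ = 1 := by rw [← sub_eq_zero.1 h]; simp
    rw [norm_mul, RCLike.norm_conj] at h1
    have : ‖ζ‖ ≤ 1 := by simpa using hζ
    nlinarith [norm_nonneg w, norm_nonneg ζ]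
  have hint {g : ℂ → ℂ} (hg : ContinuousOn g (sphere 0 1)) : CircleIntegrable g 0 1 :=
    hg.circleIntegrable zero_le_one
  have hcK : Real.circleAverage (fun ζ ↦ starRingEnd ℂ (herglotzRieszKernel 0 w ζ) * f ζ) 0 1
      = f 0 := by
    have h := (DiffContOnCl.smul
      (c := fun ζ ↦ (1 + starRingEnd ℂ w * ζ) / (1 - starRingEnd ℂ w * ζ))
      (DifferentiableOn.diffContOnCl (by
        rw [abs_one, hcl]; exact DifferentiableOn.div (by fun_prop) (by fun_prop) hden)) hf1).circleAverage
    simp only [mul_zero, add_zero, sub_zero, div_one, one_smul] at h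
    rw [← h]
    refine Real.circleAverage_congr_sphere fun ζ hζ ↦ ?_
    rw [abs_one] at hζ
    have hζ1 : ‖ζ‖ = 1 := by simpa using hζ
    have hζζ : ζ * starRingEnd ℂ ζ = 1 := by simp [Complex.mul_conj, Complex.normSq_eq_norm_sq, hζ1]
    have h1 := hden ζ (sphere_subset_closedBall hζ)
    have h2 : starRingEnd ℂ ζ - starRingEnd ℂ w ≠ 0 := by
      rw [← map_sub]; exact (map_ne_zero _).2 (hne ζ hζ)
    simp only [herglotzRieszKernel_def, sub_zero, map_div₀, map_add, map_sub, smul_eq_mul]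
    congr 1
    rw [div_eq_div_iff h2 h1]
    linear_combination (-2 * starRingEnd ℂ w) * hζζ
  have hKf : Real.circleAverage (fun ζ ↦ herglotzRieszKernel 0 w ζ * f ζ) 0 1 = 2 * f w - f 0 := by
    have h := hf1.circleAverage_smul_div (w := w) (by simpa using hw)
    rw [← h, ← hf1.circleAverage, two_mul, ← Real.circleAverage_fun_add,
      ← Real.circleAverage_fun_sub]
    · refine Real.circleAverage_congr_sphere fun ζ hζ ↦ ?_
      rw [abs_one] at hζ
      have := hne ζ hζ
      simp only [herglotzRieszKernel_def, sub_zero, smul_eq_mul]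
      field_simp
      ring
    all_goals
      refine hint ?_
      first
      | exact hfc
      | exact ContinuousOn.smul (ContinuousOn.div (by fun_prop) (by fun_prop) hne) hfc
      | exact (ContinuousOn.smul (ContinuousOn.div (by fun_prop) (by fun_prop) hne) hfc).add
          (ContinuousOn.smul (ContinuousOn.div (by fun_prop) (by fun_prop) hne) hfc)
  have hKcf : Real.circleAverage (fun ζ ↦ herglotzRieszKernel 0 w ζ * starRingEnd ℂ (f ζ)) 0 1
      = starRingEnd ℂ (f 0) := by
    have hci : CircleIntegrable
        (fun ζ ↦ starRingEnd ℂ (herglotzRieszKernel 0 w ζ) * f ζ) 0 1 :=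
      hint ((Complex.continuous_conj.comp_continuousOn hK).mul hfc)
    have h := Complex.conjCLE.toContinuousLinearMap.circleAverage_comp_comm hci
    rw [hcK] at h
    simpa [Function.comp_def] using h
  have hsum : Real.circleAverage (fun ζ ↦
      herglotzRieszKernel 0 w ζ * f ζ + herglotzRieszKernel 0 w ζ * starRingEnd ℂ (f ζ)) 0 1 =
      2 * f w - f 0 + starRingEnd ℂ (f 0) := by
    rw [← hKf, ← hKcf]
    exact Real.circleAverage_fun_add (hint (hK.mul hfc))
      (hint (hK.mul (Complex.continuous_conj.comp_continuousOn hfc)))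
  have h2 : (fun ζ ↦ herglotzRieszKernel 0 w ζ * ((f ζ).re : ℂ)) = fun ζ ↦ (1 / 2 : ℝ) •
      (herglotzRieszKernel 0 w ζ * f ζ + herglotzRieszKernel 0 w ζ * starRingEnd ℂ (f ζ)) := by
    funext ζ
    rw [Complex.re_eq_add_conj, Complex.real_smul]
    push_cast
    ring
  rw [h2, Real.circleAverage_fun_smul, hsum]
  have h3 := Complex.re_add_im (f 0)
  have h4 : starRingEnd ℂ (f 0) = (f 0).re - (f 0).im * Complex.I := by
    apply Complex.ext <;> simp
  rw [h4, Complex.real_smul]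
  push_cast
  linear_combination (1/2 : ℂ) * h3

open Metric in
/-- A nonnegative continuous function of mean one on the unit circle is the density, with respect to
normalized arc length, of a probability measure on the circle. -/
theorem exists_probabilityMeasure_integral_eq_circleAverage {f : ℂ → ℝ}
    (hf : ContinuousOn f (sphere 0 1)) (hf0 : ∀ ζ ∈ sphere (0 : ℂ) 1, 0 ≤ f ζ)
    (hf1 : Real.circleAverage f 0 1 = 1) :
    ∃ μ : ProbabilityMeasure (sphere (0 : ℂ) 1), ∀ g : ℂ → ℂ, ContinuousOn g (sphere 0 1) →
      ∫ ζ, g ζ ∂(μ : Measure (sphere (0 : ℂ) 1)) =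
        Real.circleAverage (fun ζ ↦ g ζ * (f ζ : ℂ)) 0 1 := by
  let e : ℝ → sphere (0 : ℂ) 1 := fun θ ↦ ⟨circleMap 0 1 θ, circleMap_mem_sphere 0 zero_le_one θ⟩
  have he : Continuous e := (continuous_circleMap 0 1).subtype_mk _
  have hfc : Continuous fun θ ↦ f (circleMap 0 1 θ) :=
    hf.comp_continuous (continuous_circleMap 0 1) fun θ ↦ (e θ).2
  have hpos : ∀ θ, 0 ≤ (2 * Real.pi)⁻¹ * f (circleMap 0 1 θ) := fun θ ↦
    mul_nonneg (by positivity) (hf0 _ (e θ).2)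
  let ν : Measure ℝ := (volume.restrict (Set.Ioc 0 (2 * Real.pi))).withDensity
    fun θ ↦ ENNReal.ofReal ((2 * Real.pi)⁻¹ * f (circleMap 0 1 θ))
  have hν : ν Set.univ = 1 := by
    rw [withDensity_apply _ MeasurableSet.univ, Measure.restrict_univ,
      ← ofReal_integral_eq_lintegral_ofReal _ (Eventually.of_forall hpos)]
    · rw [integral_const_mul, ← intervalIntegral.integral_of_le (by positivity)]
      rw [Real.circleAverage_def, smul_eq_mul] at hf1
      rw [hf1, ENNReal.ofReal_one]
    · exact ((continuous_const.mul hfc).integrableOn_Icc (a := 0) (b := 2 * Real.pi)).mono_set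
        Set.Ioc_subset_Icc_self
  have : IsProbabilityMeasure ν := ⟨hν⟩
  refine ⟨⟨ν.map e, Measure.isProbabilityMeasure_map he.aemeasurable⟩, fun g hg ↦ ?_⟩
  have hg' : Continuous fun ζ : sphere (0 : ℂ) 1 ↦ g ζ := hg.domRestrict
  change ∫ ζ, g ζ ∂(ν.map e) = _
  rw [integral_map he.aemeasurable hg'.aestronglyMeasurable,
    integral_withDensity_eq_integral_toReal_smul
      (hfc.measurable.const_mul _).ennreal_ofReal (by simp), Real.circleAverage_def,
    intervalIntegral.integral_of_le (by positivity), ← integral_smul]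
  refine integral_congr_ae (Eventually.of_forall fun θ ↦ ?_)
  simp only [ENNReal.toReal_ofReal (hpos θ), Complex.real_smul, e]
  push_cast
  ring

open Metric in
/-- **Herglotz representation theorem** on the unit disk. -/
theorem exists_probabilityMeasure_eq_integral_herglotzRieszKernel {f : ℂ → ℂ}
    (hf : DifferentiableOn ℂ f (ball 0 1)) (hpos : ∀ w ∈ ball (0 : ℂ) 1, 0 ≤ (f w).re)
    (hf0 : f 0 = 1) :
    ∃ μ : ProbabilityMeasure (sphere (0 : ℂ) 1), ∀ w ∈ ball (0 : ℂ) 1,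
      f w = ∫ ζ, herglotzRieszKernel 0 w ζ ∂(μ : Measure (sphere (0 : ℂ) 1)) := by
  let r : ℕ → ℝ := fun n ↦ 1 - 1 / ((n : ℝ) + 1)
  have hr0 (n) : 0 ≤ r n := by
    have : 1 / ((n : ℝ) + 1) ≤ 1 := by
      rw [div_le_one (by positivity)]
      linarith [n.cast_nonneg (α := ℝ)]
    simp only [r]; linarith
  have hr1 (n) : r n < 1 := by
    have : 0 < 1 / ((n : ℝ) + 1) := by positivity
    simp only [r]; linarith
  have hr : Tendsto r atTop (𝓝 1) := by
    simpa [r] using (tendsto_one_div_add_atTop_nhds_zero_nat (𝕜 := ℝ)).const_sub 1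
  have hcl : closure (ball (0 : ℂ) 1) = closedBall 0 1 := closure_ball 0 one_ne_zero
  have hmaps (n) : Set.MapsTo (fun w : ℂ ↦ (r n : ℂ) * w) (closedBall 0 1) (ball 0 1) := by
    intro w hw
    have hw : ‖w‖ ≤ 1 := by simpa using hw
    have h0 := hr0 n
    have h1 := hr1 n
    simp only [mem_ball_zero_iff, norm_mul, Complex.norm_real, Real.norm_eq_abs, abs_of_nonneg h0]
    nlinarith [norm_nonneg w]
  have hdiff (n) : DiffContOnCl ℂ (fun w ↦ f (r n * w)) (ball 0 1) := by
    apply DifferentiableOn.diffContOnCl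
    rw [hcl]
    exact hf.comp (by fun_prop) (hmaps n)
  have hμ (n) : ∃ μ : ProbabilityMeasure (sphere (0 : ℂ) 1), ∀ w ∈ ball (0 : ℂ) 1,
      f (r n * w) = ∫ ζ, herglotzRieszKernel 0 w ζ ∂(μ : Measure (sphere (0 : ℂ) 1)) := by
    have hc : ContinuousOn (fun w ↦ f (r n * w)) (sphere 0 1) :=
      (hdiff n).2.mono (by rw [hcl]; exact sphere_subset_closedBall)
    obtain ⟨μ, hμ⟩ := exists_probabilityMeasure_integral_eq_circleAverage
      (f := fun w ↦ (f (r n * w)).re) (Complex.continuous_re.comp_continuousOn hc)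
      (fun ζ hζ ↦ hpos _ (hmaps n (sphere_subset_closedBall hζ))) (by
        have h := (show DiffContOnCl ℂ (fun w ↦ f (r n * w)) (ball 0 |1|) by
          simpa using hdiff n).circleAverage
        have h2 := Complex.reCLM.circleAverage_comp_comm (hc.circleIntegrable zero_le_one)
        rw [h] at h2
        simpa [Function.comp_def, hf0] using h2)
    refine ⟨μ, fun w hw ↦ ?_⟩
    have hK : ContinuousOn (herglotzRieszKernel 0 w) (sphere 0 1) := by
      simpa using continuousOn_herglotzRieszKernel_sphere hw
    rw [hμ _ hK, circleAverage_herglotzRieszKernel_mul_re (hdiff n) hw]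
    simp [hf0]
  choose μ hμ using hμ
  obtain ⟨ν, -, hν⟩ := isCompact_univ.ultrafilter_le_nhds
    ((Ultrafilter.of (atTop : Filter ℕ)).map μ) (by simp)
  have hν : Tendsto μ (Ultrafilter.of (atTop : Filter ℕ)) (𝓝 ν) := hν
  refine ⟨ν, fun w hw ↦ ?_⟩
  have hK : Continuous fun ζ : sphere (0 : ℂ) 1 ↦ herglotzRieszKernel 0 w ζ := by
    have : ContinuousOn (herglotzRieszKernel 0 w) (sphere 0 1) := by
      simpa using continuousOn_herglotzRieszKernel_sphere hw
    exact this.domRestrict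
  have h1 := (ProbabilityMeasure.tendsto_iff_forall_integral_rclike_tendsto ℂ).1 hν
    (BoundedContinuousFunction.mkOfCompact ⟨_, hK⟩)
  simp only [BoundedContinuousFunction.mkOfCompact_apply, ContinuousMap.coe_mk] at h1
  simp_rw [← hμ _ w hw] at h1
  refine tendsto_nhds_unique ?_ h1
  refine Tendsto.mono_left ?_ (Ultrafilter.of_le _)
  have hcont : ContinuousAt f w := (hf.differentiableAt (isOpen_ball.mem_nhds hw)).continuousAt
  refine hcont.tendsto.comp ?_
  simpa using ((Complex.continuous_ofReal.tendsto 1).comp hr).mul_const w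

/-- The Cayley transform maps the open unit disk into the upper half-plane. -/
theorem im_cayley_pos {w : ℂ} (hw : ‖w‖ < 1) : 0 < (Complex.I * (1 + w) / (1 - w)).im := by
  have hne : 1 - w ≠ 0 := fun h ↦ by
    rw [← sub_eq_zero.1 h] at hw; simp at hw
  have h2 : w.re ^ 2 + w.im ^ 2 < 1 := by
    have := Complex.sq_norm w
    rw [Complex.normSq_apply] at this
    nlinarith [norm_nonneg w]
  have h3 := Complex.normSq_pos.2 hne
  rw [Complex.div_im, ← sub_div]
  refine div_pos ?_ h3
  simp
  nlinarith

/-- The Cayley transform is real on the unit circle. -/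
theorem ofReal_re_cayley_of_norm_eq_one {w : ℂ} (hw : ‖w‖ = 1) :
    (((Complex.I * (1 + w) / (1 - w)).re : ℝ) : ℂ) = Complex.I * (1 + w) / (1 - w) := by
  by_cases hne : 1 - w = 0
  · simp [hne]
  have hww : w * starRingEnd ℂ w = 1 := by simp [Complex.mul_conj, Complex.normSq_eq_norm_sq, hw]
  rw [← Complex.conj_eq_iff_re]
  have hne' : 1 - starRingEnd ℂ w ≠ 0 := by
    have := (map_ne_zero (starRingEnd ℂ)).2 hne
    simpa using this
  simp only [map_div₀, map_mul, map_add, map_sub, map_one, Complex.conj_I]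
  rw [div_eq_div_iff hne' hne]
  linear_combination (2 * Complex.I) * hww

theorem ofReal_sub_ne_zero {z : ℂ} (hz : 0 < z.im) (l : ℝ) : (l : ℂ) - z ≠ 0 := fun h ↦ by
  have := congrArg Complex.im h
  simp at this
  exact hz.ne' this

/-- The inverse Cayley transform maps the upper half-plane into the open unit disk. -/
theorem norm_inverse_cayley_lt_one {z : ℂ} (hz : 0 < z.im) :
    ‖(z - Complex.I) / (z + Complex.I)‖ < 1 := by
  have h0 : 0 < ‖z + Complex.I‖ := norm_pos_iff.2 fun h ↦ by
    have := congrArg Complex.im h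
    simp at this
    linarith
  rw [norm_div, div_lt_one h0]
  refine lt_of_pow_lt_pow_left₀ 2 h0.le ?_
  rw [Complex.sq_norm, Complex.sq_norm, Complex.normSq_apply, Complex.normSq_apply]
  simp
  nlinarith

/-- The Herglotz–Riesz kernel of the disk, transported to the half-plane. -/
theorem herglotzRieszKernel_cayley {z ζ : ℂ} (hz : z + Complex.I ≠ 0) (hζ : ζ ≠ 1)
    (h : Complex.I * (1 + ζ) / (1 - ζ) - z ≠ 0) :
    herglotzRieszKernel 0 ((z - Complex.I) / (z + Complex.I)) ζ =
      -Complex.I * ((1 + Complex.I * (1 + ζ) / (1 - ζ) * z) /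
        (Complex.I * (1 + ζ) / (1 - ζ) - z)) := by
  have h1 : 1 - ζ ≠ 0 := fun h ↦ hζ (sub_eq_zero.1 h).symm
  have h2 : Complex.I * (1 + ζ) - (1 - ζ) * z ≠ 0 := fun h' ↦ h (by field_simp; simpa using h')
  have h3 : ζ - (z - Complex.I) / (z + Complex.I) =
      (Complex.I * (1 + ζ) - (1 - ζ) * z) / (z + Complex.I) := by field_simp; ring
  have h4 : ζ + (z - Complex.I) / (z + Complex.I) =
      -Complex.I * ((1 - ζ) + Complex.I * (1 + ζ) * z) / (z + Complex.I) := by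
    field_simp
    linear_combination (1 + ζ) * z * Complex.I_sq
  have h5 : Complex.I * (1 + ζ) / (1 - ζ) - z = (Complex.I * (1 + ζ) - (1 - ζ) * z) / (1 - ζ) := by
    field_simp
  have h6 : 1 + Complex.I * (1 + ζ) / (1 - ζ) * z =
      ((1 - ζ) + Complex.I * (1 + ζ) * z) / (1 - ζ) := by field_simp
  rw [herglotzRieszKernel_def]
  simp only [sub_zero]
  rw [h3, h4, h5, h6, div_div_div_cancel_right₀ hz, div_div_div_cancel_right₀ h1, mul_div_assoc]

/-- Nevanlinna representation of a Herglotz function through a finite measure on the line. -/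
theorem exists_finite_measure_of_herglotz {m : ℂ → ℂ}
    (hanal : DifferentiableOn ℂ m {z : ℂ | 0 < z.im})
    (hmap : ∀ z : ℂ, 0 < z.im → 0 < (m z).im) :
    ∃ (d : ℝ) (ν : Measure ℝ), 0 ≤ d ∧ IsFiniteMeasure ν ∧ ∀ z : ℂ, 0 < z.im →
      m z = ((m Complex.I).re : ℂ) + d * z + ∫ l : ℝ, (1 + l * z) / ((l : ℂ) - z) ∂ν := by
  set a : ℝ := (m Complex.I).re with ha
  set b : ℝ := (m Complex.I).im with hb
  have hb0 : 0 < b := hmap _ (by simp)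
  have hbc : (b : ℂ) ≠ 0 := by exact_mod_cast hb0.ne'
  have hmI : m Complex.I = a + b * Complex.I := (Complex.re_add_im _).symm
  obtain ⟨μ, hμ⟩ := exists_probabilityMeasure_eq_integral_herglotzRieszKernel
    (f := fun w ↦ (m (Complex.I * (1 + w) / (1 - w)) - a) / (Complex.I * b))
    (by
      refine ((hanal.comp ?_ fun w hw ↦ im_cayley_pos (by simpa using hw)).sub_const _).div_const _
      refine DifferentiableOn.div (by fun_prop) (by fun_prop) fun w hw h ↦ ?_
      rw [← sub_eq_zero.1 h] at hw
      simp at hw)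
    (by
      intro w hw
      have h := hmap _ (im_cayley_pos (w := w) (by simpa using hw))
      have : (m (Complex.I * (1 + w) / (1 - w)) - a) / (Complex.I * b) =
          (-Complex.I * (m (Complex.I * (1 + w) / (1 - w)) - a)) / b := by
        field_simp
        linear_combination (m (Complex.I * (1 + w) / (1 - w)) - a) * Complex.I_sq
      rw [this, Complex.div_ofReal_re]
      refine div_nonneg ?_ hb0.le
      simpa using h.le)
    (by
      simp only [add_zero, sub_zero, mul_one, div_one, hmI]
      field_simp
      ring)
  let T : Metric.sphere (0 : ℂ) 1 → ℝ := fun ζ ↦ (Complex.I * (1 + ζ) / (1 - ζ)).re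
  have hT : Measurable T := by fun_prop
  let one : Metric.sphere (0 : ℂ) 1 := ⟨1, by simp⟩
  refine ⟨b * (μ : Measure _).real {one},
    ENNReal.ofReal b • ((μ : Measure _).restrict {one}ᶜ).map T, by positivity,
    Measure.smul_finite _ ENNReal.ofReal_ne_top, fun z hz ↦ ?_⟩
  have hzI : z + Complex.I ≠ 0 := fun h ↦ by
    have := congrArg Complex.im h
    simp at this
    linarith
  have hw := norm_inverse_cayley_lt_one hz
  set w := (z - Complex.I) / (z + Complex.I) with hwdef
  have hwb : w ∈ Metric.ball (0 : ℂ) 1 := by simpa using hw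
  have hw1 : 1 - w = 2 * Complex.I / (z + Complex.I) := by rw [hwdef]; field_simp; ring
  have hw2 : 1 + w = 2 * z / (z + Complex.I) := by rw [hwdef]; field_simp; ring
  have hwz : Complex.I * (1 + w) / (1 - w) = z := by
    rw [hw1, hw2]
    field_simp
  have hK : Continuous fun ζ : Metric.sphere (0 : ℂ) 1 ↦ herglotzRieszKernel 0 w ζ := by
    have : ContinuousOn (herglotzRieszKernel 0 w) (Metric.sphere 0 1) := by
      simpa using continuousOn_herglotzRieszKernel_sphere hwb
    exact this.domRestrict
  have hint : Integrable (fun ζ : Metric.sphere (0 : ℂ) 1 ↦ herglotzRieszKernel 0 w ζ)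
      (μ : Measure _) :=
    integrableOn_univ.1 (hK.continuousOn.integrableOn_compact isCompact_univ)
  have h1 := hμ w hwb
  rw [hwz, ← integral_add_compl (measurableSet_singleton one) hint, integral_singleton] at h1
  have hKone : herglotzRieszKernel 0 w one = -Complex.I * z := by
    simp only [herglotzRieszKernel_def, sub_zero, one]
    rw [hw1, hw2, div_div_div_cancel_right₀ hzI]
    field_simp
    linear_combination z * Complex.I_sq
  have h2 : ∫ ζ in {one}ᶜ, herglotzRieszKernel 0 w ζ ∂(μ : Measure _) =
      -Complex.I * ∫ ζ in {one}ᶜ, (1 + (T ζ : ℂ) * z) / ((T ζ : ℂ) - z) ∂(μ : Measure _) := by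
    rw [← integral_const_mul]
    refine setIntegral_congr_fun (measurableSet_singleton one).compl fun ζ hζ ↦ ?_
    have hT' := ofReal_re_cayley_of_norm_eq_one (w := ζ) (by simp)
    have hne := ofReal_sub_ne_zero hz (T ζ)
    simp only [T] at hne ⊢
    rw [hT'] at hne ⊢
    exact herglotzRieszKernel_cayley hzI (fun h ↦ hζ (Subtype.ext h)) hne
  have hm : Measurable fun l : ℝ ↦ (1 + (l : ℂ) * z) / ((l : ℂ) - z) := by fun_prop
  rw [integral_smul_measure, integral_map hT.aemeasurable hm.aestronglyMeasurable,
    ENNReal.toReal_ofReal hb0.le]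
  rw [h2, hKone, div_eq_iff (by simp [hbc])] at h1
  rw [sub_eq_iff_eq_add] at h1
  rw [h1]
  simp only [Complex.real_smul]
  push_cast
  linear_combination (-b * ((μ : Measure _).real {one} * z +
    ∫ ζ in {one}ᶜ, (1 + (T ζ : ℂ) * z) / ((T ζ : ℂ) - z) ∂(μ : Measure _))) * Complex.I_sq

theorem tendsto_integral_herglotz_div (ν : Measure ℝ) [IsFiniteMeasure ν] :
    Tendsto (fun η : ℝ ↦ (∫ l : ℝ, (1 + l * (η * Complex.I)) / ((l : ℂ) - η * Complex.I) ∂ν) /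
      (η * Complex.I)) atTop (𝓝 0) := by
  have hden (l : ℝ) {η : ℝ} (hη : 1 ≤ η) :
      ‖(l : ℂ) - η * Complex.I‖ ^ 2 = l ^ 2 + η ^ 2 := by
    rw [Complex.sq_norm, Complex.normSq_apply]
    simp
    ring
  have hnum (l : ℝ) {η : ℝ} (hη : 1 ≤ η) :
      ‖1 + (l : ℂ) * (η * Complex.I)‖ ^ 2 = 1 + (l * η) ^ 2 := by
    rw [Complex.sq_norm, Complex.normSq_apply]
    simp
    ring
  have hnorm (l : ℝ) {η : ℝ} (hη : 1 ≤ η) :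
      ‖(1 + (l : ℂ) * (η * Complex.I)) / ((l : ℂ) - η * Complex.I) / (η * Complex.I)‖ =
        ‖1 + (l : ℂ) * (η * Complex.I)‖ / (‖(l : ℂ) - η * Complex.I‖ * η) := by
    rw [norm_div, norm_div, div_div, norm_mul (η : ℂ), Complex.norm_I, mul_one, Complex.norm_real,
      Real.norm_eq_abs, abs_of_pos (by linarith)]
  have hη_le (l : ℝ) {η : ℝ} (hη : 1 ≤ η) : η ≤ ‖(l : ℂ) - η * Complex.I‖ := by
    refine le_of_sq_le_sq ?_ (norm_nonneg _)
    rw [hden l hη]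
    nlinarith
  simp_rw [← integral_div]
  rw [← integral_zero ℝ ℂ (μ := ν)]
  refine tendsto_integral_filter_of_dominated_convergence (fun _ ↦ 1) ?_ ?_
    (integrable_const _) ?_
  · exact Eventually.of_forall fun η ↦
      (show Measurable _ by fun_prop).aestronglyMeasurable
  · filter_upwards [eventually_ge_atTop 1] with η hη
    refine Eventually.of_forall fun l ↦ ?_
    have h0 := hη_le l hη
    rw [hnorm l hη, div_le_one (by nlinarith)]
    refine le_of_sq_le_sq ?_ (by positivity)
    rw [mul_pow, hnum l hη, hden l hη]
    have : 1 ≤ η ^ 2 := by nlinarith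
    nlinarith
  · refine Eventually.of_forall fun l ↦ ?_
    rw [tendsto_zero_iff_norm_tendsto_zero]
    refine squeeze_zero' (g := fun η : ℝ ↦ (1 + |l|) / η)
      (Eventually.of_forall fun _ ↦ norm_nonneg _) ?_ (tendsto_const_nhds.div_atTop tendsto_id)
    filter_upwards [eventually_ge_atTop 1] with η hη
    have h0 := hη_le l hη
    have h1 : ‖1 + (l : ℂ) * (η * Complex.I)‖ ≤ (1 + |l|) * η := by
      refine (norm_add_le _ _).trans ?_
      simp only [norm_one, norm_mul, Complex.norm_real, Complex.norm_I, mul_one, Real.norm_eq_abs,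
        abs_of_pos (show 0 < η by linarith)]
      nlinarith
    rw [hnorm l hη, div_le_div_iff₀ (by nlinarith) (by linarith)]
    calc _ ≤ (1 + |l|) * η * η := by gcongr
      _ ≤ (1 + |l|) * (‖(l : ℂ) - η * Complex.I‖ * η) := by rw [mul_assoc]; gcongr

/-- Nevanlinna/Riesz–Herglotz representation: every Herglotz function `m` can be written as
`m(z) = c + d z + ∫_ℝ ((λ - z)⁻¹ - λ (1 + λ²)⁻¹) dω(λ)` with `c = Re (m i)`, `d ≥ 0` the
limit of `m(iη)/(iη)` as `η → ∞`, and `ω` a Borel measure with `∫ (1 + λ²)⁻¹ dω < ∞`. -/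
theorem herglotz_nevanlinna_representation
    (m : ℂ → ℂ)
    (hanal : DifferentiableOn ℂ m {z : ℂ | 0 < z.im})
    (hmap : ∀ z : ℂ, 0 < z.im → 0 < (m z).im) :
    ∃ (c d : ℝ) (ω : Measure ℝ),
      0 ≤ d ∧
      (∫⁻ l : ℝ, ENNReal.ofReal ((1 + l ^ 2)⁻¹) ∂ω) < ⊤ ∧
      (∀ z : ℂ, 0 < z.im →
        m z = (c : ℂ) + (d : ℂ) * z +
          ∫ l : ℝ, (((l : ℂ) - z)⁻¹ - (l : ℂ) * (1 + (l : ℂ) ^ 2)⁻¹) ∂ω) ∧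
      c = (m Complex.I).re ∧
      Tendsto (fun η : ℝ => m (η * Complex.I) / (η * Complex.I)) atTop (𝓝 (d : ℂ)) := by
  obtain ⟨d, ν, hd, hν, hm⟩ := exists_finite_measure_of_herglotz hanal hmap
  have hdens : Measurable fun l : ℝ ↦ ENNReal.ofReal (1 + l ^ 2) := by fun_prop
  refine ⟨(m Complex.I).re, d, ν.withDensity fun l ↦ ENNReal.ofReal (1 + l ^ 2), hd, ?_,
    fun z hz ↦ ?_, rfl, ?_⟩
  · rw [lintegral_withDensity_eq_lintegral_mul _ hdens (by fun_prop)]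
    have h (l : ℝ) : ENNReal.ofReal (1 + l ^ 2) * ENNReal.ofReal ((1 + l ^ 2)⁻¹) = 1 := by
      rw [← ENNReal.ofReal_mul (by positivity), mul_inv_cancel₀ (by positivity), ENNReal.ofReal_one]
    simp [h]
  · rw [hm z hz, integral_withDensity_eq_integral_toReal_smul hdens (by simp)]
    congr 1
    refine integral_congr_ae (Eventually.of_forall fun l ↦ ?_)
    have h1 := ofReal_sub_ne_zero hz l
    have h2 : (1 + (l : ℂ) ^ 2) ≠ 0 := by exact_mod_cast (show 1 + l ^ 2 ≠ 0 by positivity)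
    simp only [ENNReal.toReal_ofReal (show 0 ≤ 1 + l ^ 2 by positivity), Complex.real_smul]
    push_cast
    field_simp
    ring
  · have hI : Tendsto (fun η : ℝ ↦ ((m Complex.I).re : ℂ) / (η * Complex.I)) atTop (𝓝 0) := by
      rw [tendsto_zero_iff_norm_tendsto_zero]
      simpa using Tendsto.div_atTop tendsto_const_nhds tendsto_abs_atTop_atTop
    have h := (hI.add_const (d : ℂ)).add (tendsto_integral_herglotz_div ν)
    rw [zero_add, add_zero] at h
    refine h.congr' ?_
    filter_upwards [eventually_gt_atTop 0] with η hη
    have hη' : (η : ℂ) * Complex.I ≠ 0 := by simp [hη.ne']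
    rw [hm (η * Complex.I) (by simp [hη]), add_div, add_div, mul_div_cancel_right₀ _ hη']
end

section
/- Let m be a Herglotz function with Nevanlinna representation m(z) = c + dz + ∫_ℝ ((λ − z)⁻¹ − λ(1 + λ²)⁻¹) dω(λ) for all z ∈ ℂ₊, where c ∈ ℝ, d ≥ 0, and ω is a Borel measure on ℝ with ∫_ℝ (1 + λ²)⁻¹ dω(λ) < ∞. Let ω_ac denote the absolutely continuous part of ω with respect to Lebesgue measure. Then the set S = {λ ∈ ℝ : lim_{ε↓0} Im(m(λ + iε)) exists as a finite real number and 0 < lim_{ε↓0} Im(m(λ + iε))} is a minimal support of ω_ac relative to Lebesgue measure. -/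
open MeasureTheory Filter Topology

/-- The Poisson kernel profile `1 / (1 + a²)` as a superposition of indicators of half-lines. -/
lemma setLIntegral_Ioi_two_mul_div_one_add_sq_sq {a : ℝ} (ha : 0 ≤ a) :
    ∫⁻ u in Set.Ioi a, ENNReal.ofReal (2 * u / (1 + u ^ 2) ^ 2) =
      ENNReal.ofReal ((1 + a ^ 2)⁻¹) := by
  have hder : ∀ u ∈ Set.Ici a,
      HasDerivAt (fun u : ℝ => -(1 + u ^ 2)⁻¹) (2 * u / (1 + u ^ 2) ^ 2) u := by
    intro u _
    have h : HasDerivAt (fun u : ℝ => 1 + u ^ 2) (2 * u) u := by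
      simpa using (hasDerivAt_pow 2 u).const_add 1
    refine (h.inv (by positivity)).neg.congr_deriv ?_
    ring
  have hnn : ∀ u ∈ Set.Ioi a, 0 ≤ 2 * u / (1 + u ^ 2) ^ 2 := by
    intro u hu
    have : 0 ≤ u := ha.trans (le_of_lt hu)
    positivity
  have hlim : Tendsto (fun u : ℝ => -(1 + u ^ 2)⁻¹) atTop (𝓝 0) := by
    have h : Tendsto (fun u : ℝ => 1 + u ^ 2) atTop atTop :=
      tendsto_atTop_add_const_left _ _ (tendsto_pow_atTop two_ne_zero)
    simpa using (tendsto_inv_atTop_zero.comp h).neg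
  rw [← ofReal_integral_eq_lintegral_ofReal
      (integrableOn_Ioi_deriv_of_nonneg' hder hnn hlim)
      (ae_restrict_of_forall_mem measurableSet_Ioi hnn),
    integral_Ioi_of_hasDerivAt_of_nonneg' hder hnn hlim]
  simp

lemma setLIntegral_Ioi_zero_four_mul_sq_div :
    ∫⁻ u in Set.Ioi (0 : ℝ), ENNReal.ofReal (2 * u / (1 + u ^ 2) ^ 2 * (2 * u)) =
      ENNReal.ofReal Real.pi := by
  have hder : ∀ u ∈ Set.Ici (0 : ℝ),
      HasDerivAt (fun u : ℝ => 2 * Real.arctan u - 2 * (u * (1 + u ^ 2)⁻¹))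
        (2 * u / (1 + u ^ 2) ^ 2 * (2 * u)) u := by
    intro u _
    have h : HasDerivAt (fun u : ℝ => 1 + u ^ 2) (2 * u) u := by
      simpa using (hasDerivAt_pow 2 u).const_add 1
    have hpos : (1 + u ^ 2 : ℝ) ≠ 0 := by positivity
    refine (((Real.hasDerivAt_arctan u).const_mul 2).sub
      (((hasDerivAt_id u).mul (h.inv hpos)).const_mul 2)).congr_deriv ?_
    simp only [id, Pi.inv_apply]
    field_simp
    ring
  have hnn : ∀ u ∈ Set.Ioi (0 : ℝ), 0 ≤ 2 * u / (1 + u ^ 2) ^ 2 * (2 * u) := by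
    intro u hu
    have : 0 < u := hu
    positivity
  have hlim : Tendsto (fun u : ℝ => 2 * Real.arctan u - 2 * (u * (1 + u ^ 2)⁻¹)) atTop
      (𝓝 Real.pi) := by
    have h0 : Tendsto (fun u : ℝ => u * (1 + u ^ 2)⁻¹) atTop (𝓝 0) := by
      refine squeeze_zero' (g := fun u : ℝ => u⁻¹) ?_ ?_ tendsto_inv_atTop_zero
      · filter_upwards [eventually_gt_atTop 0] with u hu
        positivity
      · filter_upwards [eventually_gt_atTop 0] with u hu
        rw [← div_eq_mul_inv, div_le_iff₀ (by positivity)]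
        field_simp
        nlinarith
    have h1 : Tendsto Real.arctan atTop (𝓝 (Real.pi / 2)) :=
      tendsto_nhds_of_tendsto_nhdsWithin Real.tendsto_arctan_atTop
    convert (h1.const_mul 2).sub (h0.const_mul 2) using 2
    ring
  rw [← ofReal_integral_eq_lintegral_ofReal
      (integrableOn_Ioi_deriv_of_nonneg' hder hnn hlim)
      (ae_restrict_of_forall_mem measurableSet_Ioi hnn),
    integral_Ioi_of_hasDerivAt_of_nonneg' hder hnn hlim]
  simp

/-- Layer-cake formula for the Poisson integral of a finite measure. -/
lemma lintegral_poisson_eq (ν : Measure ℝ) [IsFiniteMeasure ν] (x : ℝ) {ε : ℝ} (hε : 0 < ε) :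
    ∫⁻ l, ENNReal.ofReal (ε / ((l - x) ^ 2 + ε ^ 2)) ∂ν =
      ∫⁻ u in Set.Ioi (0 : ℝ), ENNReal.ofReal (2 * u / (1 + u ^ 2) ^ 2 * (2 * u)) *
        (ν (Metric.closedBall x (ε * u)) / ENNReal.ofReal (2 * (ε * u))) := by
  set K : ℝ → ℝ → ENNReal := fun l u =>
    {p : ℝ × ℝ | |p.1 - x| ≤ ε * p.2}.indicator
      (fun p => ENNReal.ofReal (ε⁻¹ * (2 * p.2 / (1 + p.2 ^ 2) ^ 2))) (l, u) with hK
  have hmeas : Measurable (Function.uncurry K) := by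
    have hset : MeasurableSet {p : ℝ × ℝ | |p.1 - x| ≤ ε * p.2} :=
      measurableSet_le (by fun_prop) (by fun_prop)
    exact Measurable.indicator (by fun_prop) hset
  have hleft : ∀ l, ENNReal.ofReal (ε / ((l - x) ^ 2 + ε ^ 2)) =
      ∫⁻ u in Set.Ioi (0 : ℝ), K l u := by
    intro l
    have ha : 0 ≤ |l - x| / ε := by positivity
    have h1 : ∀ u, K l u = (Set.Ici (|l - x| / ε)).indicator
        (fun u => ENNReal.ofReal ε⁻¹ * ENNReal.ofReal (2 * u / (1 + u ^ 2) ^ 2)) u := by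
      intro u
      simp only [hK, Set.indicator_apply, Set.mem_ofPred_eq, Set.mem_Ici, div_le_iff₀ hε,
        mul_comm u ε, ENNReal.ofReal_mul (inv_nonneg.2 hε.le)]
    have hsub : (Set.Ici (|l - x| / ε) ∩ Set.Ioi 0 : Set ℝ) =ᵐ[volume]
        Set.Ioi (|l - x| / ε) := by
      have : (Set.Ioi (|l - x| / ε) ∩ Set.Ioi 0 : Set ℝ) = Set.Ioi (|l - x| / ε) :=
        Set.inter_eq_left.2 (Set.Ioi_subset_Ioi ha)
      conv_rhs => rw [← this]
      exact Ioi_ae_eq_Ici.symm.inter (ae_eq_refl _)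
    simp_rw [h1]
    rw [lintegral_indicator measurableSet_Ici, Measure.restrict_restrict measurableSet_Ici,
      setLIntegral_congr hsub, lintegral_const_mul _ (by fun_prop),
      setLIntegral_Ioi_two_mul_div_one_add_sq_sq ha,
      ← ENNReal.ofReal_mul (inv_nonneg.2 hε.le), div_pow, sq_abs]
    congr 1
    field_simp
    ring
  simp_rw [hleft]
  rw [lintegral_lintegral_swap hmeas.aemeasurable]
  refine setLIntegral_congr_fun measurableSet_Ioi fun u hu => ?_
  have hu : 0 < u := hu
  have h2 : ∀ l, K l u = (Metric.closedBall x (ε * u)).indicator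
      (fun _ => ENNReal.ofReal (ε⁻¹ * (2 * u / (1 + u ^ 2) ^ 2))) l := by
    intro l
    simp only [hK, Set.indicator, Set.mem_ofPred_eq, Metric.mem_closedBall, Real.dist_eq]
  simp_rw [h2]
  rw [lintegral_indicator_const measurableSet_closedBall, ← ENNReal.mul_comm_div,
    ← ENNReal.ofReal_div_of_pos (by positivity)]
  congr 2
  field_simp

lemma tendsto_lintegral_poisson_of_isFiniteMeasure (ν : Measure ℝ) [IsFiniteMeasure ν] (x : ℝ)
    {D : ENNReal} (hD : D < ⊤)
    (h : Tendsto (fun r => ν (Metric.closedBall x r) / ENNReal.ofReal (2 * r)) (𝓝[>] 0) (𝓝 D)) :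
    Tendsto (fun ε => ∫⁻ l, ENNReal.ofReal (ε / ((l - x) ^ 2 + ε ^ 2)) ∂ν) (𝓝[>] 0)
      (𝓝 (ENNReal.ofReal Real.pi * D)) := by
  obtain ⟨C, hC, hbound⟩ : ∃ C : ENNReal, C < ⊤ ∧
      ∀ r > 0, ν (Metric.closedBall x r) / ENNReal.ofReal (2 * r) ≤ C := by
    have hev := h.eventually_lt_const (ENNReal.lt_add_right hD.ne one_ne_zero)
    obtain ⟨δ, hδ, hsub⟩ := mem_nhdsGT_iff_exists_Ioo_subset.1 hev
    have hδ : 0 < δ := hδ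
    refine ⟨max (D + 1) (ν Set.univ / ENNReal.ofReal (2 * δ)), ?_, fun r hr => ?_⟩
    · exact max_lt (by simpa using hD) (ENNReal.div_lt_top (measure_ne_top _ _) (by simpa using hδ))
    · rcases lt_or_ge r δ with hrδ | hrδ
      · exact (le_of_lt (hsub ⟨hr, hrδ⟩)).trans (le_max_left _ _)
      · refine le_trans ?_ (le_max_right _ _)
        gcongr
        exact Set.subset_univ _
  have hlim : Tendsto (fun ε : ℝ => ∫⁻ u in Set.Ioi (0 : ℝ),
      ENNReal.ofReal (2 * u / (1 + u ^ 2) ^ 2 * (2 * u)) *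
        (ν (Metric.closedBall x (ε * u)) / ENNReal.ofReal (2 * (ε * u)))) (𝓝[>] 0)
      (𝓝 (∫⁻ u in Set.Ioi (0 : ℝ), ENNReal.ofReal (2 * u / (1 + u ^ 2) ^ 2 * (2 * u)) * D)) := by
    refine tendsto_lintegral_filter_of_dominated_convergence
      (fun u => ENNReal.ofReal (2 * u / (1 + u ^ 2) ^ 2 * (2 * u)) * C) ?_ ?_ ?_ ?_
    · refine Eventually.of_forall fun ε => ?_
      have hmono : Measurable fun r => ν (Metric.closedBall x r) :=
        Monotone.measurable fun r s hrs => measure_mono (Metric.closedBall_subset_closedBall hrs)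
      have hcomp : Measurable fun u : ℝ => ν (Metric.closedBall x (ε * u)) :=
        hmono.comp (measurable_const_mul ε)
      exact (by fun_prop : Measurable fun u : ℝ =>
        ENNReal.ofReal (2 * u / (1 + u ^ 2) ^ 2 * (2 * u))).mul (hcomp.div (by fun_prop))
    · filter_upwards [self_mem_nhdsWithin] with ε hε
      refine ae_restrict_of_forall_mem measurableSet_Ioi fun u hu => ?_
      gcongr
      exact hbound _ (mul_pos hε hu)
    · rw [lintegral_mul_const _ (by fun_prop), setLIntegral_Ioi_zero_four_mul_sq_div]
      exact ENNReal.mul_ne_top ENNReal.ofReal_ne_top hC.ne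
    · refine ae_restrict_of_forall_mem measurableSet_Ioi fun u hu => ?_
      have hu : 0 < u := hu
      refine ENNReal.Tendsto.const_mul (h.comp ?_) (Or.inr ENNReal.ofReal_ne_top)
      refine tendsto_nhdsWithin_iff.2 ⟨?_, ?_⟩
      · refine tendsto_nhdsWithin_of_tendsto_nhds ?_
        simpa using (continuous_mul_const u).tendsto 0
      · filter_upwards [self_mem_nhdsWithin] with ε hε
        exact mul_pos hε hu
  rw [lintegral_mul_const _ (by fun_prop), setLIntegral_Ioi_zero_four_mul_sq_div] at hlim
  refine hlim.congr' ?_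
  filter_upwards [self_mem_nhdsWithin] with ε hε
  exact (lintegral_poisson_eq ν x hε).symm

lemma isFiniteMeasureOnCompacts_of_lintegral_inv_one_add_sq_lt_top {ω : Measure ℝ}
    (hω : ∫⁻ l : ℝ, ENNReal.ofReal ((1 + l ^ 2)⁻¹) ∂ω < ⊤) : IsFiniteMeasureOnCompacts ω := by
  refine ⟨fun K hK => ?_⟩
  obtain ⟨R, hR⟩ := hK.isBounded.exists_norm_le
  have hle : ENNReal.ofReal ((1 + R ^ 2)⁻¹) * ω K ≤
      ∫⁻ l : ℝ, ENNReal.ofReal ((1 + l ^ 2)⁻¹) ∂ω := by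
    rw [← setLIntegral_const]
    refine (setLIntegral_mono' hK.measurableSet fun l hl => ?_).trans (setLIntegral_le_lintegral K _)
    have := sq_le_sq' (abs_le.1 (hR l hl)).1 (abs_le.1 (hR l hl)).2
    gcongr
  have hne : ENNReal.ofReal ((1 + R ^ 2)⁻¹) ≠ 0 := by
    simpa using (by positivity : (0 : ℝ) < 1 + R ^ 2)
  exact ENNReal.lt_top_of_mul_ne_top_right (hle.trans_lt hω).ne hne

/-- The Poisson integral of a measure converges vertically to `π` times its symmetric
derivative. -/
lemma tendsto_lintegral_poisson {ω : Measure ℝ}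
    (hω : ∫⁻ l : ℝ, ENNReal.ofReal ((1 + l ^ 2)⁻¹) ∂ω < ⊤) (x : ℝ)
    {D : ENNReal} (hD : D < ⊤)
    (h : Tendsto (fun r => ω (Metric.closedBall x r) / volume (Metric.closedBall x r))
      (𝓝[>] 0) (𝓝 D)) :
    Tendsto (fun ε => ∫⁻ l, ENNReal.ofReal (ε / ((l - x) ^ 2 + ε ^ 2)) ∂ω) (𝓝[>] 0)
      (𝓝 (ENNReal.ofReal Real.pi * D)) := by
  have := isFiniteMeasureOnCompacts_of_lintegral_inv_one_add_sq_lt_top hω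
  have hfin : IsFiniteMeasure (ω.restrict (Metric.closedBall x 1)) :=
    isFiniteMeasure_restrict.2 (isCompact_closedBall x 1).measure_lt_top.ne
  have hnear := tendsto_lintegral_poisson_of_isFiniteMeasure
    (ω.restrict (Metric.closedBall x 1)) x hD (h.congr' (by
      filter_upwards [Ioo_mem_nhdsGT (zero_lt_one' ℝ)] with r hr
      rw [Measure.restrict_apply measurableSet_closedBall, Real.volume_closedBall,
        Set.inter_eq_left.2 (Metric.closedBall_subset_closedBall hr.2.le)]))
  have hfar : Tendsto (fun ε => ∫⁻ l in (Metric.closedBall x 1)ᶜ,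
      ENNReal.ofReal (ε / ((l - x) ^ 2 + ε ^ 2)) ∂ω) (𝓝[>] 0) (𝓝 0) := by
    set W := ENNReal.ofReal (3 + 2 * x ^ 2) * ∫⁻ l : ℝ, ENNReal.ofReal ((1 + l ^ 2)⁻¹) ∂ω
    have hW : W ≠ ⊤ := ENNReal.mul_ne_top ENNReal.ofReal_ne_top hω.ne
    have hup : Tendsto (fun ε : ℝ => ENNReal.ofReal ε * W) (𝓝[>] 0) (𝓝 0) := by
      have : Tendsto (fun ε : ℝ => ENNReal.ofReal ε) (𝓝[>] 0) (𝓝 0) := by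
        simpa using (ENNReal.continuous_ofReal.tendsto 0).mono_left nhdsWithin_le_nhds
      simpa using ENNReal.Tendsto.mul_const this (Or.inr hW)
    refine tendsto_of_tendsto_of_tendsto_of_le_of_le' tendsto_const_nhds hup
      (Eventually.of_forall fun _ => zero_le) ?_
    filter_upwards [self_mem_nhdsWithin] with ε hε
    have hε : 0 < ε := hε
    simp only [W]
    rw [← lintegral_const_mul _ (by fun_prop), ← lintegral_const_mul _ (by fun_prop)]
    refine (setLIntegral_mono' measurableSet_closedBall.compl fun l hl => ?_).trans
      (setLIntegral_le_lintegral _ _)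
    rw [← ENNReal.ofReal_mul (by positivity), ← ENNReal.ofReal_mul hε.le]
    refine ENNReal.ofReal_le_ofReal ?_
    have hl : 1 < |l - x| := by simpa [Real.dist_eq] using hl
    have hl2 : 1 ≤ (l - x) ^ 2 := by
      rw [← sq_abs]
      nlinarith
    rw [div_eq_mul_inv]
    gcongr
    rw [← div_eq_mul_inv, inv_le_iff_one_le_mul₀ (by positivity), div_mul_eq_mul_div,
      le_div_iff₀ (by positivity)]
    nlinarith [sq_nonneg (l - 2 * x), mul_nonneg (sq_nonneg x) (sub_nonneg.2 hl2), sq_nonneg x,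
      mul_nonneg (sq_nonneg x) (sq_nonneg ε), sq_nonneg ε]
  have hsum := hnear.add hfar
  rw [add_zero] at hsum
  refine hsum.congr fun ε => ?_
  exact lintegral_add_compl _ measurableSet_closedBall

lemma integrable_nevanlinna_kernel {ω : Measure ℝ}
    (hω : ∫⁻ l : ℝ, ENNReal.ofReal ((1 + l ^ 2)⁻¹) ∂ω < ⊤) {z : ℂ} (hz : 0 < z.im) :
    Integrable (fun l : ℝ => ((l : ℂ) - z)⁻¹ - (l : ℂ) * (1 + (l : ℂ) ^ 2)⁻¹) ω := by
  have hw : Integrable (fun l : ℝ => (1 + l ^ 2)⁻¹) ω := by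
    refine ⟨by fun_prop, ?_⟩
    rwa [hasFiniteIntegral_iff_ofReal (Eventually.of_forall fun l => by positivity)]
  have hne : ∀ l : ℝ, (l : ℂ) - z ≠ 0 := fun l h => by
    have := congrArg Complex.im h
    simp at this
    exact hz.ne' this
  have hsq : ∀ l : ℝ, (1 + (l : ℂ) ^ 2) ≠ 0 := fun l => by
    have : (1 + l ^ 2 : ℝ) ≠ 0 := by positivity
    exact_mod_cast this
  have hbdd : ∀ l : ℝ, ‖z + (1 + z ^ 2) * ((l : ℂ) - z)⁻¹‖ ≤ ‖z‖ + ‖1 + z ^ 2‖ * z.im⁻¹ := by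
    intro l
    have him : z.im ≤ ‖(l : ℂ) - z‖ := by
      simpa [abs_of_pos hz] using Complex.abs_im_le_norm ((l : ℂ) - z)
    refine (norm_add_le _ _).trans ?_
    rw [norm_mul, norm_inv]
    gcongr
  have hcont : Continuous fun l : ℝ => z + (1 + z ^ 2) * ((l : ℂ) - z)⁻¹ :=
    continuous_const.add (continuous_const.mul
      ((Complex.continuous_ofReal.sub continuous_const).inv₀ hne))
  refine (hw.ofReal (𝕜 := ℂ).bdd_mul hcont.aestronglyMeasurable
    (Eventually.of_forall hbdd)).congr (Eventually.of_forall fun l => ?_)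
  have h1 := hne l
  have h2 := hsq l
  simp only [RCLike.ofReal_eq_complex_ofReal, Complex.ofReal_inv, Complex.ofReal_add,
    Complex.ofReal_one, Complex.ofReal_pow]
  field_simp
  ring

lemma nevanlinna_kernel_im (x ε l : ℝ) :
    (((l : ℂ) - (x + ε * Complex.I))⁻¹ - (l : ℂ) * (1 + (l : ℂ) ^ 2)⁻¹).im =
      ε / ((l - x) ^ 2 + ε ^ 2) := by
  have h : (l : ℂ) * (1 + (l : ℂ) ^ 2)⁻¹ = ((l * (1 + l ^ 2)⁻¹ : ℝ) : ℂ) := by push_cast; rfl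
  rw [h, Complex.sub_im, Complex.ofReal_im, sub_zero, Complex.inv_im, Complex.normSq_apply]
  simp
  ring

lemma nevanlinna_im {m : ℂ → ℂ} {c d : ℝ} {ω : Measure ℝ}
    (hω : ∫⁻ l : ℝ, ENNReal.ofReal ((1 + l ^ 2)⁻¹) ∂ω < ⊤)
    (hrep : ∀ z : ℂ, 0 < z.im →
      m z = (c : ℂ) + (d : ℂ) * z +
        ∫ l : ℝ, (((l : ℂ) - z)⁻¹ - (l : ℂ) * (1 + (l : ℂ) ^ 2)⁻¹) ∂ω)
    (x : ℝ) {ε : ℝ} (hε : 0 < ε) :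
    (m ((x : ℂ) + ε * Complex.I)).im =
      d * ε + (∫⁻ l, ENNReal.ofReal (ε / ((l - x) ^ 2 + ε ^ 2)) ∂ω).toReal := by
  have hz : 0 < ((x : ℂ) + ε * Complex.I).im := by simpa using hε
  have him := integral_im (𝕜 := ℂ) (integrable_nevanlinna_kernel hω hz)
  simp only [RCLike.im_eq_complex_im, nevanlinna_kernel_im] at him
  rw [hrep _ hz, Complex.add_im, ← him, integral_eq_lintegral_of_nonneg_ae
    (Eventually.of_forall fun l => by positivity)
      (by fun_prop : Measurable fun l : ℝ => ε / ((l - x) ^ 2 + ε ^ 2)).aestronglyMeasurable]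
  simp

lemma tendsto_nevanlinna_im {m : ℂ → ℂ} {c d : ℝ} {ω : Measure ℝ}
    (hω : ∫⁻ l : ℝ, ENNReal.ofReal ((1 + l ^ 2)⁻¹) ∂ω < ⊤)
    (hrep : ∀ z : ℂ, 0 < z.im →
      m z = (c : ℂ) + (d : ℂ) * z +
        ∫ l : ℝ, (((l : ℂ) - z)⁻¹ - (l : ℂ) * (1 + (l : ℂ) ^ 2)⁻¹) ∂ω)
    (x : ℝ) {D : ENNReal} (hD : D < ⊤)
    (h : Tendsto (fun r => ω (Metric.closedBall x r) / volume (Metric.closedBall x r))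
      (𝓝[>] 0) (𝓝 D)) :
    Tendsto (fun ε : ℝ => (m ((x : ℂ) + ε * Complex.I)).im) (𝓝[>] 0)
      (𝓝 (Real.pi * D.toReal)) := by
  have hJ := (ENNReal.tendsto_toReal (ENNReal.mul_ne_top ENNReal.ofReal_ne_top hD.ne)).comp
    (tendsto_lintegral_poisson hω x hD h)
  have hlin : Tendsto (fun ε : ℝ => d * ε) (𝓝[>] 0) (𝓝 0) := by
    simpa using ((continuous_const_mul d).tendsto 0).mono_left nhdsWithin_le_nhds
  have hsum := hlin.add hJ
  rw [ENNReal.toReal_mul, ENNReal.toReal_ofReal Real.pi_pos.le, zero_add] at hsum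
  refine hsum.congr' ?_
  filter_upwards [self_mem_nhdsWithin] with ε hε
  exact (nevanlinna_im hω hrep x hε).symm

lemma ae_tendsto_measure_div_of_mutuallySingular (ωac ωs : Measure ℝ)
    [IsLocallyFiniteMeasure ωac] [IsLocallyFiniteMeasure ωs]
    (hs : Measure.MutuallySingular ωs volume) :
    ∀ᵐ x : ℝ, Tendsto
      (fun r => (ωac + ωs) (Metric.closedBall x r) / volume (Metric.closedBall x r))
      (𝓝[>] 0) (𝓝 (ωac.rnDeriv volume x)) := by
  filter_upwards [Besicovitch.ae_tendsto_rnDeriv ωac volume,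
    Besicovitch.ae_tendsto_rnDeriv ωs volume, (Measure.rnDeriv_eq_zero ωs volume).2 hs]
    with x h1 h2 h3
  rw [h3] at h2
  simpa [ENNReal.add_div] using h1.add h2



/-- For a Herglotz function `m` with Nevanlinna representation measure `ω` decomposed as
`ω = ω_ac + ω_s` (`ω_ac ≪ Lebesgue`, `ω_s ⟂ Lebesgue`), the set
`S = {λ : lim_{ε↓0} Im m(λ+iε) exists finitely and is > 0}` is a minimal support of
`ω_ac` relative to Lebesgue measure. -/
theorem minimal_support_ac_part
    (m : ℂ → ℂ)
    (hanal : DifferentiableOn ℂ m {z : ℂ | 0 < z.im})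
    (hmap : ∀ z : ℂ, 0 < z.im → 0 < (m z).im)
    (c d : ℝ) (ω : Measure ℝ) (hd : 0 ≤ d)
    (hω : (∫⁻ l : ℝ, ENNReal.ofReal ((1 + l ^ 2)⁻¹) ∂ω) < ⊤)
    (hrep : ∀ z : ℂ, 0 < z.im →
      m z = (c : ℂ) + (d : ℂ) * z +
        ∫ l : ℝ, (((l : ℂ) - z)⁻¹ - (l : ℂ) * (1 + (l : ℂ) ^ 2)⁻¹) ∂ω)
    (ωac ωs : Measure ℝ) (hdecomp : ω = ωac + ωs)
    (hac : ωac ≪ volume) (hs : Measure.MutuallySingular ωs volume) :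
    ωac {l : ℝ | ∃ L : ℝ, 0 < L ∧
        Tendsto (fun ε : ℝ => (m ((l : ℂ) + ε * Complex.I)).im) (𝓝[>] 0) (𝓝 L)}ᶜ = 0 ∧
      ∀ B : Set ℝ, MeasurableSet B →
        B ⊆ {l : ℝ | ∃ L : ℝ, 0 < L ∧
          Tendsto (fun ε : ℝ => (m ((l : ℂ) + ε * Complex.I)).im) (𝓝[>] 0) (𝓝 L)} →
        ωac B = 0 → volume B = 0 := by
  have := isFiniteMeasureOnCompacts_of_lintegral_inv_one_add_sq_lt_top hω
  have hac_le : ωac ≤ ω := hdecomp ▸ Measure.le_add_right le_rfl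
  have hs_le : ωs ≤ ω := hdecomp ▸ Measure.le_add_left le_rfl
  have : IsFiniteMeasureOnCompacts ωac :=
    ⟨fun _ hK => (hac_le _).trans_lt hK.measure_lt_top⟩
  have : IsFiniteMeasureOnCompacts ωs :=
    ⟨fun _ hK => (hs_le _).trans_lt hK.measure_lt_top⟩
  have hlim : ∀ᵐ x : ℝ, ωac.rnDeriv volume x < ⊤ ∧
      Tendsto (fun ε : ℝ => (m ((x : ℂ) + ε * Complex.I)).im) (𝓝[>] 0)
        (𝓝 (Real.pi * (ωac.rnDeriv volume x).toReal)) := by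
    filter_upwards [ae_tendsto_measure_div_of_mutuallySingular ωac ωs hs,
      Measure.rnDeriv_lt_top ωac volume] with x hx hfin
    rw [← hdecomp] at hx
    exact ⟨hfin, tendsto_nevanlinna_im hω hrep x hfin hx⟩
  refine ⟨?_, fun B hB hBS hB0 => ?_⟩
  · change ∀ᵐ x ∂ωac, _
    filter_upwards [hac.ae_le hlim, Measure.rnDeriv_pos hac] with x hx hpos
    exact ⟨_, mul_pos Real.pi_pos (ENNReal.toReal_pos hpos.ne' hx.1.ne), hx.2⟩
  · have hzero : ∀ᵐ x : ℝ, x ∈ B → ωac.rnDeriv volume x = 0 := by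
      rw [← Measure.withDensity_rnDeriv_eq ωac volume hac, withDensity_apply _ hB,
        lintegral_eq_zero_iff (Measure.measurable_rnDeriv _ _)] at hB0
      exact (ae_restrict_iff' hB).1 hB0
    rw [measure_eq_zero_iff_ae_notMem]
    filter_upwards [hlim, hzero] with x hx h0 hxB
    obtain ⟨L, hL, hLlim⟩ := hBS hxB
    have := tendsto_nhds_unique hLlim hx.2
    rw [h0 hxB] at this
    simp at this
    exact hL.ne' this
end

section
/- Let m be a Herglotz function with Nevanlinna representation measure ω (i.e., m(z) = c + dz + ∫_ℝ ((λ − z)⁻¹ − λ(1 + λ²)⁻¹) dω(λ) on ℂ₊ with c ∈ ℝ, d ≥ 0, ∫_ℝ (1 + λ²)⁻¹ dω(λ) < ∞). Let a ∈ 𝒜₂ satisfy a_{1,1} + a_{1,2}m(z) ≠ 0 for all z ∈ ℂ₊, let m_a(z) = (a_{2,1} + a_{2,2}m(z))/(a_{1,1} + a_{1,2}m(z)), and let ω_a be a Nevanlinna representation measure of the Herglotz function m_a. Then the absolutely continuous parts (with respect to Lebesgue measure) ω_{a,ac} and ω_ac are equivalent measures, i.e., mutually absolutely continuous: ω_{a,ac}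 ≪ ω_ac and ω_ac ≪ ω_{a,ac}. -/
open Matrix MeasureTheory Filter Topology

namespace Herglotz

lemma norm_le_two_mul_re_cpow_half {w : ℂ} (hw : 0 < w.re) :
    ‖w‖ ^ (1 / 2 : ℝ) ≤ 2 * (w ^ ((1 / 2 : ℝ) : ℂ)).re := by
  rw [Complex.cpow_ofReal_re]
  have harg : |w.arg| < Real.pi / 2 := Complex.abs_arg_lt_pi_div_two_iff.2 (Or.inl hw)
  have hcos : 1 / 2 ≤ Real.cos (w.arg * (1 / 2)) := by
    have hpi := Real.pi_pos
    have habs : |w.arg * (1 / 2)| = |w.arg| * (1 / 2) := by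
      rw [abs_mul, abs_of_pos (by norm_num : (0 : ℝ) < 1 / 2)]
    have := Real.cos_le_cos_of_nonneg_of_le_pi (abs_nonneg (w.arg * (1 / 2)))
      (by linarith : Real.pi / 3 ≤ Real.pi) (by rw [habs]; linarith)
    rwa [Real.cos_abs, Real.cos_pi_div_three] at this
  have h0 : 0 ≤ ‖w‖ ^ (1 / 2 : ℝ) := by positivity
  nlinarith

/-- If `G` is holomorphic on the upper half-plane and grows at most like `y ^ (-1/2)` near the real
line, then its integrals over horizontal segments are bounded uniformly in the height. -/
lemma norm_integral_horizontal_le {G : ℂ → ℂ} (hG : DifferentiableOn ℂ G {z : ℂ | 0 < z.im}) {R K : ℝ}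
    (hR : 0 ≤ R) (hK : 0 ≤ K)
    (hbd : ∀ z : ℂ, 0 < z.im → z.im ≤ 1 → |z.re| ≤ R → ‖G z‖ ≤ K * z.im ^ (-(1 / 2) : ℝ))
    {ε : ℝ} (hε : 0 < ε) (hε1 : ε ≤ 1) :
    ‖∫ x in (-R)..R, G (x + ε * Complex.I)‖ ≤ 2 * R * K + 4 * K := by
  have key := Complex.integral_boundary_rect_eq_zero_of_differentiableOn G
    (⟨-R, ε⟩ : ℂ) ⟨R, 1⟩ (hG.mono (by
      intro z hz
      have := (Complex.mem_reProdIm.1 hz).2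
      rw [Set.uIcc_of_le hε1] at this
      exact lt_of_lt_of_le hε this.1))
  simp only at key
  have htop : ‖∫ x in (-R)..R, G (x + (1 : ℝ) * Complex.I)‖ ≤ 2 * R * K := by
    have := intervalIntegral.norm_integral_le_of_norm_le_const (a := -R) (b := R) (C := K)
      (f := fun x : ℝ => G (x + (1 : ℝ) * Complex.I)) (by
        intro x hx
        rw [Set.uIoc_of_le (by linarith)] at hx
        have := hbd (x + (1 : ℝ) * Complex.I) (by simp) (by simp)
          (by simpa using abs_le.2 ⟨hx.1.le, hx.2⟩)
        simpa using this)
    rw [abs_of_nonneg (by linarith)] at this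
    linarith
  have hside : ∀ s : ℝ, |s| ≤ R → ‖∫ y in ε..1, G (s + y * Complex.I)‖ ≤ 2 * K := by
    intro s hs
    have h0 : (0 : ℝ) ∉ Set.uIcc ε 1 := by
      rw [Set.uIcc_of_le hε1]
      exact fun h => absurd h.1 (by linarith)
    have := intervalIntegral.norm_integral_le_of_norm_le (a := ε) (b := 1) (μ := volume)
      (f := fun y : ℝ => G (s + y * Complex.I)) (g := fun y => K * y ^ (-(1 / 2) : ℝ)) hε1
      (by
        refine Filter.Eventually.of_forall fun y hy => ?_
        have hy0 : 0 < y := hε.trans hy.1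
        simpa using hbd (s + y * Complex.I) (by simpa using hy0) (by simpa using hy.2)
          (by simpa using hs))
      ((intervalIntegral.intervalIntegrable_rpow (Or.inr h0)).const_mul K)
    refine this.trans ?_
    rw [intervalIntegral.integral_const_mul, integral_rpow (Or.inr ⟨by norm_num, h0⟩)]
    have : 0 ≤ ε ^ (-(1 / 2) + 1 : ℝ) := by positivity
    rw [Real.one_rpow]
    have h2 : (1 - ε ^ (-(1 / 2) + 1 : ℝ)) / (-(1 / 2) + 1) ≤ 2 := by
      rw [div_le_iff₀ (by norm_num)]; linarith
    nlinarith
  have h1 := hside R (abs_of_nonneg hR).le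
  have h2 := hside (-R) (by rw [abs_neg, abs_of_nonneg hR])
  have heq : ∫ x in (-R)..R, G (x + ε * Complex.I) =
      (∫ x in (-R)..R, G (x + (1 : ℝ) * Complex.I))
        - Complex.I • (∫ y in ε..1, G (R + y * Complex.I))
        + Complex.I • (∫ y in ε..1, G ((-R : ℝ) + y * Complex.I)) := by
    linear_combination key
  rw [heq]
  refine (norm_add_le _ _).trans ((add_le_add_left (norm_sub_le _ _) _).trans ?_)
  rw [norm_smul, norm_smul, Complex.norm_I]
  linarith

/-- A holomorphic self-map of the upper half-plane satisfying a Harnack-type growth bound near the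
real line does not have the radial limit `∞` on a set of positive measure. -/
lemma ae_not_tendsto_norm_atTop {m : ℂ → ℂ} (hanal : DifferentiableOn ℂ m {z : ℂ | 0 < z.im})
    (hmap : ∀ z : ℂ, 0 < z.im → 0 < (m z).im)
    (hbd : ∀ R : ℝ, ∃ C : ℝ, ∀ z : ℂ, 0 < z.im → z.im ≤ 1 → |z.re| ≤ R → ‖m z‖ ≤ C / z.im) :
    ∀ᵐ x : ℝ, ¬ Tendsto (fun y : ℝ => ‖m (x + y * Complex.I)‖) (𝓝[>] 0) atTop := by
  let ε : ℕ → ℝ := fun n => 1 / ((n : ℝ) + 1)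
  have hε : ∀ n, 0 < ε n := fun n => Nat.one_div_pos_of_nat
  have hε1 : ∀ n, ε n ≤ 1 := fun n => by
    simp only [ε]
    rw [div_le_one (by positivity)]
    linarith [n.cast_nonneg (α := ℝ)]
  have hεlim : Tendsto ε atTop (𝓝[>] 0) :=
    tendsto_nhdsWithin_iff.2
      ⟨tendsto_one_div_add_atTop_nhds_zero_nat, Filter.Eventually.of_forall hε⟩
  let G : ℂ → ℂ := fun z => (-Complex.I * m z) ^ ((1 / 2 : ℝ) : ℂ)
  have hre : ∀ z : ℂ, 0 < z.im → 0 < (-Complex.I * m z).re := fun z hz => by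
    simpa using hmap z hz
  have hG : DifferentiableOn ℂ G {z : ℂ | 0 < z.im} :=
    (hanal.const_mul _).cpow_const fun z hz => Or.inl (hre z hz)
  have hnorm : ∀ z, ‖-Complex.I * m z‖ = ‖m z‖ := fun z => by simp
  have hcont : ∀ n, Continuous fun x : ℝ => G (x + ε n * Complex.I) := fun n =>
    hG.continuousOn.comp_continuous (by fun_prop) fun x => by simpa using hε n
  have hlocal : ∀ R : ℕ, ∀ᵐ x : ℝ ∂(volume.restrict (Set.Ioc (-(R : ℝ)) R)),
      ¬ Tendsto (fun y : ℝ => ‖m (x + y * Complex.I)‖) (𝓝[>] 0) atTop := by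
    intro R
    obtain ⟨C, hC⟩ := hbd R
    have hC0 : 0 ≤ C := by
      simpa using (norm_nonneg _).trans (hC Complex.I (by simp) (by simp) (by simp))
    let K := C ^ (1 / 2 : ℝ)
    have hK : 0 ≤ K := by positivity
    have hint : ∀ n, ∫⁻ x in Set.Ioc (-(R : ℝ)) R,
        ENNReal.ofReal (‖m (x + ε n * Complex.I)‖ ^ (1 / 2 : ℝ)) ≤
          ENNReal.ofReal (2 * (2 * R * K + 4 * K)) := by
      intro n
      have hb := norm_integral_horizontal_le hG (Nat.cast_nonneg R) hK (fun z h0 h1 h2 => by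
        simp only [G, Complex.norm_cpow_real, hnorm]
        rw [Real.rpow_neg h0.le, ← div_eq_mul_inv, ← Real.div_rpow hC0 h0.le]
        exact Real.rpow_le_rpow (norm_nonneg _) (hC z h0 h1 h2) (by norm_num)) (hε n) (hε1 n)
      have hii : IntervalIntegrable (fun x : ℝ => G (x + ε n * Complex.I)) volume (-(R : ℝ)) R :=
        (hcont n).intervalIntegrable _ _
      have hiG : Integrable (fun x : ℝ => G (x + ε n * Complex.I))
          (volume.restrict (Set.Ioc (-(R : ℝ)) R)) := hii.1
      have hpt : ∀ x : ℝ, ‖m (x + ε n * Complex.I)‖ ^ (1 / 2 : ℝ) ≤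
          2 * (G (x + ε n * Complex.I)).re := fun x => by
        have := norm_le_two_mul_re_cpow_half (hre (x + ε n * Complex.I) (by simpa using hε n))
        rwa [hnorm] at this
      calc _ ≤ ∫⁻ x in Set.Ioc (-(R : ℝ)) R,
            ENNReal.ofReal (2 * (G (x + ε n * Complex.I)).re) :=
            lintegral_mono fun x => ENNReal.ofReal_le_ofReal (hpt x)
        _ = ENNReal.ofReal (∫ x in Set.Ioc (-(R : ℝ)) R, 2 * (G (x + ε n * Complex.I)).re) := by
            rw [ofReal_integral_eq_lintegral_ofReal]
            · exact hiG.re.const_mul 2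
            · exact Filter.Eventually.of_forall fun x => le_trans (by positivity) (hpt x)
        _ ≤ _ := by
            apply ENNReal.ofReal_le_ofReal
            rw [integral_const_mul]
            have h1 : ∫ x in Set.Ioc (-(R : ℝ)) R, (G (x + ε n * Complex.I)).re =
                (∫ x in Set.Ioc (-(R : ℝ)) R, G (x + ε n * Complex.I)).re := integral_re hiG
            rw [h1, ← intervalIntegral.integral_of_le (by linarith [R.cast_nonneg (α := ℝ)])]
            have := (Complex.re_le_norm _).trans hb
            linarith
    have hmeas : ∀ n, Measurable fun x : ℝ =>
        ENNReal.ofReal (‖m (x + ε n * Complex.I)‖ ^ (1 / 2 : ℝ)) := fun n => by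
      have : Continuous fun x : ℝ => m (x + ε n * Complex.I) :=
        hanal.continuousOn.comp_continuous (by fun_prop) fun x => by simpa using hε n
      exact (this.norm.measurable.pow_const _).ennreal_ofReal
    have hfin : ∫⁻ x in Set.Ioc (-(R : ℝ)) R, liminf (fun n =>
        ENNReal.ofReal (‖m (x + ε n * Complex.I)‖ ^ (1 / 2 : ℝ))) atTop ≠ ⊤ := by
      refine ne_top_of_le_ne_top (b := ENNReal.ofReal (2 * (2 * R * K + 4 * K)))
        ENNReal.ofReal_ne_top ?_
      refine (lintegral_liminf_le hmeas).trans ?_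
      refine (liminf_le_liminf (Filter.Eventually.of_forall hint)).trans ?_
      rw [liminf_const]
    filter_upwards [ae_lt_top (Measurable.liminf hmeas) hfin] with x hx hT
    have h1 : Tendsto (fun n => ENNReal.ofReal (‖m (x + ε n * Complex.I)‖ ^ (1 / 2 : ℝ)))
        atTop (𝓝 ⊤) :=
      ENNReal.tendsto_ofReal_atTop.comp
        ((tendsto_rpow_atTop (by norm_num)).comp (hT.comp hεlim))
    rw [h1.liminf_eq] at hx
    exact lt_irrefl _ hx
  have hU : (⋃ R : ℕ, Set.Ioc (-(R : ℝ)) R) = Set.univ := by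
    refine Set.eq_univ_of_forall fun x => ?_
    obtain ⟨n, hn⟩ := exists_nat_gt |x|
    have := abs_lt.1 hn
    exact Set.mem_iUnion.2 ⟨n, this.1, this.2.le⟩
  rw [← Measure.restrict_univ (μ := (volume : Measure ℝ)), ← hU, ae_restrict_iUnion_iff]
  exact hlocal

/-- The regularised Cauchy kernel `(l - z)⁻¹ - l / (1 + l ^ 2)` of the Nevanlinna representation. -/
noncomputable def nevanlinnaKernel (z : ℂ) (l : ℝ) : ℂ :=
  ((l : ℂ) - z)⁻¹ - (l : ℂ) * (1 + (l : ℂ) ^ 2)⁻¹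

/-- `m` has the Nevanlinna representation with constants `c`, `d` and measure `ω`. -/
structure IsNevanlinnaRep (m : ℂ → ℂ) (c d : ℝ) (ω : Measure ℝ) : Prop where
  nonneg : 0 ≤ d
  lintegral_lt_top : (∫⁻ l : ℝ, ENNReal.ofReal ((1 + l ^ 2)⁻¹) ∂ω) < ⊤
  eq : ∀ z : ℂ, 0 < z.im → m z = (c : ℂ) + (d : ℂ) * z + ∫ l : ℝ, nevanlinnaKernel z l ∂ω

lemma measurable_nevanlinnaKernel (z : ℂ) : Measurable (nevanlinnaKernel z) := by
  unfold nevanlinnaKernel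
  fun_prop

lemma ofReal_sub_ne_zero {z : ℂ} (hz : 0 < z.im) (l : ℝ) : (l : ℂ) - z ≠ 0 := fun h => by
  have := congrArg Complex.im h
  simp at this
  exact hz.ne' this

lemma one_add_sq_ofReal_ne_zero (l : ℝ) : (1 + (l : ℂ) ^ 2) ≠ 0 := by
  have h : (1 + l ^ 2 : ℝ) ≠ 0 := by positivity
  exact_mod_cast h

lemma norm_nevanlinnaKernel_le {z : ℂ} (hz : 0 < z.im) (l : ℝ) :
    ‖nevanlinnaKernel z l‖ ≤ ((1 + ‖z‖ ^ 2) / z.im + ‖z‖) * (1 + l ^ 2)⁻¹ := by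
  have hne := ofReal_sub_ne_zero hz l
  have hne' := one_add_sq_ofReal_ne_zero l
  have heq : nevanlinnaKernel z l = ((1 + z ^ 2) / (l - z) + z) * ((1 + l ^ 2)⁻¹ : ℝ) := by
    unfold nevanlinnaKernel
    push_cast
    field_simp
    ring
  have him : z.im ≤ ‖(l : ℂ) - z‖ := by
    have := Complex.abs_im_le_norm ((l : ℂ) - z)
    simp only [Complex.sub_im, Complex.ofReal_im, zero_sub, abs_neg] at this
    exact (le_abs_self _).trans this
  rw [heq, norm_mul, Complex.norm_real, Real.norm_of_nonneg (by positivity)]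
  gcongr
  refine (norm_add_le _ _).trans ?_
  gcongr
  rw [norm_div]
  gcongr
  refine (norm_add_le _ _).trans ?_
  rw [norm_pow, norm_one]

lemma im_nevanlinnaKernel (z : ℂ) (l : ℝ) :
    (nevanlinnaKernel z l).im = z.im / ((l - z.re) ^ 2 + z.im ^ 2) := by
  have h2 : (l : ℂ) * (1 + (l : ℂ) ^ 2)⁻¹ = ((l * (1 + l ^ 2)⁻¹ : ℝ) : ℂ) := by push_cast; rfl
  rw [nevanlinnaKernel, h2, Complex.sub_im, Complex.ofReal_im, Complex.inv_im,
    Complex.normSq_apply]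
  simp
  ring

namespace IsNevanlinnaRep

variable {m : ℂ → ℂ} {c d : ℝ} {ω : Measure ℝ}

lemma integrable_weight (h : IsNevanlinnaRep m c d ω) :
    Integrable (fun l : ℝ => (1 + l ^ 2)⁻¹) ω := by
  refine ⟨by fun_prop, ?_⟩
  rw [hasFiniteIntegral_iff_ofReal (Filter.Eventually.of_forall fun l => by positivity)]
  exact h.lintegral_lt_top

lemma integrable_kernel (h : IsNevanlinnaRep m c d ω) {z : ℂ} (hz : 0 < z.im) :
    Integrable (nevanlinnaKernel z) ω :=
  (h.integrable_weight.const_mul _).mono' (measurable_nevanlinnaKernel z).aestronglyMeasurable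
    (Filter.Eventually.of_forall (norm_nevanlinnaKernel_le hz))

lemma exists_norm_le (h : IsNevanlinnaRep m c d ω) (R : ℝ) :
    ∃ C : ℝ, ∀ z : ℂ, 0 < z.im → z.im ≤ 1 → |z.re| ≤ R → ‖m z‖ ≤ C / z.im := by
  let W := ∫ l : ℝ, (1 + l ^ 2)⁻¹ ∂ω
  have hW : 0 ≤ W := integral_nonneg fun l => by positivity
  let S := R + 1
  refine ⟨|c| + d * S + ((1 + S ^ 2) + S) * W, fun z hz hz1 hzR => ?_⟩
  have hd := h.nonneg
  have hS : ‖z‖ ≤ S := by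
    refine (Complex.norm_le_abs_re_add_abs_im z).trans ?_
    rw [abs_of_pos hz]
    exact add_le_add hzR hz1
  have hS0 : 0 ≤ S := (norm_nonneg z).trans hS
  have hint : ‖∫ l : ℝ, nevanlinnaKernel z l ∂ω‖ ≤ ((1 + ‖z‖ ^ 2) / z.im + ‖z‖) * W := by
    rw [← integral_const_mul]
    exact norm_integral_le_of_norm_le (h.integrable_weight.const_mul _)
      (Filter.Eventually.of_forall (norm_nevanlinnaKernel_le hz))
  have hle : ∀ t : ℝ, 0 ≤ t → t ≤ t / z.im := fun t ht => by
    rw [le_div_iff₀ hz]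
    nlinarith
  calc ‖m z‖ ≤ |c| + d * ‖z‖ + ((1 + ‖z‖ ^ 2) / z.im + ‖z‖) * W := by
        rw [h.eq z hz]
        refine (norm_add_le _ _).trans (add_le_add ((norm_add_le _ _).trans ?_) hint)
        rw [norm_mul, Complex.norm_real, Complex.norm_real, Real.norm_of_nonneg hd,
          Real.norm_eq_abs]
    _ ≤ |c| + d * S + ((1 + S ^ 2) / z.im + S) * W := by gcongr
    _ ≤ |c| / z.im + d * S / z.im + ((1 + S ^ 2) / z.im + S / z.im) * W := by
        have h1 := hle |c| (abs_nonneg c)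
        have h2 := hle (d * S) (by positivity)
        have h3 := hle S hS0
        gcongr
    _ = _ := by ring

/-- The imaginary part of `m` is the Poisson integral of `ω` up to a linear term. -/
lemma ofReal_im_eq (h : IsNevanlinnaRep m c d ω) (x : ℝ) {y : ℝ} (hy : 0 < y) :
    ENNReal.ofReal (m (x + y * Complex.I)).im = ENNReal.ofReal (d * y) +
      ∫⁻ l, ENNReal.ofReal (y / ((l - x) ^ 2 + y ^ 2)) ∂ω := by
  have hz : 0 < (x + y * Complex.I : ℂ).im := by simpa using hy
  have hk : ∀ l : ℝ, (nevanlinnaKernel (x + y * Complex.I) l).im = y / ((l - x) ^ 2 + y ^ 2) :=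
    fun l => by simpa using im_nevanlinnaKernel (x + y * Complex.I) l
  have hi : Integrable (fun l => y / ((l - x) ^ 2 + y ^ 2)) ω := by
    simp only [← hk]
    exact (h.integrable_kernel hz).im
  have h2 : (∫ l, nevanlinnaKernel (x + y * Complex.I) l ∂ω).im =
      ∫ l, y / ((l - x) ^ 2 + y ^ 2) ∂ω := by
    simp only [← hk]
    exact (integral_im (h.integrable_kernel hz)).symm
  have h3 : (m (x + y * Complex.I)).im = d * y + ∫ l, y / ((l - x) ^ 2 + y ^ 2) ∂ω := by
    rw [h.eq _ hz, ← h2]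
    simp
  rw [h3, ENNReal.ofReal_add (mul_nonneg h.nonneg hy.le)
    (integral_nonneg fun l => by positivity), ofReal_integral_eq_lintegral_ofReal hi
    (Filter.Eventually.of_forall fun l => by positivity)]

lemma isLocallyFiniteMeasure (h : IsNevanlinnaRep m c d ω) : IsLocallyFiniteMeasure ω := by
  refine ⟨fun x => ⟨Metric.ball x 1, Metric.ball_mem_nhds x one_pos, ?_⟩⟩
  have hpos : 0 < (1 + (|x| + 1) ^ 2)⁻¹ := by positivity
  refine lt_of_le_of_lt (measure_mono fun l hl => ?_)
    (h.integrable_weight.measure_ge_lt_top hpos)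
  have h1 : |l - x| < 1 := by simpa [Real.dist_eq] using hl
  have h2 : |l| ≤ |x| + 1 := by
    have := abs_add_le (l - x) x
    rw [sub_add_cancel] at this
    linarith
  have h3 : l ^ 2 ≤ (|x| + 1) ^ 2 := sq_le_sq' (by linarith [neg_abs_le l]) ((le_abs_self l).trans h2)
  simp only [Set.mem_ofPred_eq]
  gcongr

end IsNevanlinnaRep

lemma lintegral_poisson_le_of_measure_closedBall_le {ν : Measure ℝ} {x y : ℝ} (hy : 0 < y)
    {ε : ENNReal} (hν : ∀ r : ℝ, 0 < r → ν (Metric.closedBall x r) ≤ ε * ENNReal.ofReal (2 * r)) :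
    ∫⁻ l, ENNReal.ofReal (y / ((l - x) ^ 2 + y ^ 2)) ∂ν ≤ 16 * ε := by
  have hpt : ∀ l : ℝ, ENNReal.ofReal (y / ((l - x) ^ 2 + y ^ 2)) ≤
      ∑' k : ℕ, (Metric.closedBall x (2 ^ k * y)).indicator
        (fun _ => ENNReal.ofReal (4 / (4 ^ k * y))) l := by
    intro l
    have hex : ∃ k : ℕ, |l - x| ≤ 2 ^ k * y := by
      obtain ⟨k, hk⟩ := pow_unbounded_of_one_lt (|l - x| / y) one_lt_two
      exact ⟨k, ((div_lt_iff₀ hy).1 hk).le⟩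
    classical
    have hk := Nat.find_spec hex
    have hmin := fun j => Nat.find_min hex (m := j)
    generalize Nat.find hex = k at hk hmin
    refine le_trans ?_ (ENNReal.le_tsum k)
    rw [Set.indicator_of_mem (by rwa [Metric.mem_closedBall, Real.dist_eq])]
    apply ENNReal.ofReal_le_ofReal
    rw [div_le_div_iff₀ (by positivity) (by positivity)]
    rcases k with _ | k
    · nlinarith [sq_nonneg (l - x), sq_nonneg y]
    · have h1 : 2 ^ k * y < |l - x| := not_le.1 (hmin k (Nat.lt_succ_self k))
      have h2 : (2 ^ k * y) ^ 2 ≤ (l - x) ^ 2 := by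
        rw [← sq_abs (l - x)]
        gcongr
      have h3 : (4 : ℝ) ^ (k + 1) = 4 * (2 ^ k) ^ 2 := by
        rw [pow_succ, ← pow_mul, mul_comm k 2, pow_mul]; norm_num; ring
      rw [h3]
      nlinarith [sq_nonneg y]
  have hterm : ∀ k : ℕ, ENNReal.ofReal (4 / (4 ^ k * y)) * ν (Metric.closedBall x (2 ^ k * y)) ≤
      (8 * ε) * (2⁻¹) ^ k := by
    intro k
    refine (mul_le_mul_right (hν _ (by positivity)) _).trans (le_of_eq ?_)
    have h1 : 4 / (4 ^ k * y) * (2 * (2 ^ k * y)) = 8 * (2⁻¹) ^ k := by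
      have : (4 : ℝ) ^ k = 2 ^ k * 2 ^ k := by rw [← mul_pow]; norm_num
      rw [this, inv_pow]
      field_simp
      ring
    have h2 : ENNReal.ofReal (8 * (2⁻¹) ^ k) = 8 * (2⁻¹) ^ k := by
      rw [ENNReal.ofReal_mul (by norm_num), ENNReal.ofReal_pow (by norm_num),
        ENNReal.ofReal_inv_of_pos (by norm_num)]
      simp
    rw [mul_left_comm, ← ENNReal.ofReal_mul (by positivity), h1, h2]
    ring
  calc _ ≤ ∫⁻ l, ∑' k : ℕ, (Metric.closedBall x (2 ^ k * y)).indicator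
        (fun _ => ENNReal.ofReal (4 / (4 ^ k * y))) l ∂ν := lintegral_mono hpt
    _ = ∑' k : ℕ, ENNReal.ofReal (4 / (4 ^ k * y)) * ν (Metric.closedBall x (2 ^ k * y)) := by
        rw [lintegral_tsum fun k =>
          (measurable_const.indicator Metric.isClosed_closedBall.measurableSet).aemeasurable]
        simp only [lintegral_indicator_const Metric.isClosed_closedBall.measurableSet]
    _ ≤ ∑' k : ℕ, (8 * ε) * (2⁻¹) ^ k := ENNReal.tsum_le_tsum hterm
    _ = 16 * ε := by
        rw [ENNReal.tsum_mul_left, ENNReal.tsum_geometric, ENNReal.one_sub_inv_two, inv_inv,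
          mul_right_comm]
        norm_num

namespace IsNevanlinnaRep

variable {m : ℂ → ℂ} {c d : ℝ} {ω : Measure ℝ}

lemma measure_div_volume_le_ofReal_im (h : IsNevanlinnaRep m c d ω) (x : ℝ) {y : ℝ} (hy : 0 < y) :
    ω (Metric.closedBall x y) / volume (Metric.closedBall x y) ≤
      ENNReal.ofReal (m (x + y * Complex.I)).im := by
  rw [h.ofReal_im_eq x hy, Real.volume_closedBall]
  refine le_trans ?_ le_add_self
  rw [ENNReal.div_eq_inv_mul, ← ENNReal.ofReal_inv_of_pos (by positivity),
    ← lintegral_indicator_const Metric.isClosed_closedBall.measurableSet]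
  refine lintegral_mono fun l => Set.indicator_apply_le' (fun hl => ?_) (fun _ => zero_le)
  apply ENNReal.ofReal_le_ofReal
  rw [Metric.mem_closedBall, Real.dist_eq] at hl
  have h2 : (l - x) ^ 2 ≤ y ^ 2 := by
    rw [← sq_abs (l - x)]
    gcongr
  rw [inv_eq_one_div, div_le_div_iff₀ (by positivity) (by positivity)]
  nlinarith

lemma tendsto_ofReal_im_of_density_zero (h : IsNevanlinnaRep m c d ω) {x : ℝ}
    (hx : Tendsto (fun r => ω (Metric.closedBall x r) / volume (Metric.closedBall x r))
      (𝓝[>] 0) (𝓝 0)) :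
    Tendsto (fun y : ℝ => ENNReal.ofReal (m (x + y * Complex.I)).im) (𝓝[>] 0) (𝓝 0) := by
  rw [ENNReal.tendsto_nhds_zero]
  intro ε hε
  obtain ⟨η, hη, hηε⟩ : ∃ η : ENNReal, 0 < η ∧ 16 * η + 16 * η = ε := by
    refine ⟨ε / 32, ENNReal.div_pos hε.ne' (by norm_num), ?_⟩
    rw [← add_mul]
    norm_num
    exact ENNReal.mul_div_cancel (by norm_num) (by norm_num)
  obtain ⟨δ, hδ, hδη⟩ : ∃ δ : ℝ, 0 < δ ∧ ∀ r, 0 < r → r ≤ δ →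
      ω (Metric.closedBall x r) ≤ η * ENNReal.ofReal (2 * r) := by
    obtain ⟨δ, hδ, hsub⟩ := mem_nhdsGT_iff_exists_Ioc_subset.1 ((ENNReal.tendsto_nhds_zero.1 hx) η hη)
    refine ⟨δ, hδ, fun r hr hrδ => ?_⟩
    have := hsub ⟨hr, hrδ⟩
    simp only [Set.mem_ofPred_eq, Real.volume_closedBall] at this
    refine (ENNReal.div_le_iff ?_ ENNReal.ofReal_ne_top).1 this
    simpa using hr
  let B := Metric.closedBall x δ
  have hB : MeasurableSet B := Metric.isClosed_closedBall.measurableSet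
  have hnear : ∀ y : ℝ, 0 < y →
      ∫⁻ l in B, ENNReal.ofReal (y / ((l - x) ^ 2 + y ^ 2)) ∂ω ≤ 16 * η := by
    intro y hy
    refine lintegral_poisson_le_of_measure_closedBall_le hy fun r hr => ?_
    rcases le_total r δ with hrδ | hrδ
    · exact (Measure.restrict_apply_le _ _).trans (hδη r hr hrδ)
    · calc _ ≤ ω B := by
            rw [Measure.restrict_apply Metric.isClosed_closedBall.measurableSet]
            exact measure_mono Set.inter_subset_right
        _ ≤ η * ENNReal.ofReal (2 * δ) := hδη δ hδ le_rfl
        _ ≤ _ := by gcongr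
  let C := (1 + 2 * x ^ 2) / δ ^ 2 + 2
  let W := ∫⁻ l : ℝ, ENNReal.ofReal ((1 + l ^ 2)⁻¹) ∂ω
  have hfar : ∀ y : ℝ, 0 < y →
      ∫⁻ l in Bᶜ, ENNReal.ofReal (y / ((l - x) ^ 2 + y ^ 2)) ∂ω ≤ ENNReal.ofReal (y * C) * W := by
    intro y hy
    have hC : 0 ≤ C := by positivity
    calc _ ≤ ∫⁻ l in Bᶜ, ENNReal.ofReal (y * C) * ENNReal.ofReal ((1 + l ^ 2)⁻¹) ∂ω := by
          refine setLIntegral_mono (by fun_prop) fun l hl => ?_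
          rw [← ENNReal.ofReal_mul (by positivity)]
          apply ENNReal.ofReal_le_ofReal
          have hl' : δ < |l - x| := by
            simpa [B, Metric.mem_closedBall, Real.dist_eq] using hl
          have h1 : δ ^ 2 ≤ (l - x) ^ 2 := by
            rw [← sq_abs (l - x)]
            gcongr
          have h2 : 1 + l ^ 2 ≤ C * (l - x) ^ 2 := by
            have h3 : 1 + 2 * x ^ 2 ≤ (1 + 2 * x ^ 2) / δ ^ 2 * (l - x) ^ 2 := by
              rw [div_mul_eq_mul_div, le_div_iff₀ (by positivity)]
              gcongr
            simp only [C]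
            nlinarith [sq_nonneg (l - 2 * x)]
          rw [← div_eq_mul_inv, div_le_div_iff₀ (by positivity) (by positivity)]
          have h4 : 0 ≤ y * (C * y ^ 2) := by positivity
          nlinarith
      _ ≤ ∫⁻ l, ENNReal.ofReal (y * C) * ENNReal.ofReal ((1 + l ^ 2)⁻¹) ∂ω :=
          setLIntegral_le_lintegral _ _
      _ = _ := lintegral_const_mul _ (by fun_prop)
  have hrest : Tendsto (fun y : ℝ => ENNReal.ofReal (d * y) + ENNReal.ofReal (y * C) * W)
      (𝓝[>] 0) (𝓝 0) := by
    have h1 : Tendsto (fun y : ℝ => ENNReal.ofReal (d * y)) (𝓝 0) (𝓝 0) := by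
      have : Continuous fun y : ℝ => ENNReal.ofReal (d * y) :=
        ENNReal.continuous_ofReal.comp (by fun_prop)
      simpa using this.tendsto 0
    have h2 : Tendsto (fun y : ℝ => ENNReal.ofReal (y * C)) (𝓝 0) (𝓝 0) := by
      have : Continuous fun y : ℝ => ENNReal.ofReal (y * C) :=
        ENNReal.continuous_ofReal.comp (by fun_prop)
      simpa using this.tendsto 0
    have h3 := h1.add (ENNReal.Tendsto.mul_const h2 (b := W) (Or.inr h.lintegral_lt_top.ne))
    simp only [zero_mul, add_zero] at h3
    exact h3.mono_left nhdsWithin_le_nhds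
  have h16 : 0 < 16 * η := ENNReal.mul_pos (by norm_num) hη.ne'
  filter_upwards [(ENNReal.tendsto_nhds_zero.1 hrest) _ h16, self_mem_nhdsWithin] with y hy1 hy
  rw [h.ofReal_im_eq x hy, ← lintegral_add_compl _ hB, ← hηε]
  calc _ ≤ ENNReal.ofReal (d * y) + (16 * η + ENNReal.ofReal (y * C) * W) :=
        add_le_add le_rfl (add_le_add (hnear y hy) (hfar y hy))
    _ = 16 * η + (ENNReal.ofReal (d * y) + ENNReal.ofReal (y * C) * W) := by
        rw [add_left_comm]
    _ ≤ _ := by gcongr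

end IsNevanlinnaRep

/-- If `Im m₁ = ‖α + β m₁‖² Im m₂`, then the density of the measure of `m₁` vanishes almost
everywhere where the density of the measure of `m₂` does. -/
lemma ae_rnDeriv_eq_zero_imp {m₁ m₂ : ℂ → ℂ} {c₁ d₁ c₂ d₂ : ℝ} {ω₁ ω₂ : Measure ℝ}
    (h₁ : IsNevanlinnaRep m₁ c₁ d₁ ω₁) (h₂ : IsNevanlinnaRep m₂ c₂ d₂ ω₂)
    (hanal : DifferentiableOn ℂ m₁ {z : ℂ | 0 < z.im})
    (hmap : ∀ z : ℂ, 0 < z.im → 0 < (m₁ z).im) (α β : ℂ)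
    (him : ∀ z : ℂ, 0 < z.im → (m₁ z).im = ‖α + β * m₁ z‖ ^ 2 * (m₂ z).im) :
    ∀ᵐ x : ℝ, ω₂.rnDeriv volume x = 0 → ω₁.rnDeriv volume x = 0 := by
  have := h₁.isLocallyFiniteMeasure
  have := h₂.isLocallyFiniteMeasure
  filter_upwards [ae_not_tendsto_norm_atTop hanal hmap h₁.exists_norm_le,
    Besicovitch.ae_tendsto_rnDeriv ω₁ volume, Besicovitch.ae_tendsto_rnDeriv ω₂ volume]
    with x hx hx1 hx2 h0
  by_contra hne
  refine hx ?_
  rw [h0] at hx2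
  have ht := h₂.tendsto_ofReal_im_of_density_zero hx2
  obtain ⟨k, hk0, hk⟩ := ENNReal.lt_iff_exists_nnreal_btwn.1 (pos_iff_ne_zero.2 hne)
  have hk0' : (0 : ℝ) < k := by exact_mod_cast hk0
  rw [tendsto_atTop]
  intro M
  let D : ℝ := (‖α‖ + ‖β‖ * |M|) ^ 2 + 1
  have hD : 0 < D := by positivity
  have hpos : 0 < ENNReal.ofReal (k / D / 2) := by
    rw [ENNReal.ofReal_pos]
    positivity
  filter_upwards [hx1.eventually (lt_mem_nhds hk), (ENNReal.tendsto_nhds_zero.1 ht) _ hpos,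
    self_mem_nhdsWithin] with y hy1 hy2 hy
  have hz : 0 < (x + y * Complex.I : ℂ).im := by simpa using hy
  have hlow : (k : ℝ) ≤ (m₁ (x + y * Complex.I)).im := by
    have := hy1.le.trans (h₁.measure_div_volume_le_ofReal_im x hy)
    rw [← ENNReal.ofReal_coe_nnreal] at this
    exact (ENNReal.ofReal_le_ofReal_iff (hmap _ hz).le).1 this
  have hupp : (m₂ (x + y * Complex.I)).im ≤ k / D / 2 :=
    (ENNReal.ofReal_le_ofReal_iff (by positivity)).1 hy2
  by_contra hM
  have hM' : ‖m₁ (x + y * Complex.I)‖ ≤ |M| := (not_le.1 hM).le.trans (le_abs_self M)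
  have hden : ‖α + β * m₁ (x + y * Complex.I)‖ ^ 2 ≤ D := by
    have : ‖α + β * m₁ (x + y * Complex.I)‖ ≤ ‖α‖ + ‖β‖ * |M| := by
      refine (norm_add_le _ _).trans ?_
      rw [norm_mul]
      gcongr
    have := pow_le_pow_left₀ (norm_nonneg _) this 2
    simp only [D]
    linarith
  have h3 : (m₁ (x + y * Complex.I)).im ≤ D * (k / D / 2) := by
    rw [him _ hz]
    exact (mul_le_mul_of_nonneg_left hupp (by positivity)).trans
      (mul_le_mul_of_nonneg_right hden (by positivity))
  have h4 : D * (k / D / 2) = k / 2 := by field_simp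
  linarith

/-- Absolute continuity between the absolutely continuous parts of two measures follows from an
inclusion between the zero sets of their densities. -/
lemma absolutelyContinuous_of_ae_rnDeriv_eq_zero_imp {ω ωac ωs ω' ωac' ωs' : Measure ℝ}
    [SigmaFinite ω] [SigmaFinite ω'] (h : ω = ωac + ωs) (hac : ωac ≪ volume)
    (hs : ωs ⟂ₘ volume) (h' : ω' = ωac' + ωs') (hac' : ωac' ≪ volume) (hs' : ωs' ⟂ₘ volume)
    (hzero : ∀ᵐ x : ℝ, ω'.rnDeriv volume x = 0 → ω.rnDeriv volume x = 0) : ωac ≪ ωac' := by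
  have density : ∀ {μ μac μs : Measure ℝ} [SigmaFinite μ], μ = μac + μs → μac ≪ volume →
      μs ⟂ₘ volume → μac = volume.withDensity (μ.rnDeriv volume) := by
    intro μ μac μs _ hμ hμac hμs
    have : SigmaFinite μac := Measure.sigmaFinite_of_le μ (hμ ▸ Measure.le_add_right le_rfl)
    have : SigmaFinite μs := Measure.sigmaFinite_of_le μ (hμ ▸ Measure.le_add_left le_rfl)
    have heq : μ.rnDeriv volume =ᵐ[volume] μac.rnDeriv volume := by
      rw [hμ]
      filter_upwards [Measure.rnDeriv_add' μac μs volume, hμs.rnDeriv_ae_eq_zero] with x h1 h2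
      rw [h1, Pi.add_apply, h2, Pi.zero_apply, add_zero]
    rw [withDensity_congr_ae heq, Measure.withDensity_rnDeriv_eq _ _ hμac]
  rw [density h hac hs, density h' hac' hs']
  refine Measure.AbsolutelyContinuous.mk fun s hsm h0 => ?_
  rw [withDensity_apply _ hsm, lintegral_eq_zero_iff (Measure.measurable_rnDeriv _ _)] at h0 ⊢
  filter_upwards [h0, ae_restrict_of_ae hzero] with x hx hx'
  exact hx' hx

end Herglotz

/-- Aronszajn–Donoghue: for a Herglotz function `m` with representation measure `ω`,
`a ∈ 𝒜₂` with nonvanishing denominator, and `ω_a` a representation measure of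
`m_a = (a₂₁ + a₂₂ m)/(a₁₁ + a₁₂ m)`, the absolutely continuous parts of `ω_a` and `ω`
(with respect to Lebesgue measure) are mutually absolutely continuous. -/
theorem ac_parts_equivalent
    (m : ℂ → ℂ)
    (hanal : DifferentiableOn ℂ m {z : ℂ | 0 < z.im})
    (hmap : ∀ z : ℂ, 0 < z.im → 0 < (m z).im)
    (c d : ℝ) (ω : Measure ℝ) (hd : 0 ≤ d)
    (hω : (∫⁻ l : ℝ, ENNReal.ofReal ((1 + l ^ 2)⁻¹) ∂ω) < ⊤)
    (hrep : ∀ z : ℂ, 0 < z.im →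
      m z = (c : ℂ) + (d : ℂ) * z +
        ∫ l : ℝ, (((l : ℂ) - z)⁻¹ - (l : ℂ) * (1 + (l : ℂ) ^ 2)⁻¹) ∂ω)
    (a : Matrix (Fin 2) (Fin 2) ℂ)
    (ha : aᴴ * !![0, -1; 1, 0] * a = !![0, -1; 1, 0])
    (hda : ∀ z : ℂ, 0 < z.im → a 0 0 + a 0 1 * m z ≠ 0)
    (ca da : ℝ) (ωa : Measure ℝ) (hda' : 0 ≤ da)
    (hωa : (∫⁻ l : ℝ, ENNReal.ofReal ((1 + l ^ 2)⁻¹) ∂ωa) < ⊤)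
    (hrepa : ∀ z : ℂ, 0 < z.im →
      (a 1 0 + a 1 1 * m z) / (a 0 0 + a 0 1 * m z) = (ca : ℂ) + (da : ℂ) * z +
        ∫ l : ℝ, (((l : ℂ) - z)⁻¹ - (l : ℂ) * (1 + (l : ℂ) ^ 2)⁻¹) ∂ωa)
    (ωac ωs : Measure ℝ) (hdecomp : ω = ωac + ωs)
    (hac : ωac ≪ volume) (hs : Measure.MutuallySingular ωs volume)
    (ωaac ωas : Measure ℝ) (hdecompa : ωa = ωaac + ωas)
    (haac : ωaac ≪ volume) (has : Measure.MutuallySingular ωas volume) :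
    ωaac ≪ ωac ∧ ωac ≪ ωaac := by
  have e00 := congrFun (congrFun ha 0) 0
  have e01 := congrFun (congrFun ha 0) 1
  have e10 := congrFun (congrFun ha 1) 0
  have e11 := congrFun (congrFun ha 1) 1
  simp [Matrix.mul_apply, Fin.sum_univ_two] at e00 e01 e10 e11
  let ma : ℂ → ℂ := fun z => (a 1 0 + a 1 1 * m z) / (a 0 0 + a 0 1 * m z)
  have h : Herglotz.IsNevanlinnaRep m c d ω := ⟨hd, hω, hrep⟩
  have h' : Herglotz.IsNevanlinnaRep ma ca da ωa := ⟨hda', hωa, hrepa⟩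
  have him : ∀ z : ℂ, 0 < z.im → (m z).im = ‖a 0 0 + a 0 1 * m z‖ ^ 2 * (ma z).im := by
    intro z hz
    have hne := hda z hz
    have hN : ma z * (a 0 0 + a 0 1 * m z) = a 1 0 + a 1 1 * m z := div_mul_cancel₀ _ hne
    have hN' := congrArg (starRingEnd ℂ) hN
    simp only [map_add, map_mul] at hN'
    have hC : m z - (starRingEnd ℂ) (m z) =
        (a 0 0 + a 0 1 * m z) * (starRingEnd ℂ) (a 0 0 + a 0 1 * m z) *
          (ma z - (starRingEnd ℂ) (ma z)) := by
      simp only [map_add, map_mul]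
      linear_combination e00 + m z * e01 + (starRingEnd ℂ) (m z) * e10
        + m z * (starRingEnd ℂ) (m z) * e11
        - ((starRingEnd ℂ) (a 0 0) + (starRingEnd ℂ) (a 0 1) * (starRingEnd ℂ) (m z)) * hN
        + (a 0 0 + a 0 1 * m z) * hN'
    rw [Complex.mul_conj, Complex.sub_conj, Complex.sub_conj, Complex.normSq_eq_norm_sq] at hC
    have := congrArg Complex.im hC
    simp only [Complex.im_ofReal_mul, Complex.I_im, mul_one] at this
    linarith
  have hinv : ∀ z : ℂ, 0 < z.im →
      (a 0 0 + a 0 1 * m z) *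
        ((starRingEnd ℂ) (a 1 1) + -(starRingEnd ℂ) (a 0 1) * ma z) = 1 := by
    intro z hz
    have hne := hda z hz
    simp only [ma]
    field_simp
    linear_combination e10 + m z * e11
  have hpos : ∀ z : ℂ, 0 < z.im → 0 < (ma z).im := by
    intro z hz
    have h1 := hmap z hz
    rw [him z hz] at h1
    exact pos_of_mul_pos_right h1 (by positivity)
  have hanal' : DifferentiableOn ℂ ma {z : ℂ | 0 < z.im} :=
    ((differentiableOn_const _).add (hanal.const_mul _)).div
      ((differentiableOn_const _).add (hanal.const_mul _)) hda
  have him' : ∀ z : ℂ, 0 < z.im → (ma z).im =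
      ‖(starRingEnd ℂ) (a 1 1) + -(starRingEnd ℂ) (a 0 1) * ma z‖ ^ 2 * (m z).im := by
    intro z hz
    rw [him z hz, ← mul_assoc, ← mul_pow, ← norm_mul, mul_comm (_ + _), hinv z hz]
    simp
  have := h.isLocallyFiniteMeasure
  have := h'.isLocallyFiniteMeasure
  exact ⟨Herglotz.absolutelyContinuous_of_ae_rnDeriv_eq_zero_imp hdecompa haac has hdecomp hac hs
      (Herglotz.ae_rnDeriv_eq_zero_imp h' h hanal' hpos _ _ him'),
    Herglotz.absolutelyContinuous_of_ae_rnDeriv_eq_zero_imp hdecomp hac hs hdecompa haac has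
      (Herglotz.ae_rnDeriv_eq_zero_imp h h' hanal hmap _ _ him)⟩
end

section
/- Let m be a Herglotz function with Nevanlinna representation measure ω (i.e., m(z) = c + dz + ∫_ℝ ((λ − z)⁻¹ − λ(1 + λ²)⁻¹) dω(λ) on ℂ₊ with c ∈ ℝ, d ≥ 0, ∫_ℝ (1 + λ²)⁻¹ dω(λ) < ∞). Let a ∈ 𝒜₂ with a_{1,2} ≠ 0 satisfy a_{1,1} + a_{1,2}m(z) ≠ 0 for all z ∈ ℂ₊, let m_a(z) = (a_{2,1} + a_{2,2}m(z))/(a_{1,1} + a_{1,2}m(z)), and let ω_a be a Nevanlinna representation measure of m_a. Then the singular parts (with respect to Lebesgue measure) ω_{a,s} and ω_s are mutually singular, ω_{a,s} ⊥ ω_s; in particular, the set {λ ∈ ℝ : lim_{ε↓0} m(λ + iε) exists and equals −a_{1,1}/a_{1,2}} is a minimal support of ω_{a,s} relative to Lebesgue measure. -/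
open Matrix MeasureTheory Filter Topology

lemma nevanlinnaKernel_norm_le (z : ℂ) (hz : 0 < z.im) (l : ℝ) :
    ‖((l : ℂ) - z)⁻¹ - (l : ℂ) * (1 + (l : ℂ) ^ 2)⁻¹‖ ≤
      (‖z‖ + (1 + ‖z‖ ^ 2) / z.im) * (1 + l ^ 2)⁻¹ := by
  have hne : (l : ℂ) - z ≠ 0 := fun h => by
    have := congrArg Complex.im h
    simp at this
    exact hz.ne' this
  have hpos : (0 : ℝ) < 1 + l ^ 2 := by positivity
  have hne' : (1 + (l : ℂ) ^ 2) ≠ 0 := by exact_mod_cast hpos.ne'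
  have heq : ((l : ℂ) - z)⁻¹ - (l : ℂ) * (1 + (l : ℂ) ^ 2)⁻¹ =
      (z + (1 + z ^ 2) * ((l : ℂ) - z)⁻¹) * (1 + (l : ℂ) ^ 2)⁻¹ := by
    field_simp
    ring
  have hnorm : ‖(1 + (l : ℂ) ^ 2)⁻¹‖ = (1 + l ^ 2)⁻¹ := by
    have : (1 + (l : ℂ) ^ 2)⁻¹ = (((1 + l ^ 2)⁻¹ : ℝ) : ℂ) := by push_cast; rfl
    rw [this, Complex.norm_real, Real.norm_of_nonneg (by positivity)]
  have him : z.im ≤ ‖(l : ℂ) - z‖ := by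
    have := Complex.abs_im_le_norm ((l : ℂ) - z)
    simp only [Complex.sub_im, Complex.ofReal_im, zero_sub, abs_neg] at this
    exact (le_abs_self _).trans this
  rw [heq, norm_mul, hnorm]
  gcongr
  refine (norm_add_le _ _).trans ?_
  rw [norm_mul, norm_inv, ← div_eq_mul_inv]
  gcongr
  refine (norm_add_le _ _).trans ?_
  simp

lemma nevanlinna_weight_integrable (ω : Measure ℝ)
    (hω : (∫⁻ l : ℝ, ENNReal.ofReal ((1 + l ^ 2)⁻¹) ∂ω) < ⊤) :
    Integrable (fun l : ℝ => (1 + l ^ 2)⁻¹) ω := by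
  refine ⟨by fun_prop, ?_⟩
  rw [hasFiniteIntegral_iff_ofReal (ae_of_all _ fun l => by positivity)]
  exact hω

lemma nevanlinnaKernel_integrable (ω : Measure ℝ)
    (hω : (∫⁻ l : ℝ, ENNReal.ofReal ((1 + l ^ 2)⁻¹) ∂ω) < ⊤) (z : ℂ) (hz : 0 < z.im) :
    Integrable (fun l : ℝ => ((l : ℂ) - z)⁻¹ - (l : ℂ) * (1 + (l : ℂ) ^ 2)⁻¹) ω := by
  refine ((nevanlinna_weight_integrable ω hω).const_mul
    (‖z‖ + (1 + ‖z‖ ^ 2) / z.im)).mono' (by fun_prop) ?_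
  exact ae_of_all _ (nevanlinnaKernel_norm_le z hz)

lemma nevanlinnaKernel_im (z : ℂ) (l : ℝ) :
    (((l : ℂ) - z)⁻¹ - (l : ℂ) * (1 + (l : ℂ) ^ 2)⁻¹).im =
      z.im / ((l - z.re) ^ 2 + z.im ^ 2) := by
  have h : (l : ℂ) * (1 + (l : ℂ) ^ 2)⁻¹ = ((l * (1 + l ^ 2)⁻¹ : ℝ) : ℂ) := by push_cast; rfl
  rw [h, Complex.sub_im, Complex.ofReal_im, Complex.inv_im, Complex.normSq_apply]
  simp
  ring

lemma isLocallyFiniteMeasure_of_nevanlinna (ω : Measure ℝ)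
    (hω : (∫⁻ l : ℝ, ENNReal.ofReal ((1 + l ^ 2)⁻¹) ∂ω) < ⊤) :
    IsLocallyFiniteMeasure ω := by
  have h : ω.withDensity (fun l => ENNReal.ofReal ((1 + l ^ 2)⁻¹)) Set.univ < ⊤ := by
    simpa using hω
  refine ⟨fun x => ⟨Metric.ball (0 : ℝ) (|x| + 1), Metric.isOpen_ball.mem_nhds (by simp), ?_⟩⟩
  have hc : (0 : ℝ) < (1 + (|x| + 1) ^ 2)⁻¹ := by positivity
  refine lt_of_le_of_lt (meas_ge_le_lintegral_div (μ := ω)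
    (f := fun l : ℝ => ENNReal.ofReal ((1 + l ^ 2)⁻¹)) (by fun_prop)
    (ε := ENNReal.ofReal ((1 + (|x| + 1) ^ 2)⁻¹)) (by simpa using hc) (by simp) |> le_trans
      (measure_mono ?_)) (ENNReal.div_lt_top hω.ne (by simpa using hc))
  intro l hl
  rw [Metric.mem_ball, dist_zero_right, Real.norm_eq_abs] at hl
  refine ENNReal.ofReal_le_ofReal ?_
  have : l ^ 2 ≤ (|x| + 1) ^ 2 := sq_le_sq' (by linarith [neg_abs_le l]) (by linarith [le_abs_self l])
  gcongr

lemma im_tendsto_atTop_ae_of_singular (F : ℂ → ℂ) (c d : ℝ) (ω σ : Measure ℝ) (hd : 0 ≤ d)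
    (hω : (∫⁻ l : ℝ, ENNReal.ofReal ((1 + l ^ 2)⁻¹) ∂ω) < ⊤)
    (hF : ∀ z : ℂ, 0 < z.im → F z = (c : ℂ) + (d : ℂ) * z +
        ∫ l : ℝ, (((l : ℂ) - z)⁻¹ - (l : ℂ) * (1 + (l : ℂ) ^ 2)⁻¹) ∂ω)
    (hσω : σ ≤ ω) (hσ : Measure.MutuallySingular σ volume) :
    ∀ᵐ x : ℝ ∂σ, Tendsto (fun ε : ℝ => (F ((x : ℂ) + ε * Complex.I)).im) (𝓝[>] 0) atTop := by
  have := isLocallyFiniteMeasure_of_nevanlinna ω hω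
  have : IsLocallyFiniteMeasure σ := Measure.isLocallyFiniteMeasure_of_le hσω
  have key : ∀ (x ε : ℝ), 0 < ε →
      σ.real (Metric.closedBall x ε) / (2 * ε) ≤ (F ((x : ℂ) + ε * Complex.I)).im := by
    intro x ε hε
    have hz : 0 < ((x : ℂ) + ε * Complex.I).im := by simpa using hε
    have hint := nevanlinnaKernel_integrable ω hω _ hz
    have him := hint.im
    rw [hF _ hz]
    have e1 : (∫ l : ℝ, (((l : ℂ) - ((x : ℂ) + ε * Complex.I))⁻¹ -
        (l : ℂ) * (1 + (l : ℂ) ^ 2)⁻¹) ∂ω).im = ∫ l : ℝ, ε / ((l - x) ^ 2 + ε ^ 2) ∂ω := by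
      rw [← RCLike.im_eq_complex_im, ← integral_im hint]
      refine integral_congr_ae (ae_of_all _ fun l => ?_)
      simpa using nevanlinnaKernel_im ((x : ℂ) + ε * Complex.I) l
    have him' : Integrable (fun l : ℝ => ε / ((l - x) ^ 2 + ε ^ 2)) ω := by
      refine him.congr (ae_of_all _ fun l => ?_)
      simpa using nevanlinnaKernel_im ((x : ℂ) + ε * Complex.I) l
    rw [Complex.add_im, e1]
    have e2 : 0 ≤ ((c : ℂ) + (d : ℂ) * ((x : ℂ) + ε * Complex.I)).im := by
      simp
      positivity
    have e3 : σ.real (Metric.closedBall x ε) ≤ ω.real (Metric.closedBall x ε) :=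
      ENNReal.toReal_mono (isCompact_closedBall x ε).measure_lt_top.ne (hσω _)
    have e4 : ω.real (Metric.closedBall x ε) / (2 * ε) ≤ ∫ l : ℝ, ε / ((l - x) ^ 2 + ε ^ 2) ∂ω := by
      calc ω.real (Metric.closedBall x ε) / (2 * ε)
          = ∫ l in Metric.closedBall x ε, (2 * ε)⁻¹ ∂ω := by
            simp [div_eq_mul_inv]
        _ ≤ ∫ l in Metric.closedBall x ε, ε / ((l - x) ^ 2 + ε ^ 2) ∂ω := by
            refine setIntegral_mono_on
              (integrableOn_const (isCompact_closedBall x ε).measure_lt_top.ne)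
              him'.integrableOn Metric.isClosed_closedBall.measurableSet fun l hl => ?_
            rw [Metric.mem_closedBall, Real.dist_eq] at hl
            have : (l - x) ^ 2 ≤ ε ^ 2 := sq_le_sq' (by linarith [neg_abs_le (l - x)])
              (by linarith [le_abs_self (l - x)])
            rw [← one_div, div_le_div_iff₀ (by positivity) (by positivity)]
            nlinarith
        _ ≤ _ := setIntegral_le_integral him' (ae_of_all _ fun l => by positivity)
    have e5 : σ.real (Metric.closedBall x ε) / (2 * ε) ≤ ω.real (Metric.closedBall x ε) / (2 * ε) := by
      gcongr
    linarith
  filter_upwards [(Besicovitch.vitaliFamily σ).ae_eventually_measure_zero_of_singular hσ.symm]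
    with x hx
  have hx := hx.comp (Besicovitch.tendsto_filterAt σ x)
  refine tendsto_atTop.2 fun M => ?_
  have hM : (0 : ℝ) < |M| + 1 := by positivity
  have hev := hx.eventually_lt_const (u := ENNReal.ofReal ((|M| + 1)⁻¹)) (by simpa using hM)
  filter_upwards [hev, self_mem_nhdsWithin] with ε hlt (hε : 0 < ε)
  refine le_trans ?_ (key x ε hε)
  simp only [Function.comp, Real.volume_closedBall] at hlt
  have hfin := (isCompact_closedBall x ε).measure_lt_top (μ := σ)
  by_cases h0 : σ (Metric.closedBall x ε) = 0
  · rw [h0, ENNReal.div_zero (by simpa using hε)] at hlt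
    simp at hlt
  have hpos : 0 < σ.real (Metric.closedBall x ε) := ENNReal.toReal_pos h0 hfin.ne
  rw [← ofReal_measureReal hfin.ne, ← ENNReal.ofReal_div_of_pos hpos,
    ENNReal.ofReal_lt_ofReal_iff (by positivity), div_lt_iff₀ hpos,
    inv_mul_eq_div, lt_div_iff₀ hM] at hlt
  rw [le_div_iff₀ (by positivity)]
  change 2 * ε * (|M| + 1) < σ.real (Metric.closedBall x ε) at hlt
  nlinarith [le_abs_self M]

lemma norm_exp_neg_half_log_sq {w : ℂ} (hw : w ≠ 0) :
    ‖Complex.exp (-(Complex.log w) / 2)‖ ^ 2 = ‖w‖⁻¹ := by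
  rw [Complex.norm_exp, ← Real.exp_nat_mul]
  have : (-(Complex.log w) / 2).re = -Real.log ‖w‖ / 2 := by
    rw [show -(Complex.log w) / 2 = (((-1 / 2 : ℝ)) : ℂ) * Complex.log w by push_cast; ring,
      Complex.re_ofReal_mul, Complex.log_re]
    ring
  rw [this, show ((2 : ℕ) : ℝ) * (-Real.log ‖w‖ / 2) = -Real.log ‖w‖ by push_cast; ring,
    Real.exp_neg, Real.exp_log (norm_pos_iff.2 hw)]

lemma norm_exp_neg_half_log_le_re {w : ℂ} (hw : 0 < w.re) :
    ‖Complex.exp (-(Complex.log w) / 2)‖ ≤ 2 * (Complex.exp (-(Complex.log w) / 2)).re := by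
  have him : (-(Complex.log w) / 2).im = -(w.arg / 2) := by
    rw [show -(Complex.log w) / 2 = (((-1 / 2 : ℝ)) : ℂ) * Complex.log w by push_cast; ring,
      Complex.im_ofReal_mul, Complex.log_im]
    ring
  rw [Complex.norm_exp, Complex.exp_re, him, Real.cos_neg]
  have harg := Complex.abs_arg_lt_pi_div_two_iff.2 (Or.inl hw)
  have hcos : 1 / 2 ≤ Real.cos (w.arg / 2) := by
    rw [← Real.cos_pi_div_three, ← Real.cos_abs (w.arg / 2)]
    have : |w.arg / 2| = |w.arg| / 2 := by rw [abs_div]; simp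
    rw [this]
    refine Real.cos_le_cos_of_nonneg_of_le_pi (by positivity) ?_ ?_ <;> linarith [Real.pi_pos]
  have := Real.exp_pos (-(Complex.log w) / 2).re
  nlinarith

lemma exists_integral_norm_le (G : ℂ → ℂ) (hG : DifferentiableOn ℂ G {z : ℂ | 0 < z.im})
    (hre : ∀ z : ℂ, 0 < z.im → ‖G z‖ ≤ 2 * (G z).re) (R C : ℝ) (hR : 0 < R)
    (hbound : ∀ z : ℂ, 0 < z.im → z.im ≤ 1 → |z.re| ≤ R → ‖G z‖ ≤ C * z.im ^ (-(1 / 2) : ℝ)) :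
    ∃ K : ℝ, ∀ ε : ℝ, 0 < ε → ε ≤ 1 →
      ∫ x in -R..R, ‖G ((x : ℂ) + ε * Complex.I)‖ ≤ K := by
  have hC : 0 ≤ C := by
    have := hbound Complex.I (by simp) (by simp) (by simpa using hR.le)
    simp at this
    exact (norm_nonneg _).trans this
  refine ⟨2 * (‖∫ x in -R..R, G ((x : ℂ) + (1 : ℝ) * Complex.I)‖ + 4 * C), fun ε hε hε1 => ?_⟩
  have hcont : Continuous fun x : ℝ => G ((x : ℂ) + ε * Complex.I) := by
    refine hG.continuousOn.comp_continuous (by fun_prop) fun x => ?_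
    simpa using hε
  have hrect := Complex.integral_boundary_rect_eq_zero_of_differentiableOn G
    (⟨-R, ε⟩ : ℂ) (⟨R, 1⟩ : ℂ) (hG.mono ?_)
  swap
  · intro z hz
    rw [Complex.mem_reProdIm, Set.uIcc_of_le hε1] at hz
    exact hε.trans_le hz.2.1
  have hside : ∀ r : ℝ, |r| ≤ R →
      ‖∫ y in ε..1, G ((r : ℂ) + y * Complex.I)‖ ≤ 2 * C := by
    intro r hr
    have h1 : ‖∫ y in ε..1, G ((r : ℂ) + y * Complex.I)‖ ≤
        ∫ y in ε..1, C * y ^ (-(1 / 2) : ℝ) := by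
      refine intervalIntegral.norm_integral_le_of_norm_le hε1 (ae_of_all _ fun y hy => ?_) ?_
      · have hy0 : 0 < y := hε.trans hy.1
        simpa using hbound ((r : ℂ) + y * Complex.I) (by simpa using hy0) (by simpa using hy.2)
          (by simpa using hr)
      · exact (intervalIntegral.intervalIntegrable_rpow' (by norm_num)).const_mul C
    rw [intervalIntegral.integral_const_mul, integral_rpow (Or.inl (by norm_num))] at h1
    refine h1.trans ?_
    have h2 : 0 ≤ ε ^ (-(1 / 2) + 1 : ℝ) := by positivity
    have h3 : ((1 : ℝ) ^ (-(1 / 2) + 1 : ℝ) - ε ^ (-(1 / 2) + 1 : ℝ)) / (-(1 / 2) + 1) ≤ 2 := by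
      rw [Real.one_rpow, div_le_iff₀ (by norm_num)]
      linarith
    nlinarith
  simp only [smul_eq_mul] at hrect
  have hI := hcont.intervalIntegrable (μ := volume) (-R) R
  have hbot : ‖∫ x in -R..R, G ((x : ℂ) + ε * Complex.I)‖ ≤
      ‖∫ x in -R..R, G ((x : ℂ) + (1 : ℝ) * Complex.I)‖ + 4 * C := by
    have h1 := hside R (abs_of_pos hR).le
    have h2 := hside (-R) (by rw [abs_neg, abs_of_pos hR])
    have h3 : (∫ x in -R..R, G ((x : ℂ) + ε * Complex.I)) =
        (∫ x in -R..R, G ((x : ℂ) + (1 : ℝ) * Complex.I)) -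
        Complex.I * (∫ y in ε..1, G ((R : ℂ) + y * Complex.I)) +
        Complex.I * (∫ y in ε..1, G (((-R : ℝ) : ℂ) + y * Complex.I)) := by
      linear_combination hrect
    rw [h3]
    refine (norm_add_le _ _).trans ?_
    have h4 := norm_sub_le (∫ x in -R..R, G ((x : ℂ) + (1 : ℝ) * Complex.I))
      (Complex.I * (∫ y in ε..1, G ((R : ℂ) + y * Complex.I)))
    simp only [norm_mul, Complex.norm_I, one_mul] at h4 ⊢
    linarith
  calc ∫ x in -R..R, ‖G ((x : ℂ) + ε * Complex.I)‖
      ≤ ∫ x in -R..R, 2 * (G ((x : ℂ) + ε * Complex.I)).re := by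
        refine intervalIntegral.integral_mono_on (by linarith)
          (hcont.norm.intervalIntegrable _ _)
          ((Complex.continuous_re.comp hcont).const_mul 2 |>.intervalIntegrable _ _) fun x _ => ?_
        exact hre _ (by simpa using hε)
    _ = 2 * (∫ x in -R..R, G ((x : ℂ) + ε * Complex.I)).re := by
        rw [intervalIntegral.integral_const_mul]
        congr 1
        exact Complex.reCLM.intervalIntegral_comp_comm hI
    _ ≤ _ := by
        have := Complex.re_le_norm (∫ x in -R..R, G ((x : ℂ) + ε * Complex.I))
        linarith

lemma volume_norm_tendsto_atTop_eq_zero (G : ℂ → ℂ)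
    (hG : DifferentiableOn ℂ G {z : ℂ | 0 < z.im})
    (hre : ∀ z : ℂ, 0 < z.im → ‖G z‖ ≤ 2 * (G z).re)
    (hbound : ∀ R : ℝ, ∃ C : ℝ, ∀ z : ℂ, 0 < z.im → z.im ≤ 1 → |z.re| ≤ R →
      ‖G z‖ ≤ C * z.im ^ (-(1 / 2) : ℝ)) :
    volume {x : ℝ | Tendsto (fun ε : ℝ => ‖G ((x : ℂ) + ε * Complex.I)‖) (𝓝[>] 0) atTop} = 0 := by
  have hlocal : ∀ n : ℕ, ∀ᵐ x : ℝ ∂(volume.restrict (Set.Ioc (-((n : ℝ) + 1)) (n + 1))),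
      ¬ Tendsto (fun ε : ℝ => ‖G ((x : ℂ) + ε * Complex.I)‖) (𝓝[>] 0) atTop := by
    intro n
    have hR : (0 : ℝ) < n + 1 := by positivity
    obtain ⟨C, hC⟩ := hbound (n + 1)
    obtain ⟨K, hK⟩ := exists_integral_norm_le G hG hre (n + 1) C hR hC
    let e : ℕ → ℝ := fun k => 1 / ((k : ℝ) + 1)
    have he : ∀ k, 0 < e k := fun k => by positivity
    have he1 : ∀ k, e k ≤ 1 := fun k => by
      rw [div_le_one (by positivity)]
      linarith [(Nat.cast_nonneg k : (0 : ℝ) ≤ k)]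
    have hcont : ∀ k, Continuous fun x : ℝ => G ((x : ℂ) + e k * Complex.I) := fun k => by
      refine hG.continuousOn.comp_continuous (by fun_prop) fun x => ?_
      simpa using he k
    have hmeas : ∀ k, Measurable fun x : ℝ => ENNReal.ofReal ‖G ((x : ℂ) + e k * Complex.I)‖ :=
      fun k => (hcont k).norm.measurable.ennreal_ofReal
    have hle : ∀ k, ∫⁻ x in Set.Ioc (-((n : ℝ) + 1)) (n + 1),
        ENNReal.ofReal ‖G ((x : ℂ) + e k * Complex.I)‖ ≤ ENNReal.ofReal K := fun k => by
      rw [← ofReal_integral_eq_lintegral_ofReal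
        ((hcont k).norm.integrableOn_Ioc) (ae_of_all _ fun x => norm_nonneg _),
        ← intervalIntegral.integral_of_le (by linarith)]
      exact ENNReal.ofReal_le_ofReal (hK _ (he k) (he1 k))
    have hfatou := (lintegral_liminf_le (μ := volume.restrict (Set.Ioc (-((n : ℝ) + 1)) (n + 1)))
      (u := atTop) hmeas).trans (liminf_le_of_frequently_le' (Frequently.of_forall hle))
    filter_upwards [ae_lt_top (Measurable.liminf hmeas)
      (hfatou.trans_lt ENNReal.ofReal_lt_top).ne] with x hx htend
    have hseq : Tendsto e atTop (𝓝[>] 0) :=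
      tendsto_nhdsWithin_iff.2 ⟨tendsto_one_div_add_atTop_nhds_zero_nat, Eventually.of_forall he⟩
    have := (ENNReal.tendsto_ofReal_atTop.comp (htend.comp hseq)).liminf_eq
    exact hx.ne this
  have hall := ae_all_iff.2 fun n => (ae_restrict_iff' measurableSet_Ioc).1 (hlocal n)
  rw [← compl_mem_ae_iff]
  filter_upwards [hall] with x hx
  obtain ⟨n, hn⟩ := exists_nat_ge |x|
  exact hx n ⟨by linarith [neg_abs_le x], by linarith [le_abs_self x]⟩

lemma volume_tendsto_zero_eq_zero (h : ℂ → ℂ) (hh : DifferentiableOn ℂ h {z : ℂ | 0 < z.im})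
    (hre : ∀ z : ℂ, 0 < z.im → 0 < (h z).re)
    (hbound : ∀ R : ℝ, ∃ C : ℝ, ∀ z : ℂ, 0 < z.im → z.im ≤ 1 → |z.re| ≤ R →
      ‖h z‖⁻¹ ≤ C / z.im) :
    volume {x : ℝ | Tendsto (fun ε : ℝ => h ((x : ℂ) + ε * Complex.I)) (𝓝[>] 0) (𝓝 0)} = 0 := by
  have hne : ∀ z : ℂ, 0 < z.im → h z ≠ 0 := fun z hz h0 => by
    have := hre z hz
    simp [h0] at this
  refine measure_mono_null ?_ (volume_norm_tendsto_atTop_eq_zero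
    (fun z => Complex.exp (-(Complex.log (h z)) / 2)) ?_
    (fun z hz => norm_exp_neg_half_log_le_re (hre z hz)) fun R => ?_)
  · intro x hx
    have hx' : Tendsto (fun ε : ℝ => ‖h ((x : ℂ) + ε * Complex.I)‖) (𝓝[>] 0) (𝓝[>] 0) := by
      refine tendsto_nhdsWithin_iff.2 ⟨by simpa using hx.norm, ?_⟩
      filter_upwards [self_mem_nhdsWithin] with ε (hε : 0 < ε)
      exact norm_pos_iff.2 (hne _ (by simpa using hε))
    refine (Real.tendsto_sqrt_atTop.comp hx'.inv_tendsto_nhdsGT_zero).congr' ?_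
    filter_upwards [self_mem_nhdsWithin] with ε (hε : 0 < ε)
    have hw := hne ((x : ℂ) + ε * Complex.I) (by simpa using hε)
    simp only [Function.comp, Pi.inv_apply]
    rw [← norm_exp_neg_half_log_sq hw, Real.sqrt_sq (norm_nonneg _)]
  · refine (((hh.clog fun z hz => Or.inl (hre z hz)).neg).div_const 2).cexp
  · obtain ⟨C, hC⟩ := hbound R
    refine ⟨√C, fun z hz hz1 hzR => ?_⟩
    have h1 := hC z hz hz1 hzR
    rw [← norm_exp_neg_half_log_sq (hne z hz)] at h1
    have h2 := Real.le_sqrt_of_sq_le h1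
    rwa [Real.sqrt_div' _ hz.le, Real.sqrt_eq_rpow z.im, div_eq_mul_inv (√C),
      ← Real.rpow_neg hz.le] at h2

lemma bdd_norm_mul_im_of_nevanlinna (F : ℂ → ℂ) (c d : ℝ) (ω : Measure ℝ) (hd : 0 ≤ d)
    (hω : (∫⁻ l : ℝ, ENNReal.ofReal ((1 + l ^ 2)⁻¹) ∂ω) < ⊤)
    (hF : ∀ z : ℂ, 0 < z.im → F z = (c : ℂ) + (d : ℂ) * z +
        ∫ l : ℝ, (((l : ℂ) - z)⁻¹ - (l : ℂ) * (1 + (l : ℂ) ^ 2)⁻¹) ∂ω) (R : ℝ) :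
    ∃ C : ℝ, ∀ z : ℂ, 0 < z.im → z.im ≤ 1 → |z.re| ≤ R → ‖F z‖ ≤ C / z.im := by
  set W := ∫ l : ℝ, (1 + l ^ 2)⁻¹ ∂ω
  have hW : 0 ≤ W := integral_nonneg fun l => by positivity
  refine ⟨|c| + d * (R + 1) + ((R + 1) + (1 + (R + 1) ^ 2)) * W, fun z hz hz1 hzR => ?_⟩
  have hR : 0 ≤ R := (abs_nonneg _).trans hzR
  have hnorm : ‖z‖ ≤ R + 1 := by
    have := Complex.norm_le_abs_re_add_abs_im z
    rw [abs_of_pos hz] at this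
    linarith
  have hle : ∀ r : ℝ, 0 ≤ r → r ≤ r / z.im := fun r hr => by
    rw [le_div_iff₀ hz]
    nlinarith
  have hint : ‖∫ l : ℝ, (((l : ℂ) - z)⁻¹ - (l : ℂ) * (1 + (l : ℂ) ^ 2)⁻¹) ∂ω‖ ≤
      (‖z‖ + (1 + ‖z‖ ^ 2) / z.im) * W := by
    rw [← integral_const_mul]
    exact norm_integral_le_of_norm_le ((nevanlinna_weight_integrable ω hω).const_mul _)
      (ae_of_all _ (nevanlinnaKernel_norm_le z hz))
  have hcoef : ‖z‖ + (1 + ‖z‖ ^ 2) / z.im ≤ ((R + 1) + (1 + (R + 1) ^ 2)) / z.im := by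
    rw [add_div (R + 1)]
    refine add_le_add (hnorm.trans (hle _ (by positivity))) ?_
    gcongr
  have hlin : ‖(c : ℂ) + (d : ℂ) * z‖ ≤ (|c| + d * (R + 1)) / z.im := by
    refine le_trans ?_ (hle _ (by positivity))
    refine (norm_add_le _ _).trans ?_
    rw [norm_mul, Complex.norm_real, Complex.norm_real, Real.norm_eq_abs, Real.norm_of_nonneg hd]
    gcongr
  rw [hF z hz, add_div]
  refine (norm_add_le _ _).trans (add_le_add hlin (hint.trans ?_))
  rw [mul_div_right_comm]
  exact mul_le_mul_of_nonneg_right hcoef hW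

lemma det_ne_zero_of_conj_symplectic (a : Matrix (Fin 2) (Fin 2) ℂ)
    (ha : aᴴ * !![0, -1; 1, 0] * a = !![0, -1; 1, 0]) :
    a 0 0 * a 1 1 - a 0 1 * a 1 0 ≠ 0 := by
  intro h
  have := congrArg Matrix.det ha
  rw [Matrix.det_mul, Matrix.det_fin_two a, h] at this
  simp [Matrix.det_fin_two] at this

lemma first_row_ratio_im_eq_zero (a : Matrix (Fin 2) (Fin 2) ℂ)
    (ha : aᴴ * !![0, -1; 1, 0] * a = !![0, -1; 1, 0]) :
    (a 0 0 / a 0 1).im = 0 := by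
  set J : Matrix (Fin 2) (Fin 2) ℂ := !![0, -1; 1, 0] with hJ
  have hJJ : -J * J = 1 := by
    ext i j
    fin_cases i <;> fin_cases j <;> simp [hJ, Matrix.mul_apply]
  have h1 : (-J * aᴴ * J) * a = 1 := by
    rw [Matrix.mul_assoc, Matrix.mul_assoc, ← Matrix.mul_assoc aᴴ, ha, hJJ]
  have h2 : a * (-J * aᴴ * J) = 1 := mul_eq_one_comm.1 h1
  have h3 := congrFun (congrFun h2 0) 1
  simp [hJ, Matrix.mul_apply, Fin.sum_univ_two, Matrix.vecMul, Matrix.vecHead,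
    Matrix.vecTail] at h3
  by_cases h0 : a 0 1 = 0
  · simp [h0]
  have h0' : (starRingEnd ℂ) (a 0 1) ≠ 0 := by simpa using h0
  rw [← Complex.conj_eq_iff_im, map_div₀, div_eq_div_iff h0' h0]
  linear_combination h3

/-- Aronszajn–Donoghue: for a Herglotz function `m` with representation measure `ω`,
`a ∈ 𝒜₂` with `a₁₂ ≠ 0` and nonvanishing denominator, and `ω_a` a representation measure
of `m_a = (a₂₁ + a₂₂ m)/(a₁₁ + a₁₂ m)`, the singular parts `ω_{a,s}` and `ω_s` are
mutually singular; in particular `{λ : lim_{ε↓0} m(λ+iε) = -a₁₁/a₁₂}` is a minimal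
support of `ω_{a,s}` relative to Lebesgue measure. -/
theorem singular_parts_mutually_singular
    (m : ℂ → ℂ)
    (hanal : DifferentiableOn ℂ m {z : ℂ | 0 < z.im})
    (hmap : ∀ z : ℂ, 0 < z.im → 0 < (m z).im)
    (c d : ℝ) (ω : Measure ℝ) (hd : 0 ≤ d)
    (hω : (∫⁻ l : ℝ, ENNReal.ofReal ((1 + l ^ 2)⁻¹) ∂ω) < ⊤)
    (hrep : ∀ z : ℂ, 0 < z.im →
      m z = (c : ℂ) + (d : ℂ) * z +
        ∫ l : ℝ, (((l : ℂ) - z)⁻¹ - (l : ℂ) * (1 + (l : ℂ) ^ 2)⁻¹) ∂ω)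
    (a : Matrix (Fin 2) (Fin 2) ℂ)
    (ha : aᴴ * !![0, -1; 1, 0] * a = !![0, -1; 1, 0])
    (ha12 : a 0 1 ≠ 0)
    (hda : ∀ z : ℂ, 0 < z.im → a 0 0 + a 0 1 * m z ≠ 0)
    (ca da : ℝ) (ωa : Measure ℝ) (hda' : 0 ≤ da)
    (hωa : (∫⁻ l : ℝ, ENNReal.ofReal ((1 + l ^ 2)⁻¹) ∂ωa) < ⊤)
    (hrepa : ∀ z : ℂ, 0 < z.im →
      (a 1 0 + a 1 1 * m z) / (a 0 0 + a 0 1 * m z) = (ca : ℂ) + (da : ℂ) * z +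
        ∫ l : ℝ, (((l : ℂ) - z)⁻¹ - (l : ℂ) * (1 + (l : ℂ) ^ 2)⁻¹) ∂ωa)
    (ωac ωs : Measure ℝ) (hdecomp : ω = ωac + ωs)
    (hac : ωac ≪ volume) (hs : Measure.MutuallySingular ωs volume)
    (ωaac ωas : Measure ℝ) (hdecompa : ωa = ωaac + ωas)
    (haac : ωaac ≪ volume) (has : Measure.MutuallySingular ωas volume) :
    Measure.MutuallySingular ωas ωs ∧
      ωas {l : ℝ | Tendsto (fun ε : ℝ => m ((l : ℂ) + ε * Complex.I)) (𝓝[>] 0)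
          (𝓝 (-(a 0 0) / a 0 1))}ᶜ = 0 ∧
      ∀ B : Set ℝ, MeasurableSet B →
        B ⊆ {l : ℝ | Tendsto (fun ε : ℝ => m ((l : ℂ) + ε * Complex.I)) (𝓝[>] 0)
          (𝓝 (-(a 0 0) / a 0 1))} →
        ωas B = 0 → volume B = 0 := by
  have hdet := det_ne_zero_of_conj_symplectic a ha
  have ht := first_row_ratio_im_eq_zero a ha
  set F : ℂ → ℂ := fun z => (a 1 0 + a 1 1 * m z) / (a 0 0 + a 0 1 * m z) with hF
  set S : Set ℝ := {l : ℝ | Tendsto (fun ε : ℝ => m ((l : ℂ) + ε * Complex.I)) (𝓝[>] 0)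
          (𝓝 (-(a 0 0) / a 0 1))} with hS
  have hFne : ∀ z : ℂ, 0 < z.im → F z - a 1 1 / a 0 1 ≠ 0 := fun z hz h => by
    have h1 : a 0 0 + m z * a 0 1 ≠ 0 := by simpa only [mul_comm] using hda z hz
    simp only [hF] at h
    field_simp at h
    exact hdet (by linear_combination -h)
  have hmF : ∀ z : ℂ, 0 < z.im → m z + a 0 0 / a 0 1 =
      -((a 0 0 * a 1 1 - a 0 1 * a 1 0) / a 0 1 ^ 2) * (F z - a 1 1 / a 0 1)⁻¹ := fun z hz => by
    have h1 : a 0 0 + m z * a 0 1 ≠ 0 := by simpa only [mul_comm] using hda z hz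
    rw [eq_mul_inv_iff_mul_eq₀ (hFne z hz)]
    simp only [hF]
    field_simp
    ring
  have hωas : ωas ≤ ωa := hdecompa ▸ Measure.le_add_left le_rfl
  have hωs : ωs ≤ ω := hdecomp ▸ Measure.le_add_left le_rfl
  have hsupp : ωas Sᶜ = 0 := by
    rw [← mem_ae_iff]
    filter_upwards [im_tendsto_atTop_ae_of_singular F ca da ωa ωas hda' hωa hrepa hωas has]
      with x hx
    have hcob : Tendsto (fun ε : ℝ => F ((x : ℂ) + ε * Complex.I) - a 1 1 / a 0 1) (𝓝[>] 0)
        (Bornology.cobounded ℂ) := by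
      rw [← tendsto_norm_atTop_iff_cobounded]
      refine tendsto_atTop_mono (fun ε => ?_)
        (tendsto_atTop_add_const_right _ (-‖a 1 1 / a 0 1‖) hx)
      have h1 := norm_sub_norm_le (F ((x : ℂ) + ε * Complex.I)) (a 1 1 / a 0 1)
      have h2 := (le_abs_self _).trans (Complex.abs_im_le_norm (F ((x : ℂ) + ε * Complex.I)))
      linarith
    have hlim := ((tendsto_inv₀_cobounded.comp hcob).const_mul
      (-((a 0 0 * a 1 1 - a 0 1 * a 1 0) / a 0 1 ^ 2))).sub_const (a 0 0 / a 0 1)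
    rw [mul_zero, zero_sub] at hlim
    rw [hS, Set.mem_ofPred_eq, neg_div]
    refine Tendsto.congr' ?_ hlim
    filter_upwards [self_mem_nhdsWithin] with ε (hε : 0 < ε)
    have := hmF ((x : ℂ) + ε * Complex.I) (by simpa using hε)
    simp only [Function.comp]
    rw [← this, add_sub_cancel_right]
  have hωsS : ωs S = 0 := by
    rw [← compl_mem_ae_iff]
    filter_upwards [im_tendsto_atTop_ae_of_singular m c d ω ωs hd hω hrep hωs hs] with x hx hxS
    exact not_tendsto_nhds_of_tendsto_atTop hx _ ((Complex.continuous_im.tendsto _).comp hxS)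
  have hvolS : volume S = 0 := by
    refine measure_mono_null ?_ (volume_tendsto_zero_eq_zero
      (fun z => -Complex.I * (m z + a 0 0 / a 0 1)) ?_ ?_ fun R => ?_)
    · intro x hx
      have := (hx.add_const (a 0 0 / a 0 1)).const_mul (-Complex.I)
      rwa [neg_div, neg_add_cancel, mul_zero] at this
    · exact (hanal.add_const _).const_mul _
    · intro z hz
      have := hmap z hz
      simpa [ht] using this
    · obtain ⟨C, hC⟩ := bdd_norm_mul_im_of_nevanlinna F ca da ωa hda' hωa hrepa R
      set D := ‖(a 0 0 * a 1 1 - a 0 1 * a 1 0) / a 0 1 ^ 2‖⁻¹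
      refine ⟨D * (C + ‖a 1 1 / a 0 1‖), fun z hz hz1 hzR => ?_⟩
      have h1 := hC z hz hz1 hzR
      have h2 : ‖a 1 1 / a 0 1‖ ≤ ‖a 1 1 / a 0 1‖ / z.im :=
        le_div_self (norm_nonneg _) hz hz1
      have h3 := norm_sub_le (F z) (a 1 1 / a 0 1)
      rw [hmF z hz, norm_mul, norm_mul, norm_neg, norm_neg, Complex.norm_I, one_mul, norm_inv,
        mul_inv, inv_inv, mul_div_assoc, add_div]
      gcongr
      linarith
  exact ⟨(Measure.MutuallySingular.mk hωsS hsupp (by simp)).symm, hsupp,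
    fun B _ hBS _ => measure_mono_null hBS hvolS⟩
end

section
/- Let m be a Herglotz function and let λ₁ < λ₂ be real numbers. Suppose that for Lebesgue-almost every λ ∈ (λ₁, λ₂), lim_{ε↓0} Re(m(λ + iε)) = 0. Then m can be analytically continued from ℂ₊ into ℂ₋ through the interval (λ₁, λ₂): there exists a function F analytic on the open set Ω = ℂ ∖ ((−∞, λ₁] ∪ [λ₂, ∞)) such that F(z) = m(z) for all z ∈ ℂ₊, F(z) = −conj(F(conj z)) for all z ∈ Ω, and for every λ ∈ (λ₁, λ₂) one has Re(F(λ)) = 0 and Im(F(λ)) > 0. -/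
open MeasureTheory Filter Topology
open scoped ComplexConjugate

/-- The reflected extension of a function that is real on the real line is continuous. -/
lemma continuousOn_reflect {g : ℂ → ℂ} {c r : ℝ}
    (hc : ContinuousOn g (Metric.ball (c : ℂ) r ∩ {z | 0 ≤ z.im}))
    (hreal : ∀ z ∈ Metric.ball (c : ℂ) r, z.im = 0 → (g z).im = 0) :
    ContinuousOn (fun z => if 0 ≤ z.im then g z else conj (g (conj z))) (Metric.ball (c : ℂ) r) := by
  have hball : ∀ z ∈ Metric.ball (c : ℂ) r, conj z ∈ Metric.ball (c : ℂ) r := by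
    intro z hz
    rw [Metric.mem_ball, dist_eq_norm] at hz ⊢
    rwa [← Complex.norm_conj, map_sub, Complex.conj_conj, Complex.conj_ofReal]
  have hcl : ∀ z ∈ closure {z : ℂ | ¬ 0 ≤ z.im}, z.im ≤ 0 := by
    have : closure {z : ℂ | ¬ 0 ≤ z.im} ⊆ {z : ℂ | z.im ≤ 0} :=
      closure_minimal (fun z hz => (not_le.1 hz).le) (isClosed_le Complex.continuous_im continuous_const)
    exact this
  have hcl' : closure {z : ℂ | 0 ≤ z.im} = {z : ℂ | 0 ≤ z.im} :=
    (isClosed_le continuous_const Complex.continuous_im).closure_eq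
  apply ContinuousOn.if
  · rintro z ⟨hz, hzf⟩
    have hz0 : z.im = 0 := by
      have h1 := hcl z (frontier_compl {z : ℂ | 0 ≤ z.im} ▸ hzf |>.1)
      have h2 : 0 ≤ z.im := by
        have := hzf.1
        rwa [hcl'] at this
      exact le_antisymm h1 h2
    rw [Complex.conj_eq_iff_im.2 hz0, Complex.conj_eq_iff_im.2 (hreal z hz hz0)]
  · rwa [hcl']
  · refine (Complex.continuous_conj.comp_continuousOn (hc.comp (Complex.continuous_conj.continuousOn)
      ?_))
    rintro z ⟨hz, hz2⟩
    refine ⟨hball z hz, ?_⟩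
    have := hcl z hz2
    simp [this]

/-- **Schwarz reflection principle** on a disc centred on the real line. -/
lemma differentiableOn_reflect {g : ℂ → ℂ} {c r : ℝ}
    (hc : ContinuousOn g (Metric.ball (c : ℂ) r ∩ {z | 0 ≤ z.im}))
    (hd : DifferentiableOn ℂ g (Metric.ball (c : ℂ) r ∩ {z | 0 < z.im}))
    (hreal : ∀ z ∈ Metric.ball (c : ℂ) r, z.im = 0 → (g z).im = 0) :
    DifferentiableOn ℂ (fun z => if 0 ≤ z.im then g z else conj (g (conj z)))
      (Metric.ball (c : ℂ) r) := by
  set Γ : ℂ → ℂ := fun z => if 0 ≤ z.im then g z else conj (g (conj z)) with hΓ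
  have hball : ∀ z ∈ Metric.ball (c : ℂ) r, conj z ∈ Metric.ball (c : ℂ) r := by
    intro z hz
    rw [Metric.mem_ball, dist_eq_norm] at hz ⊢
    rwa [← Complex.norm_conj, map_sub, Complex.conj_conj, Complex.conj_ofReal]
  have hcont : ContinuousOn Γ (Metric.ball (c : ℂ) r) := continuousOn_reflect hc hreal
  have hopen : IsOpen (Metric.ball (c : ℂ) r ∩ {z | 0 < z.im}) :=
    Metric.isOpen_ball.inter (isOpen_lt continuous_const Complex.continuous_im)
  have hdiff : ∀ z ∈ Metric.ball (c : ℂ) r, z.im ≠ 0 → DifferentiableAt ℂ Γ z := by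
    intro z hz hz0
    rcases lt_or_gt_of_ne hz0 with h | h
    · have h1 : DifferentiableAt ℂ g (conj z) :=
        hd.differentiableAt (hopen.mem_nhds ⟨hball z hz, by simpa using h⟩)
      have h2 := h1.hasDerivAt.conj_conj.differentiableAt
      rw [Complex.conj_conj] at h2
      refine h2.congr_of_eventuallyEq ?_
      filter_upwards [(isOpen_lt Complex.continuous_im continuous_const).mem_nhds h] with w hw
      simp only [hΓ, if_neg (not_le.2 hw), Function.comp]
    · refine (hd.differentiableAt (hopen.mem_nhds ⟨hz, h⟩)).congr_of_eventuallyEq ?_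
      filter_upwards [(isOpen_lt continuous_const Complex.continuous_im).mem_nhds h] with w hw
      simp only [hΓ, if_pos (le_of_lt hw)]
  refine ((Complex.isConservativeOn_and_continuousOn_iff_isDifferentiableOn
    Metric.isOpen_ball).1 ⟨?_, hcont⟩)
  intro z w hzw
  rw [← add_eq_zero_iff_eq_neg, Complex.wedgeIntegral_add_wedgeIntegral_eq]
  have key : ∀ p q : ℝ, Set.uIcc p q ⊆ Set.uIcc z.im w.im → 0 ∉ Set.Ioo (min p q) (max p q) →
      (∫ x : ℝ in z.re..w.re, Γ (x + p * Complex.I)) -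
        (∫ x : ℝ in z.re..w.re, Γ (x + q * Complex.I)) +
        Complex.I • (∫ y : ℝ in p..q, Γ (w.re + y * Complex.I)) -
        Complex.I • (∫ y : ℝ in p..q, Γ (z.re + y * Complex.I)) = 0 := by
    intro p q hpq h0
    have hsub : (Set.uIcc z.re w.re ×ℂ Set.uIcc p q) ⊆ Metric.ball (c : ℂ) r :=
      fun ζ hζ => hzw ⟨hζ.1, hpq hζ.2⟩
    have := Complex.integral_boundary_rect_eq_zero_of_continuousOn_of_differentiableOn Γ
      ⟨z.re, p⟩ ⟨w.re, q⟩ (hcont.mono hsub) (fun ζ hζ => (hdiff ζ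
        (hsub ⟨Set.Ioo_subset_Icc_self hζ.1, Set.Ioo_subset_Icc_self hζ.2⟩)
        (fun h => h0 (h ▸ hζ.2))).differentiableWithinAt)
    exact this
  by_cases h0 : (0 : ℝ) ∈ Set.Ioo (min z.im w.im) (max z.im w.im)
  · have h0' : (0 : ℝ) ∈ Set.uIcc z.im w.im := Set.Ioo_subset_Icc_self h0
    have k1 := key z.im 0 (Set.uIcc_subset_uIcc_left h0') (by
      rcases le_total z.im 0 with h | h <;> simp [h])
    have k2 := key 0 w.im (Set.uIcc_subset_uIcc_right h0') (by
      rcases le_total w.im 0 with h | h <;> simp [h])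
    have hint : ∀ x ∈ Set.uIcc z.re w.re, ∀ p ∈ Set.uIcc z.im w.im, ∀ q ∈ Set.uIcc z.im w.im,
        IntervalIntegrable (fun y : ℝ => Γ (x + y * Complex.I)) volume p q := by
      intro x hx p hp q hq
      apply ContinuousOn.intervalIntegrable
      refine hcont.comp (by fun_prop) (fun y hy => hzw ⟨?_, ?_⟩)
      · simpa using hx
      · simpa using Set.uIcc_subset_uIcc hp hq hy
    rw [← intervalIntegral.integral_add_adjacent_intervals
        (hint w.re Set.right_mem_uIcc _ Set.left_mem_uIcc 0 h0')
        (hint w.re Set.right_mem_uIcc 0 h0' _ Set.right_mem_uIcc),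
      ← intervalIntegral.integral_add_adjacent_intervals
        (hint z.re Set.left_mem_uIcc _ Set.left_mem_uIcc 0 h0')
        (hint z.re Set.left_mem_uIcc 0 h0' _ Set.right_mem_uIcc), smul_add, smul_add]
    linear_combination k1 + k2
  · exact key z.im w.im subset_rfl h0

/-- A holomorphic function with positive real part has a holomorphic fourth root whose square
also has positive real part. -/
lemma exists_fourth_root {U : Set ℂ} {p : ℂ → ℂ} (hd : DifferentiableOn ℂ p U)
    (hpos : ∀ z ∈ U, 0 < (p z).re) :
    ∃ s : ℂ → ℂ, DifferentiableOn ℂ s U ∧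
      ∀ z ∈ U, s z ^ 4 = p z ∧ 0 < (s z).re ∧ 0 < (s z ^ 2).re := by
  refine ⟨fun z => Complex.exp (Complex.log (p z) / 4), ?_, ?_⟩
  · exact ((hd.clog fun z hz => Or.inl (hpos z hz)).div_const 4).cexp
  · intro z hz
    have harg := abs_lt.1 (Complex.abs_arg_lt_pi_div_two_iff.2 (Or.inl (hpos z hz)))
    have hne : p z ≠ 0 := fun h => by simpa [h] using hpos z hz
    have hpi := Real.pi_pos
    refine ⟨?_, ?_, ?_⟩
    · rw [← Complex.exp_nat_mul]
      convert Complex.exp_log hne using 2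
      push_cast; ring
    · rw [Complex.exp_re]
      refine mul_pos (Real.exp_pos _) (Real.cos_pos_of_mem_Ioo ?_)
      have : (Complex.log (p z) / 4).im = (p z).arg / 4 := by
        rw [← Complex.log_im]; exact Complex.div_ofNat_im _ 4
      rw [this]; constructor <;> linarith
    · rw [← Complex.exp_nat_mul, Complex.exp_re]
      refine mul_pos (Real.exp_pos _) (Real.cos_pos_of_mem_Ioo ?_)
      have : ((2 : ℕ) * (Complex.log (p z) / 4)).im = (p z).arg / 2 := by
        rw [← Complex.log_im]
        have : ((2 : ℕ) * (Complex.log (p z) / 4)) = Complex.log (p z) / 2 := by push_cast; ring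
        rw [this]; exact Complex.div_ofNat_im _ 2
      rw [this]; constructor <;> linarith

lemma Complex.abs_im_le_re_of_re_sq_pos {w : ℂ} (h : 0 < w.re) (h2 : 0 < (w ^ 2).re) :
    |w.im| ≤ w.re := by
  rw [sq, Complex.mul_re] at h2
  exact abs_le_of_sq_le_sq (by nlinarith) h.le

lemma Complex.norm_le_two_mul_re {w : ℂ} (h : 0 < w.re) (h2 : 0 < (w ^ 2).re) :
    ‖w‖ ≤ 2 * w.re := by
  have := Complex.norm_le_abs_re_add_abs_im w
  have := Complex.abs_im_le_re_of_re_sq_pos h h2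
  rw [abs_of_pos h] at *
  linarith

lemma Complex.im_sq_le_abs_im_sq {w : ℂ} (h : 0 < w.re) (h2 : 0 < (w ^ 2).re) :
    w.im ^ 2 ≤ |(w ^ 2).im| := by
  have h3 := Complex.abs_im_le_re_of_re_sq_pos h h2
  rw [sq w, Complex.mul_im, ← sq_abs w.im,
    show w.re * w.im + w.im * w.re = 2 * w.re * w.im by ring, abs_mul,
    abs_of_pos (show 0 < 2 * w.re by linarith)]
  nlinarith [abs_nonneg w.im]

/-- Growth of a function with nonnegative real part near the boundary of the half-plane. -/
lemma exists_norm_le_div_im {p : ℂ → ℂ} (hd : DifferentiableOn ℂ p {z | 0 < z.im})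
    (hpos : ∀ z : ℂ, 0 < z.im → 0 ≤ (p z).re) (a b : ℝ) :
    ∃ C : ℝ, 0 ≤ C ∧ ∀ x ∈ Set.Icc a b, ∀ y ∈ Set.Ioc (0 : ℝ) 2,
      ‖p (x + y * Complex.I)‖ ≤ C / y := by
  have hcont : ContinuousOn (fun x : ℝ => p (x + (2 : ℝ) * Complex.I)) (Set.Icc a b) :=
    hd.continuousOn.comp (by fun_prop) (fun x _ => by simp)
  obtain ⟨B, hB⟩ := isCompact_Icc.exists_bound_of_continuousOn hcont
  refine ⟨4 + 4 * |B|, by positivity, fun x hx y hy => ?_⟩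
  set c : ℂ := x + (2 : ℝ) * Complex.I with hc
  have hmaps : ∀ ζ ∈ Metric.ball (0 : ℂ) 2, 0 < (c + ζ).im := by
    intro ζ hζ
    rw [mem_ball_zero_iff] at hζ
    have h1 := (abs_le.1 ((Complex.abs_im_le_norm ζ))).1
    simp [hc]; linarith
  have hnorm : ‖((y - 2 : ℝ) : ℂ) * Complex.I‖ = 2 - y := by
    rw [norm_mul, Complex.norm_I, Complex.norm_real, Real.norm_eq_abs, abs_of_nonpos
      (by linarith [hy.2])]; ring
  have hz : ((y - 2 : ℝ) : ℂ) * Complex.I ∈ Metric.ball (0 : ℂ) 2 := by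
    rw [mem_ball_zero_iff, hnorm]; linarith [hy.1]
  have := Complex.borelCaratheodory (f := fun ζ => - p (c + ζ)) (M := 1) (R := 2) one_pos
    ((hd.comp (by fun_prop) hmaps).neg)
    (fun ζ hζ => by
      have := hpos _ (hmaps ζ hζ)
      simp only [Set.mem_ofPred_eq, Complex.neg_re]; linarith) two_pos hz
  rw [hnorm] at this
  simp only [norm_neg, add_zero] at this
  have he : c + ((y - 2 : ℝ) : ℂ) * Complex.I = x + y * Complex.I := by
    rw [hc]; push_cast; ring
  rw [he] at this
  refine this.trans ?_
  have hp : ‖p c‖ ≤ |B| := (hB x hx).trans (le_abs_self B)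
  rw [← add_div, show (2 : ℝ) - (2 - y) = y by ring]
  have := hy.1
  have := hy.2
  rw [div_le_div_iff_of_pos_right (by assumption)]
  nlinarith [norm_nonneg (p c)]

/-- Uniform `L¹` bounds on horizontal lines for functions with values in a sector. -/
lemma exists_integral_norm_le_s19 {h : ℂ → ℂ} (hd : DifferentiableOn ℂ h {z | 0 < z.im})
    (hsec : ∀ z : ℂ, 0 < z.im → ‖h z‖ ≤ 2 * (h z).re) {a b C : ℝ} (hab : a ≤ b)
    (hgrow : ∀ x ∈ Set.Icc a b, ∀ y ∈ Set.Ioc (0 : ℝ) 2,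
      ‖h (x + y * Complex.I)‖ ≤ C * y ^ (-(1 / 2) : ℝ)) :
    ∃ B : ℝ, ∀ ε ∈ Set.Ioo (0 : ℝ) 1, ∫ x in a..b, ‖h (x + ε * Complex.I)‖ ≤ B := by
  have hhor : ∀ y : ℝ, 0 < y → Continuous fun x : ℝ => h (x + y * Complex.I) := fun y hy =>
    continuousOn_univ.1 (hd.continuousOn.comp (by fun_prop) (fun x _ => by simpa using hy))
  have hvert : ∀ x ∈ Set.Icc a b, ∀ ε ∈ Set.Ioo (0 : ℝ) 1,
      ‖∫ y in ε..1, h (x + y * Complex.I)‖ ≤ 2 * |C| := by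
    intro x hx ε hε
    calc ‖∫ y in ε..1, h (x + y * Complex.I)‖ ≤ ∫ y in ε..1, |C| * y ^ (-(1 / 2) : ℝ) := by
          refine intervalIntegral.norm_integral_le_of_norm_le hε.2.le ?_ ?_
          · refine ae_of_all _ fun y hy => (hgrow x hx y ⟨hε.1.trans hy.1, by linarith [hy.2]⟩).trans ?_
            have : 0 < y := hε.1.trans hy.1
            gcongr
            exact le_abs_self C
          · exact (intervalIntegral.intervalIntegrable_rpow' (by norm_num)).const_mul _
      _ ≤ 2 * |C| := by
          rw [intervalIntegral.integral_const_mul, integral_rpow (Or.inl (by norm_num))]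
          have : 0 ≤ ε ^ (-(1 / 2) + 1 : ℝ) := Real.rpow_nonneg hε.1.le _
          rw [Real.one_rpow, mul_comm]
          gcongr
          rw [div_le_iff₀ (by norm_num)]
          linarith
  refine ⟨2 * (‖∫ x in a..b, h (x + (1 : ℝ) * Complex.I)‖ + 2 * |C| + 2 * |C|), fun ε hε => ?_⟩
  have hrect := Complex.integral_boundary_rect_eq_zero_of_differentiableOn h ⟨a, ε⟩ ⟨b, 1⟩
    (hd.mono (by
      rintro z ⟨-, hz⟩
      have hz' : z.im ∈ Set.uIcc ε 1 := hz
      rw [Set.uIcc_of_le hε.2.le] at hz'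
      exact hε.1.trans_le hz'.1))
  simp only at hrect
  have heq : ∫ x in a..b, h (x + ε * Complex.I) =
      (∫ x in a..b, h (x + (1 : ℝ) * Complex.I)) -
      Complex.I • (∫ y in ε..1, h (b + y * Complex.I)) +
      Complex.I • (∫ y in ε..1, h (a + y * Complex.I)) := by
    linear_combination hrect
  have hint : IntervalIntegrable (fun x : ℝ => h (x + ε * Complex.I)) volume a b :=
    (hhor ε hε.1).intervalIntegrable _ _
  calc ∫ x in a..b, ‖h (x + ε * Complex.I)‖
      ≤ ∫ x in a..b, 2 * (h (x + ε * Complex.I)).re := by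
        refine intervalIntegral.integral_mono_on hab hint.norm ?_ ?_
        · exact (continuous_const.mul (Complex.continuous_re.comp (hhor ε hε.1))).intervalIntegrable _ _
        · exact fun x _ => hsec _ (by simpa using hε.1)
    _ = 2 * (∫ x in a..b, h (x + ε * Complex.I)).re := by
        rw [intervalIntegral.integral_const_mul]
        congr 1
        exact Complex.reCLM.intervalIntegral_comp_comm hint
    _ ≤ 2 * ‖∫ x in a..b, h (x + ε * Complex.I)‖ := by
        gcongr; exact Complex.re_le_norm _
    _ ≤ _ := by
        rw [heq]
        gcongr
        refine norm_add_le_of_le (norm_sub_le_of_le le_rfl ?_) ?_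
        · rw [norm_smul, Complex.norm_I, one_mul]; exact hvert b ⟨hab, le_rfl⟩ ε hε
        · rw [norm_smul, Complex.norm_I, one_mul]; exact hvert a ⟨le_rfl, hab⟩ ε hε

/-- Pointwise a.e. convergence to zero with bounded second moments implies convergence of
integrals. -/
lemma tendsto_integral_zero_of_sq_bounded {v : ℝ → ℝ → ℝ} {a b B : ℝ} (hab : a ≤ b)
    (hcont : ∀ ε, 0 < ε → Continuous (v ε))
    (hB : ∀ ε ∈ Set.Ioo (0 : ℝ) 1, ∫ x in a..b, v ε x ^ 2 ≤ B)
    (hlim : ∀ᵐ x, x ∈ Set.uIoc a b → Tendsto (fun ε => v ε x) (𝓝[>] 0) (𝓝 0)) :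
    Tendsto (fun ε => ∫ x in a..b, v ε x) (𝓝[>] 0) (𝓝 0) := by
  rw [Metric.tendsto_nhds]
  intro δ hδ
  obtain ⟨K, hK0, hK⟩ : ∃ K : ℝ, 0 < K ∧ B / K < δ / 2 := by
    refine ⟨2 * (|B| + 1) / δ, by positivity, ?_⟩
    rw [div_lt_iff₀ (by positivity)]
    field_simp
    linarith [le_abs_self B]
  have hmin : Tendsto (fun ε => ∫ x in a..b, min |v ε x| K) (𝓝[>] 0) (𝓝 (∫ x in a..b, (0 : ℝ))) := by
    refine intervalIntegral.tendsto_integral_filter_of_dominated_convergence (fun _ => K) ?_ ?_ ?_ ?_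
    · filter_upwards [self_mem_nhdsWithin] with ε hε
      exact ((hcont ε hε).abs.min continuous_const).aestronglyMeasurable
    · refine Eventually.of_forall fun ε => ae_of_all _ fun x _ => ?_
      rw [Real.norm_eq_abs, abs_of_nonneg (by positivity)]
      exact min_le_right _ _
    · simp
    · filter_upwards [hlim] with x hx hxab
      have := (hx hxab).abs.min (tendsto_const_nhds (x := K))
      simpa [hK0.le] using this
  rw [intervalIntegral.integral_zero] at hmin
  filter_upwards [hmin.eventually_lt_const (half_pos hδ), Ioo_mem_nhdsGT one_pos] with ε hε1 hε2
  have hc := hcont ε hε2.1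
  rw [dist_zero_right]
  calc ‖∫ x in a..b, v ε x‖ ≤ ∫ x in a..b, (min |v ε x| K + v ε x ^ 2 / K) := by
        refine intervalIntegral.norm_integral_le_of_norm_le hab (ae_of_all _ fun x _ => ?_)
          (Continuous.intervalIntegrable (by fun_prop) _ _)
        rw [Real.norm_eq_abs]
        rcases le_total |v ε x| K with h | h
        · rw [min_eq_left h]
          have : 0 ≤ v ε x ^ 2 / K := by positivity
          linarith
        · rw [min_eq_right h]
          have : |v ε x| ≤ v ε x ^ 2 / K := by
            rw [le_div_iff₀ hK0, ← sq_abs]; nlinarith [abs_nonneg (v ε x)]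
          linarith
    _ = (∫ x in a..b, min |v ε x| K) + (∫ x in a..b, v ε x ^ 2) / K := by
        rw [intervalIntegral.integral_add (Continuous.intervalIntegrable (by fun_prop) _ _)
          (Continuous.intervalIntegrable (by fun_prop) _ _), intervalIntegral.integral_div]
    _ < δ := by
        have := div_le_div_of_nonneg_right (hB ε hε2) hK0.le
        linarith

/-- A holomorphic function on the upper half-plane with integrable growth has a primitive that is
continuous up to the boundary. -/
lemma exists_primitive_continuousOn {s : ℂ → ℂ} (hd : DifferentiableOn ℂ s {z | 0 < z.im})
    {a b C : ℝ} (hgrow : ∀ x ∈ Set.Icc a b, ∀ y ∈ Set.Ioc (0 : ℝ) 2,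
      ‖s (x + y * Complex.I)‖ ≤ C * y ^ (-(1 / 4) : ℝ)) :
    ∃ G : ℂ → ℂ, ContinuousOn G {z | z.re ∈ Set.Icc a b ∧ z.im ∈ Set.Icc (0 : ℝ) 1} ∧
      ∀ z : ℂ, 0 < z.im → HasDerivAt G (s z) z := by
  have hopen : IsOpen {z : ℂ | 0 < z.im} := isOpen_lt continuous_const Complex.continuous_im
  obtain ⟨P, hP⟩ := (convex_halfSpace_im_gt 0).exists_forall_hasDerivWithinAt hd
  replace hP : ∀ z : ℂ, 0 < z.im → HasDerivAt P (s z) z := fun z hz =>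
    (hP z hz).hasDerivAt (hopen.mem_nhds hz)
  have hsc : ∀ z : ℂ, 0 < z.im → ContinuousAt s z := fun z hz =>
    hd.continuousOn.continuousAt (hopen.mem_nhds hz)
  set G : ℂ → ℂ := fun z => P (z + Complex.I) -
    ∫ t in (0 : ℝ)..1, Complex.I * s (z + t * Complex.I) with hG
  have hGP : ∀ z : ℂ, 0 < z.im → G z = P z := by
    intro z hz
    have hder : ∀ t ∈ Set.uIcc (0 : ℝ) 1, HasDerivAt (fun t : ℝ => P (z + t * Complex.I))
        (Complex.I * s (z + t * Complex.I)) t := by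
      intro t ht
      rw [Set.uIcc_of_le zero_le_one] at ht
      have h1 : 0 < (z + t * Complex.I).im := by simp; linarith [ht.1]
      have h2 : HasDerivAt (fun t : ℝ => z + t * Complex.I) Complex.I t := by
        simpa using ((Complex.ofRealCLM.hasDerivAt (x := t)).mul_const Complex.I).const_add z
      exact (hP _ h1).scomp t h2
    have hci : IntervalIntegrable (fun t : ℝ => Complex.I * s (z + t * Complex.I)) volume 0 1 := by
      apply ContinuousOn.intervalIntegrable
      refine continuousOn_const.mul (hd.continuousOn.comp (by fun_prop) fun t ht => ?_)
      rw [Set.uIcc_of_le zero_le_one] at ht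
      simp; linarith [ht.1]
    simp only [hG]
    rw [intervalIntegral.integral_eq_sub_of_hasDerivAt hder hci]
    simp
  refine ⟨G, ?_, fun z hz => (hP z hz).congr_of_eventuallyEq ?_⟩
  · intro z hz
    refine ContinuousWithinAt.sub ?_ ?_
    · have h1 : 0 < (z + Complex.I).im := by simp; linarith [hz.2.1]
      exact (ContinuousAt.comp (f := fun z : ℂ => z + Complex.I) (hP _ h1).continuousAt
        (by fun_prop)).continuousWithinAt
    · refine intervalIntegral.continuousWithinAt_of_dominated_interval
        (bound := fun t => |C| * t ^ (-(1 / 4) : ℝ)) ?_ ?_ ?_ ?_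
      · filter_upwards [self_mem_nhdsWithin] with w hw
        refine ContinuousOn.aestronglyMeasurable ?_ measurableSet_uIoc
        refine continuousOn_const.mul (hd.continuousOn.comp (by fun_prop) fun t ht => ?_)
        rw [Set.uIoc_of_le zero_le_one] at ht
        simp; linarith [ht.1, hw.2.1]
      · filter_upwards [self_mem_nhdsWithin] with w hw
        refine ae_of_all _ fun t ht => ?_
        rw [Set.uIoc_of_le zero_le_one] at ht
        have h0 := hw.2.1
        have h1 := hw.2.2
        have := hgrow w.re hw.1 (w.im + t) ⟨by linarith [ht.1], by linarith [ht.2]⟩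
        have he : (w.re : ℂ) + ((w.im + t : ℝ) : ℂ) * Complex.I = w + t * Complex.I := by
          conv_rhs => rw [← Complex.re_add_im w]
          push_cast; ring
        rw [he] at this
        rw [norm_mul, Complex.norm_I, one_mul]
        refine this.trans (mul_le_mul (le_abs_self C) ?_ (by have := ht.1; positivity)
          (abs_nonneg C))
        exact Real.rpow_le_rpow_of_nonpos ht.1 (by linarith) (by norm_num)
      · exact (intervalIntegral.intervalIntegrable_rpow' (by norm_num)).const_mul _
      · refine ae_of_all _ fun t ht => ?_
        rw [Set.uIoc_of_le zero_le_one] at ht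
        have h1 : 0 < (z + t * Complex.I).im := by simp; linarith [hz.2.1, ht.1]
        exact continuousWithinAt_const.mul (ContinuousAt.comp (f := fun z : ℂ => z + t * Complex.I)
          (hsc _ h1) (by fun_prop)).continuousWithinAt
  · filter_upwards [hopen.mem_nhds hz] with w hw using hGP w hw

/-- Schwarz reflection for a function whose imaginary part vanishes on the boundary in the weak
sense. -/
lemma exists_reflect_of_tendsto_integral_im {s : ℂ → ℂ}
    (hd : DifferentiableOn ℂ s {z | 0 < z.im}) {a b C x₀ r : ℝ}
    (hgrow : ∀ x ∈ Set.Icc a b, ∀ y ∈ Set.Ioc (0 : ℝ) 2,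
      ‖s (x + y * Complex.I)‖ ≤ C * y ^ (-(1 / 4) : ℝ))
    (hint : ∀ α ∈ Set.Icc a b, ∀ β ∈ Set.Icc a b, α ≤ β →
      Tendsto (fun ε : ℝ => ∫ x in α..β, (s (x + ε * Complex.I)).im) (𝓝[>] 0) (𝓝 0))
    (hr : 0 < r) (hr1 : r ≤ 1) (ha : a ≤ x₀ - r) (hb : x₀ + r ≤ b) :
    ∃ S : ℂ → ℂ, DifferentiableOn ℂ S (Metric.ball (x₀ : ℂ) r) ∧
      (∀ z ∈ Metric.ball (x₀ : ℂ) r, 0 < z.im → S z = s z) ∧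
      ∀ z ∈ Metric.ball (x₀ : ℂ) r, z.im < 0 → S z = conj (s (conj z)) := by
  obtain ⟨G, hGc, hGd⟩ := exists_primitive_continuousOn hd hgrow
  have hconst : ∀ α ∈ Set.Icc a b, ∀ β ∈ Set.Icc a b, α ≤ β →
      (G (β : ℂ)).im = (G (α : ℂ)).im := by
    intro α hα β hβ hαβ
    have hlim : ∀ x ∈ Set.Icc a b,
        Tendsto (fun ε : ℝ => G (x + ε * Complex.I)) (𝓝[>] 0) (𝓝 (G x)) := by
      intro x hx
      have h1 : Tendsto (fun ε : ℝ => (x : ℂ) + ε * Complex.I) (𝓝[>] 0)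
          (𝓝[{z | z.re ∈ Set.Icc a b ∧ z.im ∈ Set.Icc (0 : ℝ) 1}] (x : ℂ)) := by
        refine tendsto_nhdsWithin_iff.2 ⟨?_, ?_⟩
        · have : Continuous fun ε : ℝ => (x : ℂ) + ε * Complex.I := by fun_prop
          simpa using (this.tendsto 0).mono_left nhdsWithin_le_nhds
        · filter_upwards [Ioo_mem_nhdsGT one_pos] with ε hε
          simpa using ⟨hx, hε.1.le, hε.2.le⟩
      exact (hGc x (by simpa using hx)).tendsto.comp h1
    have h2 : Tendsto (fun ε : ℝ => (G (β + ε * Complex.I)).im - (G (α + ε * Complex.I)).im)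
        (𝓝[>] 0) (𝓝 ((G β).im - (G α).im)) :=
      ((Complex.continuous_im.tendsto _).comp (hlim β hβ)).sub
        ((Complex.continuous_im.tendsto _).comp (hlim α hα))
    have h3 := (hint α hα β hβ hαβ).congr' (f₂ := fun ε : ℝ =>
        (G (β + ε * Complex.I)).im - (G (α + ε * Complex.I)).im) (by
      filter_upwards [self_mem_nhdsWithin] with ε hε
      have hε' : 0 < ε := hε
      have hc : Continuous fun x : ℝ => s (x + ε * Complex.I) :=
        continuousOn_univ.1 (hd.continuousOn.comp (by fun_prop) (fun x _ => by simpa using hε'))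
      have hder : ∀ x ∈ Set.uIcc α β, HasDerivAt (fun x : ℝ => (G (x + ε * Complex.I)).im)
          (s (x + ε * Complex.I)).im x := by
        intro x _
        have h1 := hGd (x + ε * Complex.I) (by simpa using hε')
        have h2 : HasDerivAt (fun x : ℝ => (x : ℂ) + ε * Complex.I) 1 x := by
          simpa using (Complex.ofRealCLM.hasDerivAt (x := x)).add_const (ε * Complex.I)
        have h3 := h1.scomp x h2
        rw [one_smul] at h3
        exact Complex.imCLM.hasFDerivAt.comp_hasDerivAt x h3
      exact intervalIntegral.integral_eq_sub_of_hasDerivAt hder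
        ((Complex.continuous_im.comp hc).intervalIntegrable _ _))
    exact sub_eq_zero.1 (tendsto_nhds_unique h2 h3)
  have hballmem : ∀ z ∈ Metric.ball (x₀ : ℂ) r, z.re ∈ Set.Icc a b ∧ |z.im| ≤ 1 := by
    intro z hz
    rw [Metric.mem_ball, dist_eq_norm] at hz
    have h1 := abs_le.1 (Complex.abs_re_le_norm (z - x₀))
    have h2 := Complex.abs_im_le_norm (z - x₀)
    simp only [Complex.sub_re, Complex.sub_im, Complex.ofReal_re, Complex.ofReal_im,
      sub_zero] at h1 h2
    exact ⟨⟨by linarith, by linarith⟩, by linarith⟩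
  have hx₀ : x₀ ∈ Set.Icc a b := ⟨by linarith, by linarith⟩
  set g : ℂ → ℂ := fun z => G z - G x₀ with hg
  have hgd : ∀ z : ℂ, 0 < z.im → HasDerivAt g (s z) z := fun z hz => (hGd z hz).sub_const _
  have hΓ := differentiableOn_reflect (g := g) (c := x₀) (r := r)
    ((hGc.sub continuousOn_const).mono fun z hz =>
      ⟨(hballmem z hz.1).1, hz.2, (abs_le.1 (hballmem z hz.1).2).2⟩)
    (fun z hz => (hgd z hz.2).differentiableAt.differentiableWithinAt)
    (fun z hz hz0 => by
      have hz' : z = (z.re : ℂ) := by apply Complex.ext <;> simp [hz0]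
      rw [hg, hz']
      simp only [Complex.sub_im, sub_eq_zero]
      rcases le_total x₀ z.re with h | h
      · exact hconst _ hx₀ _ (hballmem z hz).1 h
      · exact (hconst _ (hballmem z hz).1 _ hx₀ h).symm)
  refine ⟨_, hΓ.deriv Metric.isOpen_ball, fun z _ hz0 => ?_, fun z _ hz0 => ?_⟩
  · refine ((hgd z hz0).congr_of_eventuallyEq ?_).deriv
    filter_upwards [(isOpen_lt continuous_const Complex.continuous_im).mem_nhds hz0] with w hw
    exact if_pos (le_of_lt hw)
  · have h1 := (hgd (conj z) (by simpa using hz0)).conj_conj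
    rw [Complex.conj_conj] at h1
    refine (h1.congr_of_eventuallyEq ?_).deriv
    filter_upwards [(isOpen_lt Complex.continuous_im continuous_const).mem_nhds hz0] with w hw
    exact if_neg (not_le.2 hw)

/-- A holomorphic function near `x₀` that extends a function with positive real part by reflection
takes positive real values on the real line. -/
lemma re_pos_im_eq_zero_of_reflect {s S : ℂ → ℂ} {x₀ r : ℝ} (hs : ∀ z : ℂ, 0 < z.im → 0 < (s z).re)
    (hd : DifferentiableOn ℂ S (Metric.ball (x₀ : ℂ) r))
    (hup : ∀ z ∈ Metric.ball (x₀ : ℂ) r, 0 < z.im → S z = s z)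
    (hlow : ∀ z ∈ Metric.ball (x₀ : ℂ) r, z.im < 0 → S z = conj (s (conj z)))
    {x : ℝ} (hx : (x : ℂ) ∈ Metric.ball (x₀ : ℂ) r) : 0 < (S x).re ∧ (S x).im = 0 := by
  have hline : ∀ y : ℝ, Tendsto (fun ε : ℝ => (y : ℂ) + ε * Complex.I) (𝓝[>] 0) (𝓝 (y : ℂ)) := by
    intro y
    have : Continuous fun ε : ℝ => (y : ℂ) + ε * Complex.I := by fun_prop
    simpa using (this.tendsto 0).mono_left nhdsWithin_le_nhds
  have hline' : Tendsto (fun ε : ℝ => conj ((x : ℂ) + ε * Complex.I)) (𝓝[>] 0) (𝓝 (x : ℂ)) := by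
    have := (Complex.continuous_conj.tendsto _).comp (hline x)
    rwa [Complex.conj_ofReal] at this
  have hball := Metric.isOpen_ball.mem_nhds hx
  have hcont : ∀ y : ℝ, (y : ℂ) ∈ Metric.ball (x₀ : ℂ) r → ContinuousAt S y := fun y hy =>
    (hd.differentiableAt (Metric.isOpen_ball.mem_nhds hy)).continuousAt
  have him : ∀ ε ∈ Set.Ioi (0 : ℝ), 0 < ((x : ℂ) + ε * Complex.I).im := fun ε hε => by
    simpa using hε
  have hpos : ∀ᶠ ε : ℝ in 𝓝[>] 0, 0 < (S (x + ε * Complex.I)).re ∧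
      S (conj (x + ε * Complex.I)) = conj (S (x + ε * Complex.I)) := by
    filter_upwards [self_mem_nhdsWithin, (hline x).eventually_mem hball, hline'.eventually_mem hball]
      with ε hε h1 h2
    have h0 := him ε hε
    rw [hup _ h1 h0, hlow _ h2 (by rw [Complex.conj_im]; linarith), Complex.conj_conj]
    exact ⟨hs _ h0, rfl⟩
  have hconj : S x = conj (S x) :=
    tendsto_nhds_unique_of_eventuallyEq ((hcont x hx).tendsto.comp hline')
      ((Complex.continuous_conj.tendsto _).comp ((hcont x hx).tendsto.comp (hline x)))
      (hpos.mono fun ε h => h.2)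
  refine ⟨?_, Complex.conj_eq_iff_im.1 hconj.symm⟩
  have hnonneg : ∀ y : ℝ, (y : ℂ) ∈ Metric.ball (x₀ : ℂ) r → 0 ≤ (S y).re := by
    intro y hy
    refine ge_of_tendsto ((Complex.continuous_re.tendsto _).comp ((hcont y hy).tendsto.comp (hline y))) ?_
    filter_upwards [self_mem_nhdsWithin, (hline y).eventually_mem (Metric.isOpen_ball.mem_nhds hy)]
      with ε hε h1
    have h0 : 0 < ((y : ℂ) + ε * Complex.I).im := by simpa using hε
    simp only [Function.comp, hup _ h1 h0]
    exact (hs _ h0).le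
  have hnonneg' : ∀ z ∈ Metric.ball (x₀ : ℂ) r, 0 ≤ (S z).re := by
    intro z hz
    rcases lt_trichotomy z.im 0 with h | h | h
    · rw [hlow z hz h, Complex.conj_re]
      exact (hs _ (by simpa using h)).le
    · have hz' : z = (z.re : ℂ) := by apply Complex.ext <;> simp [h]
      rw [hz'] at hz ⊢
      exact hnonneg _ hz
    · rw [hup z hz h]
      exact (hs z h).le
  refine (hnonneg x hx).lt_of_ne fun h0 => ?_
  have hmax : IsMaxOn (norm ∘ fun z => Complex.exp (-S z)) (Metric.ball (x₀ : ℂ) r) x := by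
    intro z hz
    simp only [Set.mem_ofPred_eq, Function.comp, Complex.norm_exp, Complex.neg_re, ← h0]
    exact Real.exp_le_exp.2 (by linarith [hnonneg' z hz])
  have heq := Complex.norm_eqOn_of_isPreconnected_of_isMaxOn
    (convex_ball (x₀ : ℂ) r).isPreconnected Metric.isOpen_ball hd.neg.cexp hx hmax
  obtain ⟨ε, hε1, hε2⟩ := (hpos.and ((hline x).eventually_mem hball)).exists
  have := heq hε2
  simp only [Function.comp, Function.const, Complex.norm_exp, Pi.neg_apply, Complex.neg_re,
    Real.exp_eq_exp] at this
  linarith [hε1.1]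

/-- Local form of the continuation theorem, for the fourth root of `-i m`. -/
lemma exists_local_fourth_root_continuation {m : ℂ → ℂ}
    (hanal : DifferentiableOn ℂ m {z : ℂ | 0 < z.im})
    (hmap : ∀ z : ℂ, 0 < z.im → 0 < (m z).im) {l₁ l₂ : ℝ}
    (hre : ∀ᵐ (l : ℝ) ∂(volume.restrict (Set.Ioo l₁ l₂)),
      Tendsto (fun ε : ℝ => (m (Complex.ofReal l + ε * Complex.I)).re) (𝓝[>] 0) (𝓝 0))
    {x₀ : ℝ} (hx₀ : x₀ ∈ Set.Ioo l₁ l₂) :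
    ∃ (S : ℂ → ℂ) (r : ℝ), 0 < r ∧ DifferentiableOn ℂ S (Metric.ball (x₀ : ℂ) r) ∧
      (∀ z ∈ Metric.ball (x₀ : ℂ) r, 0 < z.im → m z = Complex.I * S z ^ 4) ∧
      (∀ z ∈ Metric.ball (x₀ : ℂ) r, z.im < 0 → -conj (m (conj z)) = Complex.I * S z ^ 4) ∧
      ∀ x : ℝ, (x : ℂ) ∈ Metric.ball (x₀ : ℂ) r → 0 < (S x).re ∧ (S x).im = 0 := by
  set U : Set ℂ := {z : ℂ | 0 < z.im} with hU
  have hpd : DifferentiableOn ℂ (fun z => -Complex.I * m z) U := hanal.const_mul _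
  have hpre : ∀ z : ℂ, (-Complex.I * m z).re = (m z).im := fun z => by simp
  have hpim : ∀ z : ℂ, (-Complex.I * m z).im = -(m z).re := fun z => by simp
  have hppos : ∀ z ∈ U, 0 < (-Complex.I * m z).re := fun z hz => (hpre z).symm ▸ hmap z hz
  obtain ⟨s, hsd, hs⟩ := exists_fourth_root hpd hppos
  obtain ⟨r, hr, hr1, hra, hrb⟩ : ∃ r : ℝ, 0 < r ∧ r ≤ 1 ∧ l₁ < x₀ - r ∧ x₀ + r < l₂ := by
    have h1 : 0 < min 1 (min (x₀ - l₁) (l₂ - x₀)) := by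
      simp only [lt_min_iff, sub_pos]; exact ⟨one_pos, hx₀⟩
    refine ⟨min 1 (min (x₀ - l₁) (l₂ - x₀)) / 2, by positivity, ?_, ?_, ?_⟩
    · linarith [min_le_left 1 (min (x₀ - l₁) (l₂ - x₀))]
    · linarith [(min_le_right 1 (min (x₀ - l₁) (l₂ - x₀))).trans (min_le_left _ _)]
    · linarith [(min_le_right 1 (min (x₀ - l₁) (l₂ - x₀))).trans (min_le_right _ _)]
  obtain ⟨C, hC0, hC⟩ := exists_norm_le_div_im hpd (fun z hz => (hppos z hz).le) (x₀ - r) (x₀ + r)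
  have hgrow : ∀ x ∈ Set.Icc (x₀ - r) (x₀ + r), ∀ y ∈ Set.Ioc (0 : ℝ) 2,
      ‖s (x + y * Complex.I)‖ ≤ C ^ (1 / 4 : ℝ) * y ^ (-(1 / 4) : ℝ) := by
    intro x hx y hy
    have h1 := hC x hx y hy
    rw [← (hs _ (by simpa [hU] using hy.1)).1, norm_pow] at h1
    have h2 := Real.rpow_le_rpow (by positivity) h1 (show (0 : ℝ) ≤ 1 / 4 by norm_num)
    rw [← Real.rpow_natCast, ← Real.rpow_mul (norm_nonneg _), Real.div_rpow hC0 hy.1.le] at h2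
    rw [Real.rpow_neg hy.1.le, ← div_eq_mul_inv]
    simpa using h2
  have hgrow2 : ∀ x ∈ Set.Icc (x₀ - r) (x₀ + r), ∀ y ∈ Set.Ioc (0 : ℝ) 2,
      ‖s (x + y * Complex.I) ^ 2‖ ≤ (C ^ (1 / 4 : ℝ)) ^ 2 * y ^ (-(1 / 2) : ℝ) := by
    intro x hx y hy
    have h1 := pow_le_pow_left₀ (norm_nonneg _) (hgrow x hx y hy) 2
    rw [norm_pow]
    refine h1.trans (le_of_eq ?_)
    rw [mul_pow, ← Real.rpow_natCast (y ^ _), ← Real.rpow_mul hy.1.le]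
    norm_num
  have hsq : ∀ z ∈ U, 0 < ((s z ^ 2) ^ 2).re := fun z hz => by
    rw [← pow_mul, (hs z hz).1]; exact hppos z hz
  have him4 : ∀ z ∈ U, (s z).im ^ 4 ≤ |(m z).re| := by
    intro z hz
    have h1 := Complex.im_sq_le_abs_im_sq (hs z hz).2.1 (hs z hz).2.2
    have h2 := Complex.im_sq_le_abs_im_sq (hs z hz).2.2 (hsq z hz)
    rw [← pow_mul, (hs z hz).1, hpim, abs_neg] at h2
    calc (s z).im ^ 4 = ((s z).im ^ 2) ^ 2 := by ring
      _ ≤ |(s z ^ 2).im| ^ 2 := by gcongr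
      _ = (s z ^ 2).im ^ 2 := sq_abs _
      _ ≤ _ := h2
  have hint : ∀ α ∈ Set.Icc (x₀ - r) (x₀ + r), ∀ β ∈ Set.Icc (x₀ - r) (x₀ + r), α ≤ β →
      Tendsto (fun ε : ℝ => ∫ x in α..β, (s (x + ε * Complex.I)).im) (𝓝[>] 0) (𝓝 0) := by
    intro α hα β hβ hαβ
    have hsc : ∀ ε : ℝ, 0 < ε → Continuous fun x : ℝ => s (x + ε * Complex.I) := fun ε hε =>
      continuousOn_univ.1 (hsd.continuousOn.comp (by fun_prop) (fun x _ => by simpa [hU] using hε))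
    obtain ⟨B, hB⟩ := exists_integral_norm_le_s19 (h := fun z => s z ^ 2) (hsd.pow 2)
      (fun z hz => Complex.norm_le_two_mul_re (hs z hz).2.2 (hsq z hz)) hαβ
      (fun x hx => hgrow2 x ⟨hα.1.trans hx.1, hx.2.trans hβ.2⟩)
    refine tendsto_integral_zero_of_sq_bounded (B := B) hαβ
      (fun ε hε => Complex.continuous_im.comp (hsc ε hε)) (fun ε hε => ?_) ?_
    · refine (intervalIntegral.integral_mono_on hαβ ?_ ?_ fun x _ => ?_).trans (hB ε hε)
      · exact ((Complex.continuous_im.comp (hsc ε hε.1)).pow 2).intervalIntegrable _ _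
      · exact ((hsc ε hε.1).pow 2).norm.intervalIntegrable _ _
      · rw [norm_pow, ← sq_abs]
        gcongr
        exact Complex.abs_im_le_norm _
    · filter_upwards [(ae_restrict_iff' measurableSet_Ioo).1 hre] with x hx hxI
      rw [Set.uIoc_of_le hαβ] at hxI
      have h1 := (hx ⟨by linarith [hxI.1, hα.1], by linarith [hxI.2, hβ.2]⟩).abs
      rw [abs_zero] at h1
      have h4 : Tendsto (fun ε : ℝ => (s (x + ε * Complex.I)).im ^ 4) (𝓝[>] 0) (𝓝 0) := by
        refine squeeze_zero' (Eventually.of_forall fun ε => by positivity) ?_ h1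
        filter_upwards [self_mem_nhdsWithin] with ε hε
        exact him4 _ (by simpa [hU] using hε)
      have h5 := h4.sqrt.sqrt
      rw [Real.sqrt_zero, Real.sqrt_zero] at h5
      refine (tendsto_zero_iff_abs_tendsto_zero _).2 (h5.congr fun ε => ?_)
      rw [show (s (x + ε * Complex.I)).im ^ 4 = ((s (x + ε * Complex.I)).im ^ 2) ^ 2 by ring,
        Real.sqrt_sq (sq_nonneg _), Real.sqrt_sq_eq_abs]
      rfl
  obtain ⟨S, hSd, hSu, hSl⟩ := exists_reflect_of_tendsto_integral_im hsd hgrow hint hr hr1 le_rfl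
    le_rfl
  have hm : ∀ z ∈ U, m z = Complex.I * s z ^ 4 := fun z hz => by
    rw [(hs z hz).1, ← mul_assoc, mul_neg, Complex.I_mul_I, neg_neg, one_mul]
  refine ⟨S, r, hr, hSd, fun z hz h0 => ?_, fun z hz h0 => ?_, fun x hx =>
    re_pos_im_eq_zero_of_reflect (fun z hz => (hs z hz).2.1) hSd hSu hSl hx⟩
  · rw [hSu z hz h0, hm z h0]
  · rw [hSl z hz h0, hm (conj z) (by simpa [hU] using h0), map_mul, Complex.conj_I, map_pow]
    ring

/-- Kotani's lemma: if `m` is a Herglotz function whose real part has normal limit `0` at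
a.e. `λ ∈ (λ₁, λ₂)`, then `m` extends analytically through `(λ₁, λ₂)` to
`Ω = ℂ ∖ ((-∞,λ₁] ∪ [λ₂,∞))`, the extension satisfies `F(z) = -conj(F(conj z))` on `Ω`,
and on `(λ₁, λ₂)` one has `Re F = 0` and `Im F > 0`. -/
theorem kotani_reflectionless_continuation
    (m : ℂ → ℂ)
    (hanal : DifferentiableOn ℂ m {z : ℂ | 0 < z.im})
    (hmap : ∀ z : ℂ, 0 < z.im → 0 < (m z).im)
    (l₁ l₂ : ℝ) (hl : l₁ < l₂)
    (hre : ∀ᵐ (l : ℝ) ∂(volume.restrict (Set.Ioo l₁ l₂)),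
      Tendsto (fun ε : ℝ => (m (Complex.ofReal l + ε * Complex.I)).re) (𝓝[>] 0) (𝓝 0)) :
    ∃ F : ℂ → ℂ,
      DifferentiableOn ℂ F ({z : ℂ | z.im ≠ 0} ∪ {z : ℂ | l₁ < z.re ∧ z.re < l₂}) ∧
      (∀ z : ℂ, 0 < z.im → F z = m z) ∧
      (∀ z ∈ ({z : ℂ | z.im ≠ 0} ∪ {z : ℂ | l₁ < z.re ∧ z.re < l₂}),
        F z = -conj (F (conj z))) ∧
      ∀ l : ℝ, l₁ < l → l < l₂ → (F (l : ℂ)).re = 0 ∧ 0 < (F (l : ℂ)).im := by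
  set V : Set ℂ := {z : ℂ | 0 < z.im} with hV
  set F : ℂ → ℂ := fun z => if 0 < z.im then m z else if z.im < 0 then -conj (m (conj z))
    else limUnder (𝓝[V] z) m with hF
  have hFu : ∀ z : ℂ, 0 < z.im → F z = m z := fun z hz => if_pos hz
  have hFl : ∀ z : ℂ, z.im < 0 → F z = -conj (m (conj z)) := fun z hz => by
    simp only [hF, if_neg (not_lt.2 hz.le), if_pos hz]
  have hopen : IsOpen V := isOpen_lt continuous_const Complex.continuous_im
  have hloc : ∀ x₀ : ℝ, x₀ ∈ Set.Ioo l₁ l₂ → DifferentiableAt ℂ F x₀ ∧ (F x₀).re = 0 ∧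
      0 < (F x₀).im := by
    intro x₀ hx₀
    obtain ⟨S, r, hr, hSd, hSu, hSl, hSr⟩ :=
      exists_local_fourth_root_continuation hanal hmap hre hx₀
    have heq : ∀ z ∈ Metric.ball (x₀ : ℂ) r, F z = Complex.I * S z ^ 4 := by
      intro z hz
      rcases lt_trichotomy z.im 0 with h | h | h
      · rw [hFl z h, hSl z hz h]
      · simp only [hF, h, lt_irrefl, if_false]
        have hnhds := Metric.isOpen_ball.mem_nhds hz
        have : (𝓝[V] z).NeBot := by
          rw [← mem_closure_iff_nhdsWithin_neBot, hV, Complex.closure_setOfPred_lt_im]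
          exact h.ge
        refine Tendsto.limUnder_eq ?_
        have hc : Tendsto (fun w => Complex.I * S w ^ 4) (𝓝[V] z) (𝓝 (Complex.I * S z ^ 4)) :=
          ((continuousAt_const.mul ((hSd.differentiableAt hnhds).continuousAt.pow 4)).tendsto).mono_left
            nhdsWithin_le_nhds
        refine hc.congr' ?_
        filter_upwards [self_mem_nhdsWithin, nhdsWithin_le_nhds hnhds] with w hw hw2
        exact (hSu w hw2 hw).symm
      · rw [hFu z h, hSu z hz h]
    have hx₀b : (x₀ : ℂ) ∈ Metric.ball (x₀ : ℂ) r := Metric.mem_ball_self hr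
    have hnhds := Metric.isOpen_ball.mem_nhds hx₀b
    refine ⟨?_, ?_⟩
    · refine DifferentiableAt.congr_of_eventuallyEq
        (((hSd.differentiableAt hnhds).pow 4).const_mul Complex.I) ?_
      filter_upwards [hnhds] with z hz using heq z hz
    · obtain ⟨h1, h2⟩ := hSr x₀ hx₀b
      have hS : S x₀ = ((S x₀).re : ℂ) := by apply Complex.ext <;> simp [h2]
      rw [heq _ hx₀b, hS, ← Complex.ofReal_pow]
      simp only [Complex.re_mul_ofReal, Complex.im_mul_ofReal, Complex.I_re, Complex.I_im]
      exact ⟨by ring, by positivity⟩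
  have hreal : ∀ z : ℂ, z.im = 0 → z = (z.re : ℂ) := fun z hz => by
    apply Complex.ext <;> simp [hz]
  refine ⟨F, ?_, hFu, ?_, fun l h1 h2 => (hloc l ⟨h1, h2⟩).2⟩
  · intro z hz
    apply DifferentiableAt.differentiableWithinAt
    rcases lt_trichotomy z.im 0 with h | h | h
    · have h1 := (hanal.differentiableAt (x := conj z)
        (hopen.mem_nhds (by simpa [hV] using h))).hasDerivAt.conj_conj.differentiableAt
      rw [Complex.conj_conj] at h1
      refine h1.neg.congr_of_eventuallyEq ?_
      filter_upwards [(isOpen_lt Complex.continuous_im continuous_const).mem_nhds h] with w hw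
      exact hFl w hw
    · have hz' : l₁ < z.re ∧ z.re < l₂ := hz.resolve_left fun h' => h' h
      rw [hreal z h]
      exact (hloc z.re hz').1
    · refine (hanal.differentiableAt (hopen.mem_nhds h)).congr_of_eventuallyEq ?_
      filter_upwards [hopen.mem_nhds h] with w hw using hFu w hw
  · intro z hz
    rcases lt_trichotomy z.im 0 with h | h | h
    · rw [hFl z h, hFu (conj z) (by simpa using h)]
    · have hz' : l₁ < z.re ∧ z.re < l₂ := hz.resolve_left fun h' => h' h
      rw [Complex.conj_eq_iff_im.2 h, hreal z h]
      have h1 := (hloc z.re hz').2.1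
      apply Complex.ext <;> simp [h1]
    · rw [hFu z h, hFl (conj z) (by simpa using h)]
      simp
end
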